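/- Let n > 1 be an integer. There exist constants c = c(n) and κ = κ(n) such that for every irreducible polynomial f ∈ ℚ[x₁,…,x_n] of degree d > 0 defining the hypersurface X ⊆ 𝔸ⁿ_ℚ, and every real H > 2, one has #X(ℤ,H) ≤ c·d²·H^{n−2+1/d}·(log H)^κ. -/

import Mathlib

namespace BombieriPila

open MvPolynomial

/-- The exponents of total degree at most `N - t`. -/
def expSet (σ : Type*) (N t : ℕ) : Set (σ →₀ ℕ) := {a | a.degree + t ≤ N}

theorem expSet_finite {σ : Type*} [Finite σ] (N t : ℕ) : (expSet σ N t).Finite := by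
  refine (Finsupp.finite_of_degree_le (σ := σ) N).subset fun a ha => ?_
  have : a.degree + t ≤ N := ha
  show a.degree ≤ N
  omega

theorem mem_restrictSupport_expSet {σ R : Type*} [CommSemiring R] {N t : ℕ}
    {p : MvPolynomial σ R} (hp : p ≠ 0) :
    p ∈ restrictSupport R (expSet σ N t) ↔ p.totalDegree + t ≤ N := by
  rw [mem_restrictSupport_iff]
  constructor
  · intro h
    obtain ⟨a, ha, hda⟩ := Finset.exists_mem_eq_sup p.support (support_nonempty.mpr hp)
      (fun s => s.sum fun _ e => e)
    have h1 : a.degree + t ≤ N := h ha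
    have : p.totalDegree = a.degree := hda
    omega
  · intro h a ha
    have := le_totalDegree ha
    show a.degree + t ≤ N
    have h2 : a.degree = a.sum fun _ e => e := rfl
    omega

theorem ncard_expSet_eq_ncard_ge {σ : Type*} [Finite σ] (N : ℕ) (b : σ →₀ ℕ) :
    (expSet σ N b.degree).ncard = {a : σ →₀ ℕ | a.degree ≤ N ∧ b ≤ a}.ncard := by
  have : {a : σ →₀ ℕ | a.degree ≤ N ∧ b ≤ a} = (fun a => a + b) '' expSet σ N b.degree := by
    ext a
    constructor
    · rintro ⟨h1, h2⟩
      refine ⟨a - b, ?_, tsub_add_cancel_of_le h2⟩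
      show (a - b).degree + b.degree ≤ N
      rw [← map_add, tsub_add_cancel_of_le h2]
      exact h1
    · rintro ⟨c, hc, rfl⟩
      refine ⟨?_, le_add_self⟩
      have : c.degree + b.degree ≤ N := hc
      simpa using this
  rw [this, Set.ncard_image_of_injective _ (add_left_injective b)]

theorem ncard_expSet {σ : Type*} [Finite σ] {i j : σ} (hij : i ≠ j) (N d e : ℕ) :
    (expSet σ N 0).ncard + (expSet σ N (d + e)).ncard =
      {a : σ →₀ ℕ | a.degree ≤ N ∧ a i < d ∧ a j < e}.ncard
        + ((expSet σ N d).ncard + (expSet σ N e).ncard) := by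
  classical
  have key : ∀ t : ℕ, ∀ l : σ, (expSet σ N t).ncard
      = {a : σ →₀ ℕ | a.degree ≤ N ∧ t ≤ a l}.ncard := by
    intro t l
    have := ncard_expSet_eq_ncard_ge N (Finsupp.single l t)
    simpa using this
  have key2 : (expSet σ N (d + e)).ncard
      = {a : σ →₀ ℕ | a.degree ≤ N ∧ d ≤ a i ∧ e ≤ a j}.ncard := by
    have := ncard_expSet_eq_ncard_ge N (Finsupp.single i d + Finsupp.single j e)
    rw [map_add, Finsupp.degree_single, Finsupp.degree_single] at this
    rw [this]
    congr 1
    ext a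
    simp only [Set.mem_ofPred_eq, and_congr_right_iff]
    intro _
    constructor
    · intro h
      have h1 := h i
      have h2 := h j
      simp [hij, hij.symm] at h1 h2
      exact ⟨h1, h2⟩
    · rintro ⟨h1, h2⟩ l
      by_cases hi : l = i
      · subst hi; simpa [hij, hij.symm] using h1
      · by_cases hj : l = j
        · subst hj; simpa [hij, hij.symm] using h2
        · simp [Ne.symm hi, Ne.symm hj]
  rw [key2, key d i, key e j]
  have hfin : ∀ S : Set (σ →₀ ℕ), (S ⊆ {a | a.degree ≤ N}) → S.Finite := fun S hS =>
    (Finsupp.finite_of_degree_le N).subset hS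
  set A : Set (σ →₀ ℕ) := {a | a.degree ≤ N ∧ d ≤ a i} with hA
  set B : Set (σ →₀ ℕ) := {a | a.degree ≤ N ∧ e ≤ a j} with hB
  have hAf : A.Finite := hfin _ fun a h => h.1
  have hBf : B.Finite := hfin _ fun a h => h.1
  have h1 := Set.ncard_union_add_ncard_inter A B hAf hBf
  have h2 : A ∩ B = {a : σ →₀ ℕ | a.degree ≤ N ∧ d ≤ a i ∧ e ≤ a j} := by
    ext a; simp only [hA, hB, Set.mem_inter_iff, Set.mem_ofPred_eq]; tauto
  have h3 : expSet σ N 0 = {a : σ →₀ ℕ | a.degree ≤ N ∧ a i < d ∧ a j < e} ∪ (A ∪ B) := by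
    ext a
    simp only [hA, hB, expSet, Set.mem_union, Set.mem_ofPred_eq, add_zero]
    by_cases h1 : a i < d <;> by_cases h2 : a j < e <;> grind
  rw [← h2, h3, Set.ncard_union_eq ?_ (hfin _ fun a h => h.1) (hAf.union hBf)]
  · omega
  · rw [Set.disjoint_left]
    rintro a ⟨_, h1, h2⟩ (h | h)
    · exact absurd h.2 (by omega)
    · exact absurd h.2 (by omega)

theorem ncard_exponents_le {σ : Type*} [Fintype σ] [DecidableEq σ] {i j : σ} (hij : i ≠ j)
    (N d e : ℕ) :
    {a : σ →₀ ℕ | a.degree ≤ N ∧ a i < d ∧ a j < e}.ncard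
      ≤ d * e * (N + 1) ^ (Fintype.card σ - 2) := by
  set S := {a : σ →₀ ℕ | a.degree ≤ N ∧ a i < d ∧ a j < e} with hS
  have hle : ∀ a ∈ S, ∀ l, a l < N + 1 := fun a ha l =>
    Nat.lt_succ_of_le ((Finsupp.le_degree l a).trans ha.1)
  let φ : S → Fin d × Fin e × ({l // l ≠ i ∧ l ≠ j} → Fin (N + 1)) := fun a =>
    (⟨a.1 i, a.2.2.1⟩, ⟨a.1 j, a.2.2.2⟩, fun l => ⟨a.1 l.1, hle a.1 a.2 l.1⟩)
  have hφ : Function.Injective φ := by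
    intro a b hab
    simp only [φ, Prod.mk.injEq, Fin.mk.injEq] at hab
    obtain ⟨h1, h2, h3⟩ := hab
    ext l
    by_cases hi : l = i
    · subst hi; exact h1
    by_cases hj : l = j
    · subst hj; exact h2
    have := congrFun h3 ⟨l, hi, hj⟩
    simpa using this
  have := Nat.card_le_card_of_injective φ hφ
  rw [Nat.card_coe_set_eq] at this
  refine this.trans (le_of_eq ?_)
  have hc : Fintype.card {l // l ≠ i ∧ l ≠ j} = Fintype.card σ - 2 := by
    rw [Fintype.card_subtype]
    have : (Finset.univ.filter fun l => l ≠ i ∧ l ≠ j) = Finset.univ \ {i, j} := by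
      ext l; simp
    rw [this, Finset.card_sdiff_of_subset (Finset.subset_univ _), Finset.card_pair hij]
    rfl
  rw [Nat.card_prod, Nat.card_prod, Nat.card_fun]
  simp only [Nat.card_eq_fintype_card, Fintype.card_fin, hc]
  ring

/-- Bezout's theorem by counting dimensions: the image of the polynomials of degree at most `N`
under a linear map killing the multiples of `f` and `g` is small. -/
theorem finrank_range_le_of_isRelPrime {σ k W : Type*} [Field k] [Fintype σ] [DecidableEq σ]
    [AddCommGroup W] [Module k W] {i j : σ} (hij : i ≠ j) {f g : MvPolynomial σ k}
    (hf : f ≠ 0) (hg : g ≠ 0) (hrel : IsRelPrime f g) (N : ℕ)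
    (L : MvPolynomial σ k →ₗ[k] W) (hLf : ∀ p, L (f * p) = 0) (hLg : ∀ p, L (g * p) = 0) :
    Module.finrank k (LinearMap.range (L.domRestrict (restrictSupport k (expSet σ N 0))))
      ≤ f.totalDegree * g.totalDegree * (N + 1) ^ (Fintype.card σ - 2) := by
  refine le_trans ?_ (ncard_exponents_le hij N _ _)
  set d := f.totalDegree with hd
  set e := g.totalDegree with he
  let P : ℕ → Submodule k (MvPolynomial σ k) := fun t => restrictSupport k (expSet σ N t)
  have hPfin : ∀ t, Module.Finite k (P t) := fun t => by
    have : Finite (expSet σ N t) := (expSet_finite N t).to_subtype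
    exact Module.Finite.of_basis (basisRestrictSupport k (expSet σ N t))
  have hPrank : ∀ t, Module.finrank k (P t) = (expSet σ N t).ncard := fun t => by
    rw [Module.finrank_eq_nat_card_basis (basisRestrictSupport k (expSet σ N t)),
      Nat.card_coe_set_eq]
  let mulL : MvPolynomial σ k → MvPolynomial σ k →ₗ[k] MvPolynomial σ k := fun h =>
    LinearMap.mulLeft k h
  have hinj : ∀ h : MvPolynomial σ k, h ≠ 0 → Function.Injective (mulL h) := fun h hh =>
    fun a b hab => mul_left_cancel₀ hh hab
  have hUrank : ∀ h : MvPolynomial σ k, h ≠ 0 → ∀ t,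
      Module.finrank k ((P t).map (mulL h)) = (expSet σ N t).ncard := fun h hh t => by
    rw [← hPrank t]
    exact (Submodule.equivMapOfInjective _ (hinj h hh) _).finrank_eq.symm
  have hUle : ∀ h : MvPolynomial σ k, h ≠ 0 → (P h.totalDegree).map (mulL h) ≤ P 0 := by
    rintro h hh _ ⟨p, hp, rfl⟩
    rcases eq_or_ne p 0 with rfl | hp0
    · simp
    · have h1 := (mem_restrictSupport_expSet hp0).mp hp
      refine (mem_restrictSupport_expSet (mul_ne_zero hh hp0)).mpr ?_
      rw [totalDegree_mul_of_isDomain hh hp0]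
      omega
  set U1 := (P d).map (mulL f) with hU1
  set U2 := (P e).map (mulL g) with hU2
  have hinf : U1 ⊓ U2 ≤ (P (d + e)).map (mulL (f * g)) := by
    rintro h ⟨⟨p, hp, hph⟩, ⟨q, hq, hqh⟩⟩
    rcases eq_or_ne h 0 with rfl | hh
    · exact Submodule.zero_mem _
    have hpq : f * p = g * q := hph.trans hqh.symm
    have hfq : f ∣ q := hrel.dvd_of_dvd_mul_left ⟨p, hpq.symm⟩
    obtain ⟨r, rfl⟩ := hfq
    have hqh' : g * (f * r) = h := hqh
    have hr : r ≠ 0 := by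
      rintro rfl
      exact hh (by rw [← hqh']; ring)
    refine ⟨r, (mem_restrictSupport_expSet hr).mpr ?_, ?_⟩
    · have := (mem_restrictSupport_expSet (mul_ne_zero hf hr)).mp hq
      rw [totalDegree_mul_of_isDomain hf hr] at this
      omega
    · show f * g * r = h
      rw [← hqh']; ring
  have hfin0 := hPfin 0
  have hfind := hPfin d
  have hfine := hPfin e
  have hfinde := hPfin (d + e)
  have hdim := Submodule.finrank_sup_add_finrank_inf_eq U1 U2
  rw [hUrank f hf, hUrank g hg] at hdim
  have hinf' := (Submodule.finrank_mono hinf).trans_eq (hUrank (f * g) (mul_ne_zero hf hg) _)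
  have hker : U1 ⊔ U2 ≤ (LinearMap.ker (L.domRestrict (P 0))).map (P 0).subtype := by
    refine sup_le ?_ ?_
    · intro h hh
      refine ⟨⟨h, hUle f hf hh⟩, ?_, rfl⟩
      obtain ⟨p, -, rfl⟩ := hh
      exact hLf p
    · intro h hh
      refine ⟨⟨h, hUle g hg hh⟩, ?_, rfl⟩
      obtain ⟨p, -, rfl⟩ := hh
      exact hLg p
  have hker' := Submodule.finrank_mono hker
  rw [Submodule.finrank_map_subtype_eq] at hker'
  have hrn := LinearMap.finrank_range_add_finrank_ker (L.domRestrict (P 0))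
  rw [hPrank 0] at hrn
  have := ncard_expSet hij N d e
  change Module.finrank k (LinearMap.range (L.domRestrict (P 0))) ≤ _
  omega

theorem finrank_le_of_isRelPrime {σ k W : Type*} [Field k] [Fintype σ] [DecidableEq σ]
    [AddCommGroup W] [Module k W] {i j : σ} (hij : i ≠ j) {f g : MvPolynomial σ k}
    (hf : f ≠ 0) (hg : g ≠ 0) (hrel : IsRelPrime f g) (N : ℕ)
    (L : MvPolynomial σ k →ₗ[k] W) (hL : ∀ w, ∃ p, p.totalDegree ≤ N ∧ L p = w)
    (hLf : ∀ p, L (f * p) = 0) (hLg : ∀ p, L (g * p) = 0) :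
    Module.finrank k W ≤ f.totalDegree * g.totalDegree * (N + 1) ^ (Fintype.card σ - 2) := by
  have h := finrank_range_le_of_isRelPrime hij hf hg hrel N L hLf hLg
  have hrange : LinearMap.range (L.domRestrict (restrictSupport k (expSet σ N 0))) = ⊤ := by
    rw [LinearMap.range_eq_top]
    intro w
    obtain ⟨p, hp, hpw⟩ := hL w
    rcases eq_or_ne p 0 with rfl | hp0
    · exact ⟨0, by rw [map_zero, ← hpw, map_zero]⟩
    · exact ⟨⟨p, (mem_restrictSupport_expSet hp0).mpr (by omega)⟩, hpw⟩
  rwa [hrange, finrank_top] at h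

/-- The integer points of the box of radius `R`. -/
noncomputable def box (σ : Type*) [Fintype σ] [DecidableEq σ] (R : ℕ) : Finset (σ → ℤ) :=
  Fintype.piFinset fun _ => Finset.Icc (-(R : ℤ)) R

theorem exists_eval_box {σ : Type*} [Fintype σ] [DecidableEq σ] (R : ℕ)
    {S : Finset (σ → ℤ)} (hS : S ⊆ box σ R) (w : S → ℚ) :
    ∃ p : MvPolynomial σ ℚ, p.totalDegree ≤ Fintype.card σ * (2 * R) ∧
      ∀ z : S, eval (fun i => (z.1 i : ℚ)) p = w z := by
  let ℓ : (σ → ℤ) → MvPolynomial σ ℚ := fun z =>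
    ∏ i, ∏ t ∈ (Finset.Icc (-(R : ℤ)) R).erase (z i), (X i - C (t : ℚ))
  have hℓdeg : ∀ z ∈ S, (ℓ z).totalDegree ≤ Fintype.card σ * (2 * R) := by
    intro z hz
    have hz' := Fintype.mem_piFinset.mp (hS hz)
    refine (totalDegree_finsetProd _ _).trans ?_
    refine (Finset.sum_le_card_nsmul _ _ (2 * R) fun i _ => ?_).trans_eq (by simp)
    refine (totalDegree_finsetProd _ _).trans ?_
    refine (Finset.sum_le_card_nsmul _ _ 1 fun t _ => ?_).trans_eq ?_
    · refine (totalDegree_sub_C_le _ _).trans ?_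
      simp [totalDegree_X]
    · rw [Finset.card_erase_of_mem (hz' i), Int.card_Icc]
      simp; omega
  have hℓ0 : ∀ z ∈ S, ∀ z' : σ → ℤ, z ≠ z' → eval (fun i => (z i : ℚ)) (ℓ z') = 0 := by
    intro z hz z' hne
    have hz' := Fintype.mem_piFinset.mp (hS hz)
    obtain ⟨i, hi⟩ := Function.ne_iff.mp hne
    rw [map_prod]
    refine Finset.prod_eq_zero (Finset.mem_univ i) ?_
    rw [map_prod]
    exact Finset.prod_eq_zero (Finset.mem_erase.mpr ⟨hi, hz' i⟩) (by simp)
  have hℓ1 : ∀ z : σ → ℤ, eval (fun i => (z i : ℚ)) (ℓ z) ≠ 0 := by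
    intro z
    simp only [ℓ, map_prod, map_sub, eval_X, eval_C]
    refine Finset.prod_ne_zero_iff.mpr fun i _ => Finset.prod_ne_zero_iff.mpr fun t ht => ?_
    have := (Finset.mem_erase.mp ht).1
    rw [sub_ne_zero]
    exact_mod_cast this.symm
  refine ⟨∑ z : S, C (w z / eval (fun i => (z.1 i : ℚ)) (ℓ z)) * ℓ z, ?_, ?_⟩
  · refine totalDegree_finsetSum_le fun z _ => ?_
    refine (totalDegree_mul _ _).trans ?_
    rw [totalDegree_C, zero_add]
    exact hℓdeg z z.2
  · intro z
    rw [map_sum, Finset.sum_eq_single z]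
    · simp [hℓ1]
    · intro z' _ hne
      rw [map_mul, hℓ0 z z.2 z' fun h => hne (Subtype.ext h.symm), mul_zero]
    · simp

/-- Two polynomials without common factor have few common integer zeros in a box. -/
theorem card_common_zeros_le {σ : Type*} [Fintype σ] [DecidableEq σ] {i j : σ} (hij : i ≠ j)
    {f g : MvPolynomial σ ℚ} (hf : f ≠ 0) (hg : g ≠ 0) (hrel : IsRelPrime f g) {R : ℕ}
    {S : Finset (σ → ℤ)} (hS : S ⊆ box σ R) (hSf : ∀ z ∈ S, eval (fun i => (z i : ℚ)) f = 0)
    (hSg : ∀ z ∈ S, eval (fun i => (z i : ℚ)) g = 0) :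
    S.card ≤ f.totalDegree * g.totalDegree
        * (Fintype.card σ * (2 * R) + 1) ^ (Fintype.card σ - 2) := by
  obtain ⟨L, hLapp⟩ : ∃ L : MvPolynomial σ ℚ →ₗ[ℚ] (S → ℚ),
      ∀ p z, L p z = eval (fun i => (z.1 i : ℚ)) p :=
    ⟨LinearMap.pi fun z => (aeval (R := ℚ) fun i => (z.1 i : ℚ)).toLinearMap, fun p z => by
      simp [aeval_eq_eval]⟩
  have hL : ∀ w : S → ℚ, ∃ p : MvPolynomial σ ℚ,
      p.totalDegree ≤ Fintype.card σ * (2 * R) ∧ L p = w := by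
    intro w
    obtain ⟨p, hp, hpw⟩ := exists_eval_box R hS w
    refine ⟨p, hp, ?_⟩
    funext z
    rw [hLapp, hpw]
  have hLf : ∀ p, L (f * p) = 0 := fun p => funext fun z => by
    rw [hLapp, map_mul, hSf z.1 z.2, zero_mul, Pi.zero_apply]
  have hLg : ∀ p, L (g * p) = 0 := fun p => funext fun z => by
    rw [hLapp, map_mul, hSg z.1 z.2, zero_mul, Pi.zero_apply]
  have h := finrank_le_of_isRelPrime hij hf hg hrel _ L hL hLf hLg
  rwa [Module.finrank_fintype_fun_eq_card, Fintype.card_coe] at h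

/-- Elimination: the ideal of two coprime plane curves contains a nonzero polynomial in `X`. -/
theorem exists_elimination {k : Type*} [Field k] {F G : MvPolynomial (Fin 2) k}
    (hF : F ≠ 0) (hG : G ≠ 0) (hrel : IsRelPrime F G) :
    ∃ r : Polynomial k, r ≠ 0 ∧ Polynomial.aeval (X 0 : MvPolynomial (Fin 2) k) r
      ∈ Ideal.span {F, G} := by
  set I : Ideal (MvPolynomial (Fin 2) k) := Ideal.span {F, G} with hI
  let L : MvPolynomial (Fin 2) k →ₗ[k] (MvPolynomial (Fin 2) k ⧸ I) :=
    (Ideal.Quotient.mkₐ k I).toLinearMap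
  have hL0 : ∀ p, L p = 0 ↔ p ∈ I := fun p => Ideal.Quotient.eq_zero_iff_mem
  set N := F.totalDegree * G.totalDegree with hN
  have h := finrank_range_le_of_isRelPrime (i := (0 : Fin 2)) (j := 1) (by decide) hF hG hrel N L
    (fun p => (hL0 _).mpr (I.mul_mem_right _ (Ideal.subset_span (by simp))))
    (fun p => (hL0 _).mpr (I.mul_mem_right _ (Ideal.subset_span (by simp))))
  rw [Fintype.card_fin, Nat.sub_self, pow_zero, mul_one] at h
  let V := Polynomial.degreeLT k (N + 1)
  have hV : Module.finrank k V = N + 1 := by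
    rw [(Polynomial.degreeLTEquiv k (N + 1)).finrank_eq]; simp
  have hmem : ∀ r ∈ V, Polynomial.aeval (X 0 : MvPolynomial (Fin 2) k) r
      ∈ restrictSupport k (expSet (Fin 2) N 0) := by
    intro r hr
    rw [Polynomial.aeval_eq_sum_range]
    refine Submodule.sum_mem _ fun l hl => Submodule.smul_mem _ _ ?_
    refine (mem_restrictSupport_expSet (pow_ne_zero _ (X_ne_zero 0))).mpr ?_
    rw [totalDegree_X_pow]
    rcases eq_or_ne r 0 with rfl | hr0
    · simp at hl; omega
    have := (Polynomial.natDegree_lt_iff_degree_lt hr0).mpr (Polynomial.mem_degreeLT.mp hr)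
    have := Finset.mem_range.mp hl
    omega
  let T : V →ₗ[k] LinearMap.range (L.domRestrict (restrictSupport k (expSet (Fin 2) N 0))) :=
    { toFun := fun r => ⟨L (Polynomial.aeval (X 0) r.1), ⟨⟨_, hmem r.1 r.2⟩, rfl⟩⟩
      map_add' := fun a b => by ext; simp
      map_smul' := fun c a => by ext; simp }
  have hPfin : Module.Finite k (restrictSupport k (expSet (Fin 2) N 0)) := by
    have : Finite (expSet (Fin 2) N 0) := (expSet_finite N 0).to_subtype
    exact Module.Finite.of_basis (basisRestrictSupport k (expSet (Fin 2) N 0))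
  have hT : ¬ Function.Injective T := fun hinj => by
    have := LinearMap.finrank_le_finrank_of_injective hinj
    omega
  rw [injective_iff_map_eq_zero] at hT
  push Not at hT
  obtain ⟨r, hr, hr0⟩ := hT
  refine ⟨r.1, fun h => hr0 (Subtype.ext h), (hL0 _).mp (congrArg Subtype.val hr)⟩

/-- Bezout's theorem with multiplicities along vertical lines. -/
theorem sum_natDegree_le {k : Type*} [Field k] {F G : MvPolynomial (Fin 2) k}
    (hF : F ≠ 0) (hG : G ≠ 0) (hrel : IsRelPrime F G) (B : Finset k) (h : k → Polynomial k)
    (h0 : ∀ b ∈ B, h b ≠ 0) (hhF : ∀ b ∈ B, h b ∣ aeval ![Polynomial.C b, Polynomial.X] F)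
    (hhG : ∀ b ∈ B, h b ∣ aeval ![Polynomial.C b, Polynomial.X] G) :
    ∑ b ∈ B, (h b).natDegree ≤ F.totalDegree * G.totalDegree := by
  classical
  let W := (b : B) → AdjoinRoot (h b)
  let ev : (b : k) → MvPolynomial (Fin 2) k →ₐ[k] Polynomial k := fun b =>
    aeval ![Polynomial.C b, Polynomial.X]
  let L : MvPolynomial (Fin 2) k →ₗ[k] W :=
    LinearMap.pi fun b => ((AdjoinRoot.mkₐ (h b)).comp (ev b)).toLinearMap
  have hLapp : ∀ p (b : B), L p b = AdjoinRoot.mk (h b) (ev b p) := fun p b => rfl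
  have hfin : ∀ b : B, Module.Finite k (AdjoinRoot (h b)) := fun b =>
    (AdjoinRoot.powerBasis (h0 b b.2)).finite
  have hrank : Module.finrank k W = ∑ b ∈ B, (h b).natDegree := by
    rw [Module.finrank_pi_fintype, ← Finset.sum_coe_sort B]
    refine Finset.sum_congr rfl fun b _ => ?_
    rw [(AdjoinRoot.powerBasis (h0 b b.2)).finrank, AdjoinRoot.powerBasis_dim]
  have hsurj : Function.Surjective L := by
    intro w
    choose u hu using fun b : B => AdjoinRoot.mk_surjective (w b)
    refine ⟨∑ b : B, Polynomial.aeval (X 0) (Lagrange.basis B id b.1)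
      * Polynomial.aeval (X 1) (u b), funext fun b => ?_⟩
    rw [hLapp, map_sum]
    have : ∀ b' : B, ev b (Polynomial.aeval (X 0) (Lagrange.basis B id b'.1)
        * Polynomial.aeval (X 1) (u b')) = if b = b' then u b else 0 := by
      intro b'
      rw [map_mul, ← Polynomial.aeval_algHom_apply, ← Polynomial.aeval_algHom_apply]
      have h1 : ev b (X 0) = algebraMap k _ b.1 := by simp [ev]
      have h2 : ev b (X 1) = Polynomial.X := by simp [ev]
      rw [h1, h2, Polynomial.aeval_algebraMap_apply, Polynomial.aeval_X_left_apply]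
      split_ifs with hb
      · subst hb
        have := Lagrange.eval_basis_self (s := B) (v := id) Function.injective_id.injOn b.2
        rw [Polynomial.coe_aeval_eq_eval]
        simp only [id] at this
        rw [this]; simp
      · have := Lagrange.eval_basis_of_ne (s := B) (v := id) (i := b'.1) (j := b.1)
          (fun hh => hb (Subtype.ext hh.symm)) b.2
        rw [Polynomial.coe_aeval_eq_eval]
        simp only [id] at this
        rw [this]; simp
    rw [Finset.sum_congr rfl fun b' _ => this b', Finset.sum_ite_eq Finset.univ b]
    simp [hu]
  obtain ⟨N, hN⟩ : ∃ N, ∀ w : W, ∃ p, p.totalDegree ≤ N ∧ L p = w := by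
    let bs := Module.finBasis k W
    choose p hp using fun l => hsurj (bs l)
    refine ⟨Finset.univ.sup fun l => (p l).totalDegree, fun w =>
      ⟨∑ l, bs.repr w l • p l, totalDegree_finsetSum_le fun l _ =>
        (totalDegree_smul_le _ _).trans (Finset.le_sup (f := fun l => (p l).totalDegree)
          (Finset.mem_univ l)), ?_⟩⟩
    simp only [map_sum, map_smul, hp]
    exact bs.sum_repr w
  have key := finrank_le_of_isRelPrime (i := (0 : Fin 2)) (j := 1) (by decide) hF hG hrel N L hN
    (fun p => funext fun b => by
      rw [hLapp, map_mul, AdjoinRoot.mk_eq_zero.mpr ((hhF b b.2).mul_right _)]; rfl)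
    (fun p => funext fun b => by
      rw [hLapp, map_mul, AdjoinRoot.mk_eq_zero.mpr ((hhG b b.2).mul_right _)]; rfl)
  rw [hrank, Fintype.card_fin, Nat.sub_self, pow_zero, mul_one] at key
  exact key

end BombieriPila

namespace BombieriPila

open MvPolynomial

/-! ### Filtrations, Wronskians and derivations -/

section Filtration

theorem map_iterate_of_comm {R S : Type*} {ρ : R → S} {θ : R → R} {θ' : S → S}
    (hθ : ∀ G, ρ (θ G) = θ' (ρ G)) (i : ℕ) (G : R) : ρ (θ^[i] G) = θ'^[i] (ρ G) := by
  induction i generalizing G with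
  | zero => rfl
  | succ i ih => rw [Function.iterate_succ_apply, ih, hθ, Function.iterate_succ_apply]

variable {R : Type*} [CommRing R]

/-- An increasing multiplicative filtration of a ring by additive subgroups. -/
structure IsFiltration (P : ℕ → AddSubgroup R) : Prop where
  mono : Monotone P
  one : (1 : R) ∈ P 0
  mul : ∀ {k l a b}, a ∈ P k → b ∈ P l → a * b ∈ P (k + l)

theorem IsFiltration.prod {P : ℕ → AddSubgroup R} (hP : IsFiltration P) {ι : Type*}
    (s : Finset ι) (g : ι → R) (k : ι → ℕ) (h : ∀ i ∈ s, g i ∈ P (k i)) :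
    ∏ i ∈ s, g i ∈ P (∑ i ∈ s, k i) := by
  classical
  induction s using Finset.induction_on with
  | empty => simpa using hP.one
  | insert i s hi ih =>
    rw [Finset.prod_insert hi, Finset.sum_insert hi]
    exact hP.mul (h i (by simp)) (ih fun j hj => h j (by simp [hj]))

/-- The Wronskian of `h 0, …, h (m - 1)` with respect to an operator `θ`. -/
def wronskian (θ : R → R) (h : ℕ → R) (m : ℕ) : R :=
  (Matrix.of fun i j : Fin m => θ^[i] (h j)).det

theorem wronskian_zero (θ : R → R) (h : ℕ → R) : wronskian θ h 0 = 1 := by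
  simp [wronskian]

theorem map_wronskian {S : Type*} [CommRing S] (ρ : R →+* S) {θ : R → R} {θ' : S → S}
    (hθ : ∀ G, ρ (θ G) = θ' (ρ G)) {h : ℕ → R} {h' : ℕ → S} (hh : ∀ j, ρ (h j) = h' j)
    (m : ℕ) : ρ (wronskian θ h m) = wronskian θ' h' m := by
  rw [wronskian, wronskian, RingHom.map_det]
  congr 1
  ext i j
  simp [map_iterate_of_comm hθ, hh]

theorem IsFiltration.iterate {P : ℕ → AddSubgroup R} {θ : R → R} {t : ℕ}
    (hθ : ∀ k G, G ∈ P k → θ G ∈ P (k + t)) {b : ℕ} {G : R} (hG : G ∈ P b) (i : ℕ) :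
    θ^[i] G ∈ P (b + i * t) := by
  induction i with
  | zero => simpa using hG
  | succ i ih =>
    rw [Function.iterate_succ_apply', Nat.succ_mul, ← add_assoc]
    exact hθ _ _ ih

theorem IsFiltration.wronskian_mem {P : ℕ → AddSubgroup R} (hP : IsFiltration P) {θ : R → R}
    {t : ℕ} (hθ : ∀ k G, G ∈ P k → θ G ∈ P (k + t)) {h : ℕ → R} {b : ℕ} {m : ℕ}
    (hh : ∀ j < m, h j ∈ P b) : wronskian θ h m ∈ P (m * (b + m * t)) := by
  rw [wronskian, Matrix.det_apply]
  refine AddSubgroup.sum_mem _ fun τ _ => ?_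
  rw [Units.smul_def]
  refine AddSubgroup.zsmul_mem _ ?_ _
  have := hP.prod Finset.univ (fun i : Fin m => (Matrix.of fun i j : Fin m => θ^[i] (h j)) (τ i) i)
    (fun _ => b + m * t) fun i _ => by
      refine hP.mono ?_ (IsFiltration.iterate hθ (hh i i.2) (τ i))
      have := (τ i).2
      gcongr
  simpa using this

end Filtration

section Degree

variable {σ R : Type*} [CommRing R]

/-- The filtration of polynomials by total degree. -/
noncomputable def degFilt (σ R : Type*) [CommRing R] (k : ℕ) : AddSubgroup (MvPolynomial σ R) :=
  (restrictTotalDegree σ R k).toAddSubgroup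

theorem mem_degFilt {k : ℕ} {p : MvPolynomial σ R} :
    p ∈ degFilt σ R k ↔ p.totalDegree ≤ k := by
  rw [degFilt, Submodule.mem_toAddSubgroup, mem_restrictTotalDegree]

theorem isFiltration_degFilt : IsFiltration (degFilt σ R) where
  mono k l hkl p hp := mem_degFilt.mpr ((mem_degFilt.mp hp).trans hkl)
  one := mem_degFilt.mpr (by simp)
  mul ha hb := mem_degFilt.mpr ((totalDegree_mul _ _).trans
    (add_le_add (mem_degFilt.mp ha) (mem_degFilt.mp hb)))

/-- The filtration of polynomials by the degrees of their coefficients. -/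
def coeffFilt (σ τ R : Type*) [CommRing R] (k : ℕ) :
    AddSubgroup (MvPolynomial σ (MvPolynomial τ R)) where
  carrier := {p | ∀ e, (coeff e p).totalDegree ≤ k}
  zero_mem' e := by simp
  add_mem' ha hb e := by
    rw [coeff_add]
    exact (totalDegree_add _ _).trans (max_le (ha e) (hb e))
  neg_mem' ha e := by
    rw [coeff_neg, totalDegree_neg]
    exact ha e

theorem mem_coeffFilt {τ : Type*} {k : ℕ} {p : MvPolynomial σ (MvPolynomial τ R)} :
    p ∈ coeffFilt σ τ R k ↔ ∀ e, (coeff e p).totalDegree ≤ k := Iff.rfl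

theorem isFiltration_coeffFilt {τ : Type*} : IsFiltration (coeffFilt σ τ R) where
  mono k l hkl p hp e := (hp e).trans hkl
  one e := by
    classical
    rw [coeff_one]
    split_ifs <;> simp
  mul {k l a b} ha hb e := by
    classical
    rw [coeff_mul]
    refine totalDegree_finsetSum_le fun x _ => (totalDegree_mul _ _).trans ?_
    exact add_le_add (ha _) (hb _)

theorem totalDegree_pderiv_le (i : σ) (p : MvPolynomial σ R) :
    (pderiv i p).totalDegree ≤ p.totalDegree := by
  conv_lhs => rw [p.as_sum, map_sum]
  refine totalDegree_finsetSum_le fun e he => ?_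
  rw [pderiv_monomial]
  refine (totalDegree_monomial_le _ _).trans (le_trans ?_ (le_totalDegree he))
  exact Finsupp.degree_mono (tsub_le_self : e - Finsupp.single i 1 ≤ e)

theorem pderiv_mem_coeffFilt {τ : Type*} (i : σ) {k : ℕ} {p : MvPolynomial σ (MvPolynomial τ R)}
    (hp : p ∈ coeffFilt σ τ R k) : pderiv i p ∈ coeffFilt σ τ R k := by
  rw [p.as_sum, map_sum]
  refine AddSubgroup.sum_mem _ fun e _ => ?_
  rw [pderiv_monomial]
  intro e'
  classical
  rw [coeff_monomial]
  split_ifs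
  · refine (totalDegree_mul _ _).trans ?_
    have : ((e i : ℕ) : MvPolynomial τ R).totalDegree = 0 := by
      rw [← map_natCast (C : R →+* MvPolynomial τ R), totalDegree_C]
    rw [this, add_zero]
    exact hp e
  · simp

end Degree

section Derivations

variable {σ R : Type*} [CommRing R]

/-- The derivative in the direction `a`. -/
noncomputable def dirDeriv (a : σ → R) :
    Derivation R (MvPolynomial σ R) (MvPolynomial σ R) :=
  mkDerivation R fun i => C (a i)

theorem dirDeriv_X (a : σ → R) (i : σ) : dirDeriv a (X i) = C (a i) := mkDerivation_X _ _ _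

theorem dirDeriv_eq_sum [Fintype σ] (a : σ → R) (p : MvPolynomial σ R) :
    dirDeriv a p = ∑ i, C (a i) * pderiv i p := by
  classical
  have hsum : ∀ (E : σ → Derivation R (MvPolynomial σ R) (MvPolynomial σ R)) (q),
      (∑ i, E i) q = ∑ i, E i q := fun E q => by
    have := congrFun (map_sum Derivation.coeFnAddMonoidHom E Finset.univ) q
    rw [Finset.sum_apply] at this
    exact this
  have : dirDeriv a = ∑ i, (C (a i) : MvPolynomial σ R) • pderiv (R := R) i := by
    refine derivation_ext fun j => ?_
    rw [dirDeriv_X, hsum]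
    simp [pderiv_X, Pi.single_apply]
  rw [this, hsum]
  simp

/-- The derivation `f_y ∂_a - (∂_a f) ∂_y`, which is tangent to the slices of `f = 0` by planes
parallel to `a` and the `y`-axis. -/
noncomputable def tangent (y : σ) (a : σ → R) (f : MvPolynomial σ R) :
    Derivation R (MvPolynomial σ R) (MvPolynomial σ R) :=
  pderiv y f • dirDeriv a - dirDeriv a f • pderiv y

theorem tangent_apply (y : σ) (a : σ → R) (f G : MvPolynomial σ R) :
    tangent y a f G = pderiv y f * dirDeriv a G - dirDeriv a f * pderiv y G := rfl

theorem tangent_self (y : σ) (a : σ → R) (f : MvPolynomial σ R) : tangent y a f f = 0 := by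
  rw [tangent_apply]; ring

theorem map_derivation {R' S' : Type*} [CommRing R'] [CommRing S'] [Algebra R' S']
    (ρ : MvPolynomial σ R →+* S') (E : Derivation R (MvPolynomial σ R) (MvPolynomial σ R))
    (E' : Derivation R' S' S') (hC : ∀ r, E' (ρ (C r)) = 0)
    (hX : ∀ i, ρ (E (X i)) = E' (ρ (X i))) (G : MvPolynomial σ R) : ρ (E G) = E' (ρ G) := by
  induction G using MvPolynomial.induction_on with
  | C r =>
    rw [hC, ← algebraMap_eq, Derivation.map_algebraMap, map_zero]
  | add p q hp hq => rw [map_add, map_add, map_add, map_add, hp, hq]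
  | mul_X p i hp =>
    simp only [map_mul, Derivation.leibniz, map_add, smul_eq_mul, hp, hX]

theorem map_tangent {τ R' : Type*} [CommRing R'] (ρ : MvPolynomial σ R →+* MvPolynomial τ R')
    {y : σ} {a : σ → R} {y' : τ} {a' : τ → R'}
    (hy : ∀ G, ρ (pderiv y G) = pderiv y' (ρ G))
    (ha : ∀ G, ρ (dirDeriv a G) = dirDeriv a' (ρ G)) (f G : MvPolynomial σ R) :
    ρ (tangent y a f G) = tangent y' a' (ρ f) (ρ G) := by
  simp only [tangent_apply, map_sub, map_mul, hy, ha]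

theorem map_pderiv_map {R' : Type*} [CommRing R'] (φ : R →+* R') (y : σ) (G : MvPolynomial σ R) :
    map φ (pderiv y G) = pderiv y (map φ G) := by
  classical
  refine map_derivation (map φ) (pderiv y) (pderiv y) (fun r => by simp) (fun i => ?_) G
  rw [map_X, pderiv_X, pderiv_X]
  by_cases h : i = y
  · subst h; simp
  · simp [h]

theorem map_dirDeriv_map {R' : Type*} [CommRing R'] (φ : R →+* R') (a : σ → R)
    (G : MvPolynomial σ R) : map φ (dirDeriv a G) = dirDeriv (fun i => φ (a i)) (map φ G) := by
  refine map_derivation (map φ) (dirDeriv a) (dirDeriv _) (fun r => ?_) (fun i => ?_) G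
  · rw [map_C, ← algebraMap_eq, Derivation.map_algebraMap]
  · rw [map_X, dirDeriv_X, dirDeriv_X, map_C]

theorem map_tangent_map {R' : Type*} [CommRing R'] (φ : R →+* R') (y : σ) (a : σ → R)
    (f G : MvPolynomial σ R) :
    map φ (tangent y a f G) = tangent y (fun i => φ (a i)) (map φ f) (map φ G) :=
  map_tangent (map φ) (map_pderiv_map φ y) (map_dirDeriv_map φ a) f G

theorem tangent_mem_degFilt [Fintype σ] (y : σ) (a : σ → R) (f : MvPolynomial σ R) (k : ℕ)
    (G : MvPolynomial σ R) (hG : G ∈ degFilt σ R k) :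
    tangent y a f G ∈ degFilt σ R (k + f.totalDegree) := by
  have hP : ∀ p : MvPolynomial σ R, (dirDeriv a p).totalDegree ≤ p.totalDegree := fun p => by
    rw [dirDeriv_eq_sum]
    refine totalDegree_finsetSum_le fun i _ => (totalDegree_mul _ _).trans ?_
    rw [totalDegree_C, zero_add]
    exact totalDegree_pderiv_le i p
  rw [tangent_apply, add_comm]
  refine AddSubgroup.sub_mem _ (isFiltration_degFilt.mul ?_ ?_) (isFiltration_degFilt.mul ?_ ?_)
  · exact mem_degFilt.mpr (totalDegree_pderiv_le y f)
  · exact mem_degFilt.mpr ((hP G).trans (mem_degFilt.mp hG))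
  · exact mem_degFilt.mpr (hP f)
  · exact mem_degFilt.mpr ((totalDegree_pderiv_le y G).trans (mem_degFilt.mp hG))

theorem tangent_mem_coeffFilt {τ : Type*} [Fintype σ] (y : σ) {a : σ → MvPolynomial τ R}
    (ha : ∀ i, (a i).totalDegree ≤ 1) {f : MvPolynomial σ (MvPolynomial τ R)}
    (hf : f ∈ coeffFilt σ τ R 0) (k : ℕ)
    (G : MvPolynomial σ (MvPolynomial τ R)) (hG : G ∈ coeffFilt σ τ R k) :
    tangent y a f G ∈ coeffFilt σ τ R (k + 1) := by
  have hF := isFiltration_coeffFilt (σ := σ) (τ := τ) (R := R)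
  have hP : ∀ l, ∀ p ∈ coeffFilt σ τ R l, dirDeriv a p ∈ coeffFilt σ τ R (l + 1) := by
    intro l p hp
    rw [dirDeriv_eq_sum, add_comm]
    refine AddSubgroup.sum_mem _ fun i _ => hF.mul (fun e => ?_) (pderiv_mem_coeffFilt i hp)
    classical
    rw [coeff_C]
    split_ifs
    · exact ha i
    · simp
  rw [tangent_apply]
  refine AddSubgroup.sub_mem _ ?_ ?_
  · rw [← zero_add (k + 1)]
    exact hF.mul (pderiv_mem_coeffFilt y hf) (hP k G hG)
  · rw [add_comm]
    exact hF.mul (hP 0 f hf) (pderiv_mem_coeffFilt y hG)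

end Derivations

end BombieriPila

namespace BombieriPila

open MvPolynomial

/-! ### The ideal of functions flat along the flow of a derivation -/

section FlatIdeal

variable {k R : Type*} [Field k] [CommRing R] [Algebra k R]

theorem iterate_derivation_mul_of_flat (D : Derivation k R R) (ε : R →ₐ[k] k) (i : ℕ) :
    ∀ u A : R, (∀ l < i, ε (D^[l] A) = 0) → ε (D^[i] (u * A)) = ε u * ε (D^[i] A) := by
  induction i with
  | zero => intro u A _; simp
  | succ i ih =>
    intro u A hA
    have hadd : ∀ a b : R, D^[i] (a + b) = D^[i] a + D^[i] b := fun a b =>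
      iterate_map_add D i a b
    rw [Function.iterate_succ_apply, Derivation.leibniz, hadd, map_add, smul_eq_mul, smul_eq_mul,
      mul_comm A, ih u (D A) fun l hl => ?_, ih (D u) A fun l hl => hA l (hl.trans i.lt_succ_self),
      hA i i.lt_succ_self, mul_zero, add_zero, Function.iterate_succ_apply]
    rw [← Function.iterate_succ_apply]
    exact hA _ (Nat.succ_lt_succ hl)

/-- The ideal of elements all of whose iterated derivatives vanish at a point. -/
def flatIdeal (D : Derivation k R R) (ε : R →ₐ[k] k) : Ideal R where
  carrier := {G | ∀ i, ε (D^[i] G) = 0}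
  zero_mem' i := by
    rw [iterate_map_zero, map_zero]
  add_mem' ha hb i := by
    rw [iterate_map_add, map_add, ha i, hb i, add_zero]
  smul_mem' u A hA i := by
    rw [smul_eq_mul, iterate_derivation_mul_of_flat D ε i u A fun l _ => hA l, hA i, mul_zero]

theorem derivation_mem_flatIdeal {D : Derivation k R R} {ε : R →ₐ[k] k} {G : R}
    (hG : G ∈ flatIdeal D ε) : D G ∈ flatIdeal D ε := fun i => by
  rw [← Function.iterate_succ_apply]; exact hG _

theorem mem_flatIdeal_of_mul_mem {D : Derivation k R R} {ε : R →ₐ[k] k} {u A : R} (hu : ε u ≠ 0)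
    (h : u * A ∈ flatIdeal D ε) : A ∈ flatIdeal D ε := by
  intro i
  induction i using Nat.strong_induction_on with
  | _ i ih =>
    have := h i
    rw [iterate_derivation_mul_of_flat D ε i u A ih] at this
    exact (mul_eq_zero.mp this).resolve_left hu

theorem mem_flatIdeal_of_derivation_eq_zero {D : Derivation k R R} {ε : R →ₐ[k] k} {F : R}
    (hD : D F = 0) (hε : ε F = 0) : F ∈ flatIdeal D ε := by
  intro i
  cases i with
  | zero => exact hε
  | succ i => rw [Function.iterate_succ_apply, hD, iterate_map_zero, map_zero]

/-- If the Wronskian of `h 0, …, h n` is flat and the one of `h 0, …, h (n - 1)` does not vanish,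
some nontrivial linear combination of `h 0, …, h n` is flat. -/
theorem exists_combination_mem_flatIdeal (D : Derivation k R R) (ε : R →ₐ[k] k) (h : ℕ → R)
    (n : ℕ) (hW : wronskian D h (n + 1) ∈ flatIdeal D ε) (hw : ε (wronskian D h n) ≠ 0) :
    ∃ c : Fin (n + 1) → k, c (Fin.last n) ≠ 0 ∧
      ∑ j, algebraMap k R (c j) * h j ∈ flatIdeal D ε := by
  set I := flatIdeal D ε with hI
  let M : Matrix (Fin (n + 1)) (Fin (n + 1)) R := Matrix.of fun i j => D^[i] (h j)
  let M' : Matrix (Fin n) (Fin n) R := Matrix.of fun i j => D^[i] (h j)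
  set w := wronskian D h n with hwdef
  let c : Fin (n + 1) → R := fun j => M.adjugate j (Fin.last n)
  have hclast : c (Fin.last n) = w := by
    show M.adjugate _ _ = _
    rw [Matrix.adjugate_fin_succ_eq_det_submatrix]
    have : M.submatrix (Fin.last n).succAbove (Fin.last n).succAbove = M' := by
      ext i j
      simp [M, M']
    rw [this, Fin.val_last, Even.neg_one_pow ⟨n, rfl⟩, one_mul]
    rfl
  let r : ℕ → R := fun i => ∑ j, c j * D^[i] (h j)
  have hr : ∀ i : Fin (n + 1), r i = if i = Fin.last n then wronskian D h (n + 1) else 0 := by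
    intro i
    have := congrFun (congrFun (Matrix.mul_adjugate M) i) (Fin.last n)
    rw [Matrix.mul_apply, Matrix.smul_apply, Matrix.one_apply, smul_eq_mul, mul_ite, mul_one,
      mul_zero] at this
    rw [show wronskian D h (n + 1) = M.det from rfl, ← this]
    exact Finset.sum_congr rfl fun j _ => mul_comm _ _
  have hr0 : ∀ i < n, r i = 0 := fun i hi => by
    rw [hr ⟨i, by omega⟩, if_neg]
    exact fun h => by simp [Fin.ext_iff] at h; omega
  have hrn : r n ∈ I := by
    have := hr (Fin.last n)
    rw [if_pos rfl, Fin.val_last] at this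
    rw [this]; exact hW
  have hrle : ∀ i ≤ n, r i ∈ I := fun i hi => by
    rcases hi.eq_or_lt with rfl | hi
    · exact hrn
    · rw [hr0 i hi]; exact I.zero_mem
  have hDr : ∀ i, D (r i) = ∑ j, D (c j) * D^[i] (h j) + r (i + 1) := by
    intro i
    simp only [r, map_sum, Derivation.leibniz, smul_eq_mul, Finset.sum_add_distrib,
      Function.iterate_succ_apply']
    rw [add_comm]
    congr 1
    exact Finset.sum_congr rfl fun j _ => mul_comm _ _
  let E : Fin (n + 1) → R := fun j => w * D (c j) - D w * c j
  have hElast : E (Fin.last n) = 0 := by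
    simp only [E, hclast]; ring
  have hEsum : ∀ i, ∑ j, E j * D^[i] (h j) = w * (D (r i) - r (i + 1)) - D w * r i := by
    intro i
    rw [hDr i, add_sub_cancel_right, Finset.mul_sum, Finset.mul_sum, ← Finset.sum_sub_distrib]
    exact Finset.sum_congr rfl fun j _ => by simp only [E]; ring
  have hErow : ∀ i : Fin n, ∑ j : Fin n, M' i j * E j.castSucc ∈ I := by
    intro i
    have h1 : ∑ j : Fin n, M' i j * E j.castSucc
        = w * (D (r i) - r (i + 1)) - D w * r i := by
      rw [← hEsum, Fin.sum_univ_castSucc, hElast, zero_mul, add_zero]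
      exact Finset.sum_congr rfl fun j _ => mul_comm _ _
    rw [h1, hr0 i i.2]
    have h2 := hrle (i + 1) i.2
    rw [map_zero, mul_zero, sub_zero, zero_sub]
    exact I.mul_mem_left _ (I.neg_mem h2)
  have hE : ∀ j, E j ∈ I := by
    intro j
    refine Fin.lastCases ?_ (fun j => ?_) j
    · rw [hElast]; exact I.zero_mem
    · refine mem_flatIdeal_of_mul_mem hw ?_
      have hadj := congrFun (congrArg (fun N => Matrix.mulVec N fun l : Fin n => E l.castSucc)
        (Matrix.adjugate_mul M')) j
      simp only [← Matrix.mulVec_mulVec] at hadj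
      rw [Matrix.smul_mulVec, Matrix.one_mulVec, Pi.smul_apply, smul_eq_mul] at hadj
      rw [show w = M'.det from rfl, ← hadj]
      change ∑ i, M'.adjugate j i * ∑ l, M' i l * E l.castSucc ∈ I
      exact I.sum_mem fun i _ => I.mul_mem_left _ (hErow i)
  have hrall : ∀ i, r i ∈ I := by
    intro i
    induction i with
    | zero => exact hrle 0 (Nat.zero_le _)
    | succ i ih =>
      refine mem_flatIdeal_of_mul_mem hw ?_
      have h1 : ∑ j, E j * D^[i] (h j) ∈ I := I.sum_mem fun j _ => I.mul_mem_right _ (hE j)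
      have h2 : w * r (i + 1) = w * D (r i) - D w * r i - ∑ j, E j * D^[i] (h j) := by
        rw [hEsum]; ring
      rw [h2]
      exact I.sub_mem (I.sub_mem (I.mul_mem_left _ (derivation_mem_flatIdeal ih))
        (I.mul_mem_left _ ih)) h1
  refine ⟨fun j => ε (c j), by simpa only [hclast] using hw, fun i => ?_⟩
  have hit : D^[i] (∑ j, algebraMap k R (ε (c j)) * h j)
      = ∑ j, algebraMap k R (ε (c j)) * D^[i] (h j) := by
    clear_value c
    induction i with
    | zero => rfl
    | succ i ih =>
      rw [Function.iterate_succ_apply', ih, map_sum]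
      refine Finset.sum_congr rfl fun j _ => ?_
      rw [Derivation.leibniz, Derivation.map_algebraMap, smul_zero, add_zero, smul_eq_mul,
        Function.iterate_succ_apply']
  rw [hit, map_sum, ← hrall i 0]
  simp only [r, Function.iterate_zero, id, map_sum, map_mul]
  refine Finset.sum_congr rfl fun j _ => ?_
  rw [AlgHom.commutes]; rfl

end FlatIdeal

/-- Over a smooth point of an irreducible plane curve `F`, Wronskians of functions independent
modulo `F` cannot first become divisible by `F` where the previous Wronskian does not vanish. -/
theorem eval_wronskian_eq_zero_of_dvd {k : Type*} [Field k] [CharZero k]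
    {F : MvPolynomial (Fin 2) k} (hF : Irreducible F) (P : Fin 2 → k) (hP : eval P F = 0)
    (hPy : eval P (pderiv 1 F) ≠ 0) (h : ℕ → MvPolynomial (Fin 2) k) (n : ℕ)
    (hind : ∀ c : Fin (n + 1) → k, c (Fin.last n) ≠ 0 → ¬ F ∣ ∑ j, C (c j) * h j)
    (hdvd : F ∣ wronskian (tangent 1 ![1, 0] F) h (n + 1)) :
    eval P (wronskian (tangent 1 ![1, 0] F) h n) = 0 := by
  by_contra hw
  set D := tangent 1 ![1, 0] F with hD
  let ε : MvPolynomial (Fin 2) k →ₐ[k] k := aeval P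
  have hε : ∀ G, ε G = eval P G := fun G => by simp [ε, aeval_eq_eval]
  set I := flatIdeal D ε with hI
  have hFI : F ∈ I := mem_flatIdeal_of_derivation_eq_zero (tangent_self _ _ _) (by rw [hε, hP])
  obtain ⟨c, hc, hG⟩ := exists_combination_mem_flatIdeal D ε h n (I.mem_of_dvd hdvd hFI)
    (by rwa [hε])
  set G := ∑ j, algebraMap k (MvPolynomial (Fin 2) k) (c j) * h j with hGdef
  have hFG : ¬ F ∣ G := hind c hc
  have hG0 : G ≠ 0 := fun h => hFG (h ▸ dvd_zero F)
  have hrel : IsRelPrime F G := (hF.isRelPrime_iff_not_dvd).mpr hFG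
  obtain ⟨r, hr0, hr⟩ := exists_elimination hF.ne_zero hG0 hrel
  have hrI : Polynomial.aeval (X 0 : MvPolynomial (Fin 2) k) r ∈ I :=
    (Ideal.span_le.mpr (by rintro _ (rfl | rfl); exacts [hFI, hG]) :
      Ideal.span {F, G} ≤ I) hr
  clear hr
  have hdesc : ∀ (N : ℕ) (r : Polynomial k), r ≠ 0 → r.natDegree ≤ N →
      Polynomial.aeval (X 0 : MvPolynomial (Fin 2) k) r ∈ I → False := by
    intro N
    induction N with
    | zero =>
      intro r hr0 hdeg hrI
      rw [Polynomial.eq_C_of_natDegree_le_zero hdeg, Polynomial.aeval_C] at hrI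
      have := hrI 0
      rw [Function.iterate_zero, id, AlgHom.commutes] at this
      refine hr0 ?_
      rw [Polynomial.eq_C_of_natDegree_le_zero hdeg]
      simpa using this
    | succ N ih =>
      intro r hr0 hdeg hrI
      by_cases hd : r.natDegree = 0
      · exact ih r hr0 (by omega) hrI
      refine ih (Polynomial.derivative r) (fun h => hd ?_) ?_ ?_
      · exact Polynomial.derivative_eq_zero.mp h
      · exact (Polynomial.natDegree_derivative_le r).trans (by omega)
      · refine mem_flatIdeal_of_mul_mem (u := pderiv 1 F) (by rwa [hε]) ?_
        have := derivation_mem_flatIdeal hrI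
        rw [Derivation.map_aeval] at this
        have hX : D (X 0) = pderiv 1 F := by
          rw [hD, tangent_apply, dirDeriv_X, pderiv_X]
          simp
        rw [hX, smul_eq_mul, mul_comm] at this
        exact this
  exact hdesc _ r hr0 le_rfl hrI

end BombieriPila

namespace BombieriPila

open MvPolynomial

/-! ### Planar slices -/

section Slice

variable {σ S : Type*} [DecidableEq σ] [CommRing S]

/-- Restriction of polynomials to the plane through `c` spanned by the direction `a` and the
`y`-axis. -/
noncomputable def slice (y : σ) (c a : σ → S) : MvPolynomial σ S →ₐ[S] MvPolynomial (Fin 2) S :=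
  aeval fun i => if i = y then X 1 else C (c i) + C (a i) * X 0

theorem slice_X (y : σ) (c a : σ → S) (i : σ) :
    slice y c a (X i) = if i = y then X 1 else C (c i) + C (a i) * X 0 := aeval_X _ _

theorem slice_C (y : σ) (c a : σ → S) (r : S) : slice y c a (C r) = C r :=
  (slice y c a).commutes r

theorem dirDeriv_fin_two : (dirDeriv ![1, 0] : Derivation S (MvPolynomial (Fin 2) S) _)
    = pderiv 0 := by
  refine derivation_ext fun i => ?_
  rw [dirDeriv_X, pderiv_X]
  fin_cases i <;> simp

theorem slice_pderiv (y : σ) (c a : σ → S) (G : MvPolynomial σ S) :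
    slice y c a (pderiv y G) = pderiv 1 (slice y c a G) := by
  refine map_derivation (slice y c a).toRingHom (pderiv y) (pderiv 1) (fun r => ?_)
    (fun i => ?_) G
  · change pderiv 1 (slice y c a (C r)) = 0
    rw [slice_C, pderiv_C]
  · change slice y c a _ = pderiv 1 (slice y c a (X i))
    rw [slice_X, pderiv_X]
    by_cases h : i = y
    · subst h; simp
    · simp [h]

theorem slice_dirDeriv {y : σ} (c : σ → S) {a : σ → S} (ha : a y = 0) (G : MvPolynomial σ S) :
    slice y c a (dirDeriv a G) = dirDeriv ![1, 0] (slice y c a G) := by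
  rw [dirDeriv_fin_two]
  refine map_derivation (slice y c a).toRingHom (dirDeriv a) (pderiv 0) (fun r => ?_)
    (fun i => ?_) G
  · change pderiv 0 (slice y c a (C r)) = 0
    rw [slice_C, pderiv_C]
  · change slice y c a _ = pderiv 0 (slice y c a (X i))
    rw [slice_X, dirDeriv_X, slice_C]
    by_cases h : i = y
    · subst h; simp [ha]
    · simp [h]

theorem slice_tangent {y : σ} (c : σ → S) {a : σ → S} (ha : a y = 0) (f G : MvPolynomial σ S) :
    slice y c a (tangent y a f G) = tangent 1 ![1, 0] (slice y c a f) (slice y c a G) :=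
  map_tangent (slice y c a).toRingHom (slice_pderiv y c a) (slice_dirDeriv c ha) f G

theorem eval_slice (y : σ) (c a : σ → S) (P : Fin 2 → S) (G : MvPolynomial σ S) :
    eval P (slice y c a G) = eval (fun i => if i = y then P 1 else c i + a i * P 0) G := by
  have : (eval P).comp (slice y c a).toRingHom
      = eval (fun i => if i = y then P 1 else c i + a i * P 0) := by
    refine ringHom_ext (fun r => ?_) fun i => ?_
    · change eval P (slice y c a (C r)) = _
      rw [slice_C, eval_C, eval_C]
    · change eval P (slice y c a (X i)) = _
      rw [slice_X, eval_X]
      split_ifs <;> simp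
  exact congrArg (fun φ : MvPolynomial σ S →+* S => φ G) this

end Slice

/-! ### Generic slices of an irreducible polynomial -/

section Generic

theorem not_dvd_of_mem_supported {σ k : Type*} [Field k] {y : σ} {f g : MvPolynomial σ k}
    (hfy : pderiv y f ≠ 0) (hg : g ≠ 0) (hgs : g ∈ supported k ({y}ᶜ : Set σ)) : ¬ f ∣ g := by
  rintro ⟨q, rfl⟩
  have hf : f ≠ 0 := left_ne_zero_of_mul hg
  have hq : q ≠ 0 := right_ne_zero_of_mul hg
  have h1 : y ∉ (f * q).vars := fun h => by
    have := mem_supported.mp hgs h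
    simp at this
  have h2 : degreeOf y f ≠ 0 := fun h => hfy (pderiv_eq_zero_of_notMem_vars fun h' =>
    mem_vars_iff_degreeOf_ne_zero.mp h' h)
  refine h1 (mem_vars_iff_degreeOf_ne_zero.mpr ?_)
  rw [degreeOf_mul_eq hf hq]
  omega

variable {σ : Type*} [DecidableEq σ]

/-- The indices of the free parameters of a direction. -/
abbrev Free (x y : σ) : Type _ := {i : σ // i ≠ x ∧ i ≠ y}

/-- The direction with coordinates `1` at `x`, `0` at `y` and `v` elsewhere. -/
def direction {S : Type*} [CommRing S] (x y : σ) (v : Free x y → S) (i : σ) : S :=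
  if h : i ≠ x ∧ i ≠ y then v ⟨i, h⟩ else if i = x then 1 else 0

variable {S : Type*} [CommRing S] {x y : σ}

theorem direction_x (v : Free x y → S) : direction x y v x = 1 := by simp [direction]

theorem direction_y (hxy : x ≠ y) (v : Free x y → S) : direction x y v y = 0 := by
  simp [direction, hxy.symm]

theorem direction_free (v : Free x y → S) (i : Free x y) : direction x y v i = v i := by
  simp [direction, i.2]

theorem map_direction {S' : Type*} [CommRing S'] (φ : S →+* S') (v : Free x y → S) (i : σ) :
    φ (direction x y v i) = direction x y (fun j => φ (v j)) i := by
  unfold direction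
  split_ifs <;> simp

variable (x y) in
/-- Restriction to the plane through `p` with the generic direction. -/
noncomputable def genericSlice (p : σ → ℚ) :
    MvPolynomial σ ℚ →+* MvPolynomial (Fin 2) (MvPolynomial (Free x y) ℚ) :=
  (slice y (fun i => C (p i) - direction x y X i * C (p x)) (direction x y X)).toRingHom.comp
    (map C)

theorem genericSlice_apply (p : σ → ℚ) (G : MvPolynomial σ ℚ) :
    genericSlice x y p G = slice y (fun i => C (p i) - direction x y X i * C (p x))
      (direction x y X) (map (C : ℚ →+* MvPolynomial (Free x y) ℚ) G) := rfl

theorem genericSlice_X (p : σ → ℚ) (i : σ) :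
    genericSlice x y p (X i) = if i = y then X 1 else
      C (C (p i) - direction x y X i * C (p x)) + C (direction x y X i) * X 0 := by
  rw [genericSlice_apply, map_X, slice_X]

theorem genericSlice_C (p : σ → ℚ) (r : ℚ) : genericSlice x y p (C r) = C (C r) := by
  rw [genericSlice_apply, map_C, slice_C]

theorem genericSlice_X_y (p : σ → ℚ) : genericSlice x y p (X y) = X 1 := by
  rw [genericSlice_X, if_pos rfl]

theorem genericSlice_X_x (hxy : x ≠ y) (p : σ → ℚ) : genericSlice x y p (X x) = X 0 := by
  rw [genericSlice_X, if_neg hxy, direction_x]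
  simp

theorem genericSlice_X_free (p : σ → ℚ) (i : Free x y) :
    genericSlice x y p (X i.1 - C (p i.1)) = C (X i) * (X 0 - C (C (p x))) := by
  rw [map_sub, genericSlice_X, if_neg i.2.2, direction_free, genericSlice_C]
  simp only [map_sub, map_mul]
  ring

theorem genericSlice_injective (hxy : x ≠ y) (p : σ → ℚ) :
    Function.Injective (genericSlice x y p) := by
  let L := FractionRing (MvPolynomial σ ℚ)
  let ι : MvPolynomial σ ℚ →+* L := algebraMap _ _
  have hι : Function.Injective ι := IsFractionRing.injective _ _
  let l : L := ι (X x - C (p x))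
  have hl : l ≠ 0 := by
    have : (X x - C (p x) : MvPolynomial σ ℚ) ≠ 0 := fun h => by
      have := congrArg (eval fun _ => p x + 1) h
      simp at this
    exact fun h => this (hι (h.trans (map_zero ι).symm))
  let lam : MvPolynomial (Fin 2) (MvPolynomial (Free x y) ℚ) →+* L :=
    eval₂Hom (eval₂Hom (ι.comp C) fun i => ι (X i.1 - C (p i)) / l) ![ι (X x), ι (X y)]
  have key : lam.comp (genericSlice x y p) = ι := by
    refine ringHom_ext (fun r => ?_) fun i => ?_
    · simp only [RingHom.comp_apply, genericSlice_C, lam, eval₂Hom_C]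
    · rw [RingHom.comp_apply]
      by_cases hx : i = x
      · subst hx; rw [genericSlice_X_x hxy]; simp [lam]
      by_cases hy : i = y
      · subst hy; rw [genericSlice_X_y]; simp [lam]
      have h1 := congrArg lam (genericSlice_X_free p ⟨i, hx, hy⟩)
      rw [map_sub, genericSlice_C, map_sub, map_mul, map_sub] at h1
      have hCC : ∀ r, lam (C (C r)) = ι (C r) := fun r => by
        simp only [RingHom.comp_apply, lam, eval₂Hom_C]
      have h2 : lam (X 0) - lam (C (C (p x))) = l := by rw [hCC]; simp [lam, l]
      have h3 : lam (C (X ⟨i, hx, hy⟩)) = ι (X i - C (p i)) / l := by simp [lam]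
      rw [h2, h3, hCC, div_mul_cancel₀ _ hl, map_sub] at h1
      exact sub_left_injective h1
  have hinj : Function.Injective (lam.comp (genericSlice x y p)) := key ▸ hι
  rw [RingHom.coe_comp] at hinj
  exact hinj.of_comp

theorem exists_genericSlice_eq_C (hxy : x ≠ y) (p : σ → ℚ) (b : MvPolynomial (Free x y) ℚ) :
    ∃ M, ∃ B' ∈ supported ℚ {y}ᶜ, genericSlice x y p B' = (X 0 - C (C (p x))) ^ M * C b := by
  have hl : genericSlice x y p (X x - C (p x)) = X 0 - C (C (p x)) := by
    rw [map_sub, genericSlice_X_x hxy, genericSlice_C]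
  have hlmem : (X x - C (p x) : MvPolynomial σ ℚ) ∈ supported ℚ {y}ᶜ :=
    sub_mem (X_mem_supported.mpr (by simpa using hxy)) (Subalgebra.algebraMap_mem _ _)
  induction b using MvPolynomial.induction_on with
  | C r => exact ⟨0, C r, Subalgebra.algebraMap_mem _ _, by rw [genericSlice_C, pow_zero, one_mul]⟩
  | add a b ha hb =>
    obtain ⟨M, A', hA, hA'⟩ := ha
    obtain ⟨N, B', hB, hB'⟩ := hb
    refine ⟨M + N, A' * (X x - C (p x)) ^ N + B' * (X x - C (p x)) ^ M,
      add_mem (mul_mem hA (pow_mem hlmem _)) (mul_mem hB (pow_mem hlmem _)), ?_⟩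
    rw [map_add, map_mul, map_mul, hA', hB', map_pow, map_pow, hl, map_add]
    ring
  | mul_X a i ha =>
    obtain ⟨M, A', hA, hA'⟩ := ha
    refine ⟨M + 1, A' * (X i.1 - C (p i)), mul_mem hA (sub_mem (X_mem_supported.mpr
      (by simpa using i.2.2)) (Subalgebra.algebraMap_mem _ _)), ?_⟩
    rw [map_mul, hA', genericSlice_X_free, map_mul]
    ring

/-- Every polynomial on the generic slice becomes, after multiplication by a power of `X - p_x`,
the restriction of a polynomial. -/
theorem exists_genericSlice_eq (hxy : x ≠ y) (p : σ → ℚ)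
    (B : MvPolynomial (Fin 2) (MvPolynomial (Free x y) ℚ)) :
    ∃ M, ∃ B', genericSlice x y p B' = (X 0 - C (C (p x))) ^ M * B := by
  have hl : genericSlice x y p (X x - C (p x)) = X 0 - C (C (p x)) := by
    rw [map_sub, genericSlice_X_x hxy, genericSlice_C]
  induction B using MvPolynomial.induction_on with
  | C b =>
    obtain ⟨M, B', -, h⟩ := exists_genericSlice_eq_C hxy p b
    exact ⟨M, B', h⟩
  | add a b ha hb =>
    obtain ⟨M, A', hA'⟩ := ha
    obtain ⟨N, B', hB'⟩ := hb
    refine ⟨M + N, A' * (X x - C (p x)) ^ N + B' * (X x - C (p x)) ^ M, ?_⟩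
    rw [map_add, map_mul, map_mul, hA', hB', map_pow, map_pow, hl]
    ring
  | mul_X a i ha =>
    obtain ⟨M, A', hA'⟩ := ha
    fin_cases i
    · refine ⟨M, A' * X x, ?_⟩
      rw [map_mul, hA', genericSlice_X_x hxy, mul_assoc]
      rfl
    · refine ⟨M, A' * X y, ?_⟩
      rw [map_mul, hA', genericSlice_X_y, mul_assoc]
      rfl

/-- Clearing denominators. -/
theorem exists_map_eq_C_mul {A K τ : Type*} [CommRing A] [IsDomain A] [Field K] [Algebra A K]
    [IsFractionRing A K] (G : MvPolynomial τ K) :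
    ∃ α : A, α ≠ 0 ∧ ∃ G' : MvPolynomial τ A,
      map (algebraMap A K) G' = C (algebraMap A K α) * G := by
  induction G using MvPolynomial.induction_on with
  | C r =>
    obtain ⟨a, b, hb, rfl⟩ := IsFractionRing.div_surjective (A := A) r
    have hb0 : algebraMap A K b ≠ 0 :=
      IsFractionRing.to_map_ne_zero_of_mem_nonZeroDivisors hb
    refine ⟨b, nonZeroDivisors.ne_zero hb, C a, ?_⟩
    rw [map_C, ← C_mul, mul_div_cancel₀ _ hb0]
  | add a b ha hb =>
    obtain ⟨α, hα, A', hA'⟩ := ha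
    obtain ⟨β, hβ, B', hB'⟩ := hb
    refine ⟨α * β, mul_ne_zero hα hβ, C β * A' + C α * B', ?_⟩
    rw [map_add, map_mul, map_mul, hA', hB', map_C, map_C, map_mul, map_mul]
    ring
  | mul_X a i ha =>
    obtain ⟨α, hα, A', hA'⟩ := ha
    exact ⟨α, hα, A' * X i, by rw [map_mul, hA', map_X, mul_assoc]⟩

theorem prime_X_sub_C_of_field {K τ : Type*} [Field K] (i : τ) (c : K) :
    Prime (X i - C c : MvPolynomial τ K) := by
  classical
  have h1 : coeff (Finsupp.single i 1) (X i - C c : MvPolynomial τ K) = 1 := by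
    rw [coeff_sub, coeff_C, if_neg (Finsupp.single_ne_zero.mpr one_ne_zero).symm, sub_zero]
    rw [coeff_X, if_pos rfl]
  refine (irreducible_of_totalDegree_eq_one (le_antisymm ?_ ?_) fun x hx => ?_).prime
  · exact (totalDegree_sub _ _).trans (by simp)
  · refine le_trans (by simp) (le_totalDegree (s := Finsupp.single i 1) ?_)
    rw [mem_support_iff, h1]
    exact one_ne_zero
  · exact isUnit_of_dvd_one (h1 ▸ hx (Finsupp.single i 1))

theorem eval_genericSlice (hxy : x ≠ y) (p : σ → ℚ) (G : MvPolynomial σ ℚ) :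
    eval ![C (p x), C (p y)] (genericSlice x y p G) = C (eval p G) := by
  have : (eval ![C (p x), C (p y)]).comp (genericSlice x y p)
      = (C : ℚ →+* MvPolynomial (Free x y) ℚ).comp (eval p) := by
    refine ringHom_ext (fun r => ?_) fun i => ?_
    · simp only [RingHom.comp_apply, genericSlice_C, eval_C]
    · simp only [RingHom.comp_apply, genericSlice_X, eval_X]
      split_ifs with h
      · subst h; simp
      · simp
  exact congrArg (fun φ : MvPolynomial σ ℚ →+* MvPolynomial (Free x y) ℚ => φ G) this

theorem genericSlice_pderiv (p : σ → ℚ) (G : MvPolynomial σ ℚ) :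
    genericSlice x y p (pderiv y G) = pderiv 1 (genericSlice x y p G) := by
  rw [genericSlice_apply, genericSlice_apply, ← slice_pderiv, map_pderiv_map]

variable {K : Type*} [Field K] [Algebra (MvPolynomial (Free x y) ℚ) K]
  [IsFractionRing (MvPolynomial (Free x y) ℚ) K]

/-- The generic slice of an irreducible polynomial through a smooth zero is irreducible. -/
theorem irreducible_map_genericSlice (hxy : x ≠ y) {f : MvPolynomial σ ℚ} (hf : Irreducible f)
    {p : σ → ℚ} (hp : eval p f = 0) (hpy : eval p (pderiv y f) ≠ 0) :
    Irreducible (map (algebraMap (MvPolynomial (Free x y) ℚ) K) (genericSlice x y p f)) := by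
  set A := MvPolynomial (Free x y) ℚ
  set ι := algebraMap A K with hι
  set ψ := genericSlice x y p with hψ
  have hιinj : Function.Injective ι := IsFractionRing.injective A K
  have hmapinj : Function.Injective (map ι : MvPolynomial (Fin 2) A → _) := map_injective ι hιinj
  have hψinj : Function.Injective ψ := genericSlice_injective hxy p
  have hfy : pderiv y f ≠ 0 := fun h => hpy (by rw [h, map_zero])
  have heval : ∀ G, eval ![ι (C (p x)), ι (C (p y))] (map ι (ψ G)) = ι (C (eval p G)) := fun G => by
    rw [← eval_genericSlice hxy p G, ← hψ, eval_map, ← eval₂_id, eval₂_comp_left, RingHom.comp_id]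
    congr 1
    funext i
    fin_cases i <;> rfl
  set F := map ι (ψ f) with hF
  have hpF : eval ![ι (C (p x)), ι (C (p y))] F = 0 := by rw [hF, heval, hp, map_zero, map_zero]
  have hpFy : eval ![ι (C (p x)), ι (C (p y))] (pderiv 1 F) ≠ 0 := by
    have : pderiv 1 F = map ι (ψ (pderiv y f)) := by
      rw [genericSlice_pderiv, map_pderiv_map]
    rw [this, heval]
    exact fun h => hpy (C_injective _ _ (by
      rw [map_zero]; exact hιinj (h.trans (map_zero ι).symm)))
  set l : MvPolynomial (Fin 2) K := X 0 - C (ι (C (p x))) with hl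
  have hlF : ¬ l ∣ F := by
    rintro ⟨G, hG⟩
    refine hpFy ?_
    rw [hG, Derivation.leibniz, map_add]
    simp [hl]
  have hlprime : Prime l := prime_X_sub_C_of_field 0 _
  set lam : MvPolynomial σ ℚ := X x - C (p x) with hlam
  have hψlam : ψ lam = X 0 - C (C (p x)) := by
    rw [hlam, map_sub, genericSlice_X_x hxy, genericSlice_C]
  have hlam0 : lam ≠ 0 := (prime_X_sub_C_of_field x (p x)).ne_zero
  have hlams : lam ∈ supported ℚ ({y}ᶜ : Set σ) :=
    sub_mem (X_mem_supported.mpr (by simpa using hxy)) (Subalgebra.algebraMap_mem _ _)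
  have hfprime : Prime f := hf.prime
  have hstep : ∀ {a : MvPolynomial (Fin 2) K} {α : A} {a' M A'}, α ≠ 0 → map ι a' = C (ι α) * a →
      ψ A' = (X 0 - C (C (p x))) ^ M * a' → f ∣ A' → F ∣ a := by
    rintro a α a' M A' hα ha' hA' ⟨B, rfl⟩
    have h1 : F * map ι (ψ B) = l ^ M * (C (ι α) * a) := by
      rw [← ha', hF, ← map_mul, ← map_mul, hA', map_mul, map_pow, map_sub, map_X, map_C]
    obtain ⟨H, hH⟩ := hlprime.pow_dvd_of_dvd_mul_left M hlF (Dvd.intro _ h1.symm)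
    have h2 : F * H = C (ι α) * a := by
      refine mul_left_cancel₀ (pow_ne_zero M hlprime.ne_zero) ?_
      rw [← h1, hH]; ring
    have hα' : ι α ≠ 0 := fun h => hα (hιinj (h.trans (map_zero ι).symm))
    refine ⟨C (ι α)⁻¹ * H, ?_⟩
    rw [mul_left_comm, h2, ← mul_assoc, ← C_mul, inv_mul_cancel₀ hα', C_1, one_mul]
  refine Prime.irreducible ⟨?_, ?_, ?_⟩
  · exact fun h => hlF (h ▸ dvd_zero l)
  · intro h
    have := h.map (eval ![ι (C (p x)), ι (C (p y))])
    rw [hpF] at this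
    exact not_isUnit_zero this
  · rintro a b ⟨c, hc⟩
    obtain ⟨α, hα, a', ha'⟩ := exists_map_eq_C_mul (A := A) a
    obtain ⟨β, hβ, b', hb'⟩ := exists_map_eq_C_mul (A := A) b
    obtain ⟨γ, hγ, c', hc'⟩ := exists_map_eq_C_mul (A := A) c
    obtain ⟨M, A', hA'⟩ := exists_genericSlice_eq hxy p a'
    obtain ⟨N, B', hB'⟩ := exists_genericSlice_eq hxy p b'
    obtain ⟨P, C', hC'⟩ := exists_genericSlice_eq hxy p c'
    obtain ⟨Q, E, hE'⟩ := exists_genericSlice_eq hxy p (C (α * β))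
    obtain ⟨R, Γ, hΓs, hΓ⟩ := exists_genericSlice_eq_C hxy p γ
    have h1 : C γ * (a' * b') = ψ f * (c' * C (α * β)) := by
      refine hmapinj ?_
      rw [map_mul, map_mul, map_mul, map_mul, ha', hb', hc', map_C, map_C, ← hF, map_mul,
        map_mul]
      linear_combination C (ι γ) * C (ι α) * C (ι β) * hc
    have h2 : Γ * (A' * B') * lam ^ (P + Q) = f * (C' * E) * lam ^ (M + N + R) := by
      refine hψinj ?_
      simp only [map_mul, map_pow, hψlam]
      rw [hA', hB', hC', hE', hΓ]
      linear_combination ((X 0 - C (C (p x))) ^ (M + N + R + P + Q)) * h1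
    have h3 : f ∣ Γ * (A' * B') * lam ^ (P + Q) := ⟨C' * E * lam ^ (M + N + R), by
      rw [h2]; ring⟩
    have hΓ0 : Γ ≠ 0 := by
      rintro rfl
      rw [map_zero] at hΓ
      refine mul_ne_zero (pow_ne_zero _ ?_) (fun h => hγ (C_injective _ _ (h.trans C_0.symm)))
        hΓ.symm
      rw [← hψlam]
      exact fun h => hlam0 (hψinj (h.trans (map_zero ψ).symm))
    rcases hfprime.dvd_or_dvd h3 with h3 | h3
    · rcases hfprime.dvd_or_dvd h3 with h3 | h3
      · exact absurd h3 (not_dvd_of_mem_supported hfy hΓ0 hΓs)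
      · rcases hfprime.dvd_or_dvd h3 with h3 | h3
        · exact Or.inl (hstep hα ha' hA' h3)
        · exact Or.inr (hstep hβ hb' hB' h3)
    · exact absurd (hfprime.dvd_of_dvd_pow h3) (not_dvd_of_mem_supported hfy hlam0 hlams)

end Generic

end BombieriPila

namespace BombieriPila

open MvPolynomial

/-! ### Leading exponents of generic slices -/

section Leading

theorem totalDegree_map_monomial_le {k σ A τ : Type*} [Field k] [CommRing A]
    {φ : MvPolynomial σ k →+* MvPolynomial τ A} (hφ : ∀ i, (φ (X i)).totalDegree ≤ 1)
    (n : ℕ) : ∀ e : σ →₀ ℕ, e.degree = n → (φ (monomial e 1)).totalDegree ≤ n := by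
  classical
  induction n with
  | zero =>
    intro e he
    rw [Finsupp.degree_eq_zero_iff] at he
    subst he
    change (φ (C 1)).totalDegree ≤ 0
    rw [C_1, map_one, totalDegree_one]
  | succ n ih =>
    intro e he
    obtain ⟨i, hi⟩ : ∃ i, e i ≠ 0 := by
      by_contra! h
      have : e = 0 := Finsupp.ext h
      simp [this] at he
    have hei : e - Finsupp.single i 1 + Finsupp.single i 1 = e :=
      Finsupp.sub_add_single_one_cancel hi
    have hdeg : (e - Finsupp.single i 1).degree = n := by
      have := congrArg Finsupp.degree hei
      rw [map_add, Finsupp.degree_single] at this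
      omega
    have hmon : (monomial e 1 : MvPolynomial σ k) = monomial (e - Finsupp.single i 1) 1 * X i := by
      rw [X, monomial_mul, hei, one_mul]
    rw [hmon, map_mul]
    exact (totalDegree_mul _ _).trans (add_le_add (ih _ hdeg) (hφ i))

theorem totalDegree_map_monomial_sub_le {k σ A τ : Type*} [Field k] [CommRing A]
    {φ ψ : MvPolynomial σ k →+* MvPolynomial τ A} (hφ : ∀ i, (φ (X i)).totalDegree ≤ 1)
    (hψ : ∀ i, (ψ (X i)).totalDegree ≤ 1) (hφψ : ∀ i, (φ (X i) - ψ (X i)).totalDegree = 0)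
    (n : ℕ) : ∀ e : σ →₀ ℕ, e.degree = n →
      (φ (monomial e 1) - ψ (monomial e 1)).totalDegree ≤ n - 1 := by
  classical
  induction n with
  | zero =>
    intro e he
    rw [Finsupp.degree_eq_zero_iff] at he
    subst he
    change (φ (C 1) - ψ (C 1)).totalDegree ≤ 0
    rw [C_1, map_one, map_one, sub_self, totalDegree_zero]
  | succ n ih =>
    intro e he
    obtain ⟨i, hi⟩ : ∃ i, e i ≠ 0 := by
      by_contra! h
      have : e = 0 := Finsupp.ext h
      simp [this] at he
    have hei : e - Finsupp.single i 1 + Finsupp.single i 1 = e :=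
      Finsupp.sub_add_single_one_cancel hi
    set e' := e - Finsupp.single i 1 with he'
    have hdeg : e'.degree = n := by
      have := congrArg Finsupp.degree hei
      rw [map_add, Finsupp.degree_single] at this
      omega
    have hmon : (monomial e 1 : MvPolynomial σ k) = monomial e' 1 * X i := by
      rw [X, monomial_mul, hei, one_mul]
    have hsplit : φ (monomial e 1) - ψ (monomial e 1)
        = (φ (monomial e' 1) - ψ (monomial e' 1)) * φ (X i)
          + ψ (monomial e' 1) * (φ (X i) - ψ (X i)) := by
      rw [hmon, map_mul, map_mul]; ring
    rw [hsplit, Nat.add_sub_cancel]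
    refine (totalDegree_add _ _).trans (max_le ?_ ?_)
    · by_cases hn : n = 0
      · subst hn
        rw [Finsupp.degree_eq_zero_iff] at hdeg
        have : φ (monomial e' 1) - ψ (monomial e' 1) = 0 := by
          rw [hdeg]
          change φ (C 1) - ψ (C 1) = 0
          rw [C_1, map_one, map_one, sub_self]
        rw [this, zero_mul, totalDegree_zero]
      · have h1 := ih e' hdeg
        have h2 := hφ i
        have h3 := totalDegree_mul (φ (monomial e' 1) - ψ (monomial e' 1)) (φ (X i))
        omega
    · have h1 := totalDegree_map_monomial_le hψ n e' hdeg
      have h2 := hφψ i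
      have h3 := totalDegree_mul (ψ (monomial e' 1)) (φ (X i) - ψ (X i))
      omega

theorem totalDegree_map_sub_le {k σ A τ : Type*} [Field k] [CommRing A] {ι : k → A}
    {φ ψ : MvPolynomial σ k →+* MvPolynomial τ A} (hφ : ∀ i, (φ (X i)).totalDegree ≤ 1)
    (hψ : ∀ i, (ψ (X i)).totalDegree ≤ 1) (hφψ : ∀ i, (φ (X i) - ψ (X i)).totalDegree = 0)
    (hφC : ∀ c, φ (C c) = C (ι c)) (hψC : ∀ c, ψ (C c) = C (ι c)) (G : MvPolynomial σ k) :
    (φ G - ψ G).totalDegree ≤ G.totalDegree - 1 := by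
  have hsum : φ G - ψ G = ∑ e ∈ G.support, C (ι (coeff e G)) *
      (φ (monomial e 1) - ψ (monomial e 1)) := by
    conv_lhs => rw [G.as_sum, map_sum, map_sum, ← Finset.sum_sub_distrib]
    refine Finset.sum_congr rfl fun e _ => ?_
    rw [← mul_one (coeff e G), ← C_mul_monomial, map_mul, map_mul, hφC, hψC, mul_one]
    ring
  rw [hsum]
  refine totalDegree_finsetSum_le fun e he => ?_
  refine (totalDegree_mul _ _).trans ?_
  rw [totalDegree_C, zero_add]
  refine (totalDegree_map_monomial_sub_le hφ hψ hφψ _ e rfl).trans (Nat.sub_le_sub_right ?_ 1)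
  exact le_totalDegree he

theorem totalDegree_map_le {k σ A τ : Type*} [Field k] [CommRing A] {ι : k → A}
    {φ : MvPolynomial σ k →+* MvPolynomial τ A} (hφ : ∀ i, (φ (X i)).totalDegree ≤ 1)
    (hφC : ∀ c, φ (C c) = C (ι c)) (G : MvPolynomial σ k) :
    (φ G).totalDegree ≤ G.totalDegree := by
  conv_lhs => rw [G.as_sum, map_sum]
  refine totalDegree_finsetSum_le fun e he => ?_
  rw [← mul_one (coeff e G), ← C_mul_monomial, map_mul, hφC]
  refine (totalDegree_mul _ _).trans ?_
  rw [totalDegree_C, zero_add]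
  exact (totalDegree_map_monomial_le hφ _ e rfl).trans (le_totalDegree he)

open MonomialOrder in
theorem degree_degLex_eq_of_totalDegree_lt {τ A : Type*} [LinearOrder τ] [WellFoundedGT τ]
    [CommRing A] {P Q : MvPolynomial τ A} (h : (P - Q).totalDegree < Q.totalDegree) :
    degLex.degree P = degLex.degree Q := by
  have : degLex.toSyn (degLex.degree (P - Q)) < degLex.toSyn (degLex.degree Q) := by
    rw [degLex_lt_iff, Finsupp.DegLex.lt_iff]
    left
    simpa [degree_degLexDegree] using h
  have h2 := degree_add_of_lt this
  rwa [add_sub_cancel] at h2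

variable {σ : Type*} [DecidableEq σ] {x y : σ}

theorem totalDegree_genericSlice_X_le (p : σ → ℚ) (i : σ) :
    (genericSlice x y p (X i)).totalDegree ≤ 1 := by
  rw [genericSlice_X]
  split_ifs
  · exact (totalDegree_X _).le
  · refine (totalDegree_add _ _).trans (max_le (by rw [totalDegree_C]; exact Nat.zero_le _)
      ((totalDegree_mul _ _).trans ?_))
    rw [totalDegree_C, zero_add]
    exact (totalDegree_X _).le

theorem totalDegree_genericSlice_le (p : σ → ℚ) (G : MvPolynomial σ ℚ) :
    (genericSlice x y p G).totalDegree ≤ G.totalDegree :=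
  totalDegree_map_le (totalDegree_genericSlice_X_le p) (genericSlice_C p) G

theorem isHomogeneous_genericSlice_zero {G : MvPolynomial σ ℚ} {d : ℕ} (hG : G.IsHomogeneous d) :
    (genericSlice x y 0 G).IsHomogeneous d := by
  rw [genericSlice_apply]
  have := (hG.map (C : ℚ →+* MvPolynomial (Free x y) ℚ)).aeval
    (fun i => (if i = y then X 1 else C (C ((0 : σ → ℚ) i) - direction x y X i *
      C ((0 : σ → ℚ) x)) + C (direction x y X i) * X 0 :
        MvPolynomial (Fin 2) (MvPolynomial (Free x y) ℚ))) (n := 1) fun i => ?_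
  · rwa [one_mul] at this
  · split_ifs
    · exact isHomogeneous_X _ _
    · simp only [Pi.zero_apply, C_0, mul_zero, sub_zero, zero_add]
      exact isHomogeneous_C_mul_X _ _

open MonomialOrder in
/-- The leading exponent of the generic slice through `p` does not depend on `p`. -/
theorem exists_degree_genericSlice (hxy : x ≠ y) {f : MvPolynomial σ ℚ} (hf : f.totalDegree ≠ 0) :
    ∃ δ : Fin 2 →₀ ℕ, δ.degree = f.totalDegree ∧
      ∀ p, degLex.degree (genericSlice x y p f) = δ := by
  set d := f.totalDegree with hd
  set g := homogeneousComponent d f with hg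
  have hg0 : g ≠ 0 := by
    have hf0 : f ≠ 0 := fun h => hf (by rw [hd, h, totalDegree_zero])
    obtain ⟨e, he, hed⟩ := Finset.exists_mem_eq_sup f.support (support_nonempty.mpr hf0)
      fun s => s.sum fun _ e => e
    intro h
    have := congrArg (coeff e) h
    rw [hg, coeff_homogeneousComponent, if_pos (show e.degree = d from hed.symm), coeff_zero] at this
    exact (mem_support_iff.mp he) this
  have hψg : genericSlice x y 0 g ≠ 0 := fun h =>
    hg0 (genericSlice_injective hxy 0 (h.trans (map_zero _).symm))
  have hdeg : (genericSlice x y 0 g).totalDegree = d :=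
    (isHomogeneous_genericSlice_zero (homogeneousComponent_isHomogeneous d f)).totalDegree hψg
  have hfg : (f - g).totalDegree ≤ d - 1 := by
    refine Finset.sup_le fun e he => ?_
    by_contra! h
    change d - 1 < e.degree at h
    refine (mem_support_iff.mp he) ?_
    rw [coeff_sub, hg, coeff_homogeneousComponent]
    split_ifs with h1
    · exact sub_self _
    · rw [sub_zero]
      refine coeff_eq_zero_of_totalDegree_lt ?_
      rw [← hd]
      change d < e.degree
      omega
  refine ⟨degLex.degree (genericSlice x y 0 g), by rw [degree_degLexDegree, hdeg], fun p =>
    degree_degLex_eq_of_totalDegree_lt ?_⟩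
  have hsplit : genericSlice x y p f - genericSlice x y 0 g
      = (genericSlice x y p f - genericSlice x y 0 f) + genericSlice x y 0 (f - g) := by
    rw [map_sub]; ring
  rw [hsplit, hdeg]
  refine lt_of_le_of_lt (totalDegree_add _ _) (max_lt ?_ ?_)
  · have := totalDegree_map_sub_le (totalDegree_genericSlice_X_le p)
      (totalDegree_genericSlice_X_le 0) (fun i => ?_) (genericSlice_C p) (genericSlice_C (x := x) (y := y) 0) f
    · omega
    · rw [genericSlice_X, genericSlice_X]
      split_ifs
      · rw [sub_self, totalDegree_zero]
      · rw [add_sub_add_right_eq_sub, ← C_sub, totalDegree_C]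
  · have := totalDegree_genericSlice_le (x := x) (y := y) 0 (f - g)
    omega

open MonomialOrder in
theorem not_dvd_sum_monomial {τ k : Type*} [LinearOrder τ] [WellFoundedGT τ] [CommRing k]
    [IsDomain k] {F : MvPolynomial τ k} {s : ℕ} {e : Fin s → τ →₀ ℕ} (he : Function.Injective e)
    (heF : ∀ j, ¬ degLex.degree F ≤ e j) {c : Fin s → k} {j₀ : Fin s} (hc : c j₀ ≠ 0) :
    ¬ F ∣ ∑ j, monomial (e j) (c j) := by
  classical
  rintro ⟨Q, hQ⟩
  have hcoeff : ∀ u, coeff u (∑ j, monomial (e j) (c j)) ≠ 0 → ∃ j, u = e j := by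
    intro u hu
    rw [coeff_sum] at hu
    obtain ⟨j, -, hj⟩ := Finset.exists_ne_zero_of_sum_ne_zero hu
    rw [coeff_monomial] at hj
    exact ⟨j, by_contra fun h => hj (if_neg (Ne.symm h))⟩
  have h0 : (∑ j, monomial (e j) (c j)) ≠ 0 := by
    intro h
    have := congrArg (coeff (e j₀)) h
    rw [coeff_sum, Finset.sum_eq_single j₀, coeff_monomial, if_pos rfl, coeff_zero] at this
    · exact hc this
    · intro j _ hj
      rw [coeff_monomial, if_neg fun h => hj (he h)]
    · simp
  obtain ⟨j, hj⟩ := hcoeff _ (mem_support_iff.mp (degLex.degree_mem_support h0))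
  rw [hQ, degree_mul (left_ne_zero_of_mul (hQ ▸ h0)) (right_ne_zero_of_mul (hQ ▸ h0))] at hj
  exact heF j (hj ▸ le_self_add)

theorem degree_map_of_injective {τ A B : Type*} (m : MonomialOrder τ) [CommRing A] [CommRing B]
    {φ : A →+* B} (hφ : Function.Injective φ) (P : MvPolynomial τ A) :
    m.degree (map φ P) = m.degree P := by
  unfold MonomialOrder.degree
  rw [support_map_of_injective _ hφ]

end Leading

end BombieriPila

namespace BombieriPila

open MvPolynomial

/-! ### Specialisation of the direction -/

section Specialisation

variable {k σ τ : Type*} [Field k]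

theorem exists_swap (k σ τ : Type*) [Field k] :
    ∃ Φ : MvPolynomial σ (MvPolynomial τ k) ≃+* MvPolynomial τ (MvPolynomial σ k),
      (∀ p, Φ (C p) = map C p) ∧ ∀ i, Φ (X i) = C (X i) :=
  ⟨(commAlgEquiv k σ τ).toRingEquiv, fun p => commAlgEquiv_C p,
    fun i => commAlgEquiv_X i⟩

variable {Φ : MvPolynomial σ (MvPolynomial τ k) ≃+* MvPolynomial τ (MvPolynomial σ k)}

theorem swap_map_C (hC : ∀ p, Φ (C p) = map C p) (hX : ∀ i, Φ (X i) = C (X i))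
    (f : MvPolynomial σ k) : Φ (map C f) = C f := by
  have : Φ.toRingHom.comp (map C) = C := by
    refine ringHom_ext (fun r => ?_) fun i => ?_
    · change Φ (map C (C r)) = _
      rw [map_C, hC, map_C]
    · change Φ (map C (X i)) = _
      rw [map_X, hX]
  exact congrArg (fun φ : MvPolynomial σ k →+* MvPolynomial τ (MvPolynomial σ k) => φ f) this

theorem totalDegree_swap_le (hC : ∀ p, Φ (C p) = map C p) (hX : ∀ i, Φ (X i) = C (X i)) {K : ℕ}
    {P : MvPolynomial σ (MvPolynomial τ k)} (hP : P ∈ coeffFilt σ τ k K) :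
    (Φ P).totalDegree ≤ K := by
  rw [mem_coeffFilt] at hP
  rw [P.as_sum, map_sum]
  refine totalDegree_finsetSum_le fun e _ => ?_
  have : Φ (e.prod fun n e => X n ^ e) = C (e.prod fun n e => X n ^ e) := by
    rw [Finsupp.prod, map_prod, Finsupp.prod, map_prod]
    refine Finset.prod_congr rfl fun i _ => ?_
    rw [map_pow, hX, C_pow]
  rw [monomial_eq, map_mul, hC, this]
  refine (totalDegree_mul _ _).trans ?_
  rw [totalDegree_C, add_zero]
  exact (Finset.sup_mono (support_map_subset _ _)).trans (hP e)

theorem eval_swap (hC : ∀ p, Φ (C p) = map C p) (hX : ∀ i, Φ (X i) = C (X i)) (v : τ → ℕ)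
    (P : MvPolynomial σ (MvPolynomial τ k)) :
    eval (fun i => (v i : MvPolynomial σ k)) (Φ P) = map (eval fun i => (v i : k)) P := by
  have h2 : ((eval (fun i => (v i : MvPolynomial σ k))).comp (map C))
      = (C : k →+* MvPolynomial σ k).comp (eval fun i => (v i : k)) := by
    refine ringHom_ext (fun r => ?_) fun i => ?_
    · simp only [RingHom.comp_apply, map_C, eval_C]
    · simp only [RingHom.comp_apply, map_X, eval_X, map_natCast]
  have : (eval (fun i => (v i : MvPolynomial σ k))).comp Φ.toRingHom
      = map (eval fun i => (v i : k)) := by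
    refine ringHom_ext (fun r => ?_) fun i => ?_
    · change eval _ (Φ (C r)) = _
      rw [hC, map_C]
      exact congrArg (fun φ : MvPolynomial τ k →+* MvPolynomial σ k => φ r) h2
    · change eval _ (Φ (X i)) = _
      rw [hX, eval_C, map_X]
  exact congrArg (fun φ : MvPolynomial σ (MvPolynomial τ k) →+* MvPolynomial σ k => φ P) this

theorem exists_specialisation_not_dvd [CharZero k] [Finite τ] {f : MvPolynomial σ k}
    (hf : Irreducible f) {P : MvPolynomial σ (MvPolynomial τ k)} {K : ℕ}
    (hP : P ∈ coeffFilt σ τ k K) (h : ¬ map C f ∣ P) :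
    ∃ v : τ → ℕ, (∀ i, v i ≤ K) ∧ ¬ f ∣ map (eval fun i => (v i : k)) P := by
  classical
  obtain ⟨Φ, hC, hX⟩ := exists_swap k σ τ
  have hprime := hf.prime
  let I := Ideal.span {f}
  have hI : I.IsPrime := (Ideal.span_singleton_prime hprime.ne_zero).mpr hprime
  let q := Ideal.Quotient.mk I
  have hq : ∀ r, q r = 0 ↔ f ∣ r := fun r => by
    rw [Ideal.Quotient.eq_zero_iff_mem, Ideal.mem_span_singleton]
  have hchar : CharZero (MvPolynomial σ k ⧸ I) :=
    charZero_of_injective_algebraMap (algebraMap k (MvPolynomial σ k ⧸ I)).injective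
  have hne : map q (Φ P) ≠ 0 := by
    rw [Ne, ← C_dvd_iff_map_hom_eq_zero q f hq, ← swap_map_C hC hX]
    exact fun h' => h ((map_dvd_iff Φ).mp h')
  have hex : ∃ w : τ → MvPolynomial σ k ⧸ I,
      (∀ i, w i ∈ (Finset.range (K + 1)).image (fun m : ℕ => (m : MvPolynomial σ k ⧸ I))) ∧
        eval w (map q (Φ P)) ≠ 0 := by
    by_contra! hcon
    refine hne (eq_zero_of_eval_zero_at_prod_finset _
      (fun _ => (Finset.range (K + 1)).image (fun m : ℕ => (m : MvPolynomial σ k ⧸ I)))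
      (fun i => ?_) hcon)
    rw [Finset.card_image_of_injective _ Nat.cast_injective, Finset.card_range, Nat.lt_succ_iff]
    exact (degreeOf_le_totalDegree _ _).trans ((Finset.sup_mono
      (support_map_subset _ _)).trans (totalDegree_swap_le hC hX hP))
  obtain ⟨w, hw, hw0⟩ := hex
  simp only [Finset.mem_image, Finset.mem_range, Nat.lt_succ_iff] at hw
  choose v hvK hv using hw
  refine ⟨v, hvK, fun hdvd => hw0 ?_⟩
  rw [← (hq _), ← eval_swap hC hX] at hdvd
  have hwv : w = fun i => q (v i : MvPolynomial σ k) := by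
    funext i; rw [← hv i, map_natCast]
  rw [hwv, eval_map, ← hdvd]
  rw [← eval₂_id, eval₂_comp_left, RingHom.comp_id]
  rfl

theorem prime_map_C {f : MvPolynomial σ k} (hf : Irreducible f) :
    Prime (map C f : MvPolynomial σ (MvPolynomial τ k)) := by
  obtain ⟨Φ, hC, hX⟩ := exists_swap k σ τ
  rw [← MulEquiv.prime_iff Φ]
  rw [swap_map_C hC hX, prime_C_iff]
  exact hf.prime

end Specialisation

end BombieriPila

namespace BombieriPila

open MvPolynomial

/-! ### Wronskians along generic directions -/

theorem totalDegree_pderiv_lt {σ R : Type*} [CommRing R] {y : σ} {f : MvPolynomial σ R}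
    (hfy : pderiv y f ≠ 0) : (pderiv y f).totalDegree < f.totalDegree := by
  obtain ⟨u, hu, hdeg⟩ := Finset.exists_mem_eq_sup (pderiv y f).support (support_nonempty.mpr hfy)
    fun u => u.degree
  have htd : (pderiv y f).totalDegree = u.degree := hdeg
  have hmem : u + Finsupp.single y 1 ∈ f.support := by
    rw [mem_support_iff] at hu ⊢
    contrapose! hu
    rw [coeff_pderiv, hu, zero_mul]
  have := le_totalDegree hmem
  change (u + Finsupp.single y 1).degree ≤ _ at this
  rw [map_add, Finsupp.degree_single] at this
  omega

theorem not_dvd_pderiv {σ R : Type*} [CommRing R] [IsDomain R] {y : σ} {f : MvPolynomial σ R}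
    (hfy : pderiv y f ≠ 0) : ¬ f ∣ pderiv y f := fun h =>
  (totalDegree_le_of_dvd_of_isDomain h hfy).not_gt (totalDegree_pderiv_lt hfy)

section PlaneMonomial

variable {σ R : Type*} [CommRing R]

/-- The monomial in the two coordinates `x`, `y` with exponent `e j`. -/
noncomputable def planeMonomial (R : Type*) [CommRing R] (x y : σ) (e : ℕ → Fin 2 →₀ ℕ) (j : ℕ) :
    MvPolynomial σ R := X x ^ e j 0 * X y ^ e j 1

theorem eval_map_apply {S : Type*} [CommRing S] (φ : R →+* S) (p : σ → R) (G : MvPolynomial σ R) :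
    eval (fun i => φ (p i)) (map φ G) = φ (eval p G) := by
  rw [eval_map, ← eval₂_id, eval₂_comp_left, RingHom.comp_id]
  rfl

theorem map_planeMonomial {S : Type*} [CommRing S] (φ : R →+* S) (x y : σ) (e : ℕ → Fin 2 →₀ ℕ)
    (j : ℕ) : map φ (planeMonomial R x y e j) = planeMonomial S x y e j := by
  simp [planeMonomial]

theorem totalDegree_planeMonomial_le (x y : σ) (e : ℕ → Fin 2 →₀ ℕ) (j : ℕ) :
    (planeMonomial R x y e j).totalDegree ≤ (e j).degree := by
  have : (e j).degree = e j 0 + e j 1 := by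
    rw [Finsupp.degree_eq_sum, Fin.sum_univ_two]
  rw [this]
  cases subsingleton_or_nontrivial R
  · rw [Subsingleton.elim (planeMonomial R x y e j) 0, totalDegree_zero]
    exact Nat.zero_le _
  refine (totalDegree_mul _ _).trans (add_le_add ?_ ?_) <;>
    rw [totalDegree_X_pow]

theorem planeMonomial_mem_coeffFilt {τ : Type*} (x y : σ) (e : ℕ → Fin 2 →₀ ℕ) (j : ℕ) :
    planeMonomial (MvPolynomial τ R) x y e j ∈ coeffFilt σ τ R 0 := by
  classical
  intro u
  have : planeMonomial (MvPolynomial τ R) x y e j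
      = monomial (Finsupp.single x (e j 0) + Finsupp.single y (e j 1)) 1 := by
    rw [planeMonomial, X_pow_eq_monomial, X_pow_eq_monomial, monomial_mul, one_mul]
  rw [this, coeff_monomial]
  split_ifs <;> simp

theorem slice_planeMonomial [DecidableEq σ] {x y : σ} (hxy : x ≠ y) {c a : σ → R} (hc : c x = 0)
    (ha : a x = 1) (e : ℕ → Fin 2 →₀ ℕ) (j : ℕ) :
    slice y c a (planeMonomial R x y e j) = monomial (e j) 1 := by
  rw [planeMonomial, map_mul, map_pow, map_pow, slice_X, slice_X, if_neg hxy, if_pos rfl, hc, ha,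
    C_0, zero_add, C_1, one_mul, monomial_eq, C_1, one_mul, Finsupp.prod_fintype _ _ (by simp),
    Fin.prod_univ_two]

end PlaneMonomial

section GenericWronskian

variable {σ : Type*} [DecidableEq σ] {x y : σ}

theorem eval_wronskian_generic_eq_zero (hxy : x ≠ y) {f : MvPolynomial σ ℚ} (hf : Irreducible f)
    {p : σ → ℚ} (hp : eval p f = 0) (hpy : eval p (pderiv y f) ≠ 0) {e : ℕ → Fin 2 →₀ ℕ} {m : ℕ}
    (he : Function.Injective fun j : Fin (m + 1) => e j)
    (heδ : ∀ j : Fin (m + 1), ¬ MonomialOrder.degLex.degree (genericSlice x y p f) ≤ e j)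
    (hdvd : map C f ∣ wronskian (tangent y (direction x y X) (map C f))
      (planeMonomial (MvPolynomial (Free x y) ℚ) x y e) (m + 1)) :
    eval (fun i => C (p i)) (wronskian (tangent y (direction x y X) (map C f))
      (planeMonomial (MvPolynomial (Free x y) ℚ) x y e) m) = 0 := by
  obtain ⟨ι, hι, hirr⟩ : ∃ ι : MvPolynomial (Free x y) ℚ →+*
      FractionRing (MvPolynomial (Free x y) ℚ), Function.Injective ι ∧
        Irreducible (map ι (genericSlice x y p f)) :=
    ⟨algebraMap _ _, IsFractionRing.injective _ _, irreducible_map_genericSlice hxy hf hp hpy⟩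
  set K := FractionRing (MvPolynomial (Free x y) ℚ)
  set c : σ → MvPolynomial (Free x y) ℚ := fun i => C (p i) - direction x y X i * C (p x) with hc
  have hcx : c x = 0 := by rw [hc]; simp [direction_x]
  set F := map ι (genericSlice x y p f) with hF
  obtain ⟨ρ, hρ⟩ : ∃ ρ : MvPolynomial σ (MvPolynomial (Free x y) ℚ) →+* MvPolynomial (Fin 2) K,
      ∀ G, ρ G = map ι (slice y c (direction x y X) G) :=
    ⟨(map ι).comp (slice y c (direction x y X)).toRingHom, fun G => rfl⟩
  have hρf : ρ (map C f) = F := by rw [hρ, hF, genericSlice_apply]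
  have hρθ : ∀ G, ρ (tangent y (direction x y X) (map C f) G)
      = tangent 1 ![1, 0] F (ρ G) := fun G => by
    rw [hρ, slice_tangent c (direction_y hxy _), map_tangent_map, ← hρ, ← hρ, hρf]
    congr 2
    funext i
    fin_cases i
    · exact map_one ι
    · exact map_zero ι
  have hρh : ∀ j, ρ (planeMonomial _ x y e j) = monomial (e j) 1 := fun j => by
    rw [hρ, slice_planeMonomial hxy hcx (direction_x _), map_monomial, map_one]
  have hρW := map_wronskian ρ hρθ hρh
  have heval : ∀ G, eval (fun i => ι (![C (p x), C (p y)] i)) (ρ G)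
      = ι (eval (fun i => C (p i)) G) := fun G => by
    have h1 : eval ![C (p x), C (p y)] (slice y c (direction x y X) G)
        = eval (fun i => C (p i)) G := by
      rw [eval_slice]
      congr 2
      funext i
      split_ifs with h
      · subst h; simp
      · simp [hc]
    rw [← h1, hρ, eval_map_apply ι]
  refine hι ?_
  rw [map_zero, ← heval, hρW]
  refine eval_wronskian_eq_zero_of_dvd hirr _ ?_ ?_ _ m ?_ ?_
  · rw [← hρf, heval, eval_map_apply C, hp, C_0, map_zero]
  · have : pderiv 1 F = ρ (map C (pderiv y f)) := by
      rw [← hρf, hρ, hρ, map_pderiv_map, slice_pderiv, map_pderiv_map]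
    rw [this, heval, eval_map_apply C]
    exact fun h => hpy (C_injective _ _ ((hι (h.trans (map_zero ι).symm)).trans C_0.symm))
  · intro c' hc' hd
    refine not_dvd_sum_monomial he (fun j => ?_) hc' (F := F) ?_
    · rw [hF, degree_map_of_injective _ hι]
      exact heδ j
    · convert hd using 2 with j
      rw [C_mul_monomial, mul_one]
  · rw [← hρW, ← hρf]
    exact map_dvd ρ hdvd

/-- Either the Wronskians along a suitable integral direction do not vanish identically on the
hypersurface, or all points of the hypersurface lie on another one of controlled degree. -/
theorem exists_direction_or_exists_hypersurface [Fintype σ] (hxy : x ≠ y) {f : MvPolynomial σ ℚ}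
    (hf : Irreducible f) (hfy : pderiv y f ≠ 0) {δ : Fin 2 →₀ ℕ}
    (hδ : ∀ p, MonomialOrder.degLex.degree (genericSlice x y p f) = δ) {e : ℕ → Fin 2 →₀ ℕ}
    {s D : ℕ} (he : Function.Injective fun j : Fin s => e j) (heδ : ∀ j < s, ¬ δ ≤ e j)
    (heD : ∀ j < s, (e j).degree ≤ D) :
    (∃ v : Free x y → ℕ, (∀ i, v i ≤ (s + 1) * s ^ 2) ∧ ∀ m ≤ s,
      ¬ f ∣ wronskian (tangent y (direction x y fun i => (v i : ℚ)) f) (planeMonomial ℚ x y e) m) ∨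
    ∃ g : MvPolynomial σ ℚ, ¬ f ∣ g ∧
      g.totalDegree ≤ f.totalDegree + s * (D + s * f.totalDegree) ∧
      ∀ p, eval p f = 0 → eval p g = 0 := by
  set W := wronskian (tangent y (direction x y X) (map C f))
    (planeMonomial (MvPolynomial (Free x y) ℚ) x y e) with hW
  have hprime : Prime (map C f : MvPolynomial σ (MvPolynomial (Free x y) ℚ)) := prime_map_C hf
  have hspec : ∀ (v : Free x y → ℕ) m, map (eval fun i => (v i : ℚ)) (W m)
      = wronskian (tangent y (direction x y fun i => (v i : ℚ)) f) (planeMonomial ℚ x y e) m := by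
    intro v m
    have hfv : map (eval fun i => (v i : ℚ)) (map C f) = f := by
      rw [map_map]
      have : (eval fun i => (v i : ℚ)).comp C = RingHom.id ℚ := by
        ext r; simp
      rw [this, map_id]
    refine map_wronskian (map (eval fun i => (v i : ℚ))) (fun G => ?_)
      (fun j => map_planeMonomial _ _ _ _ _) m
    rw [map_tangent_map, hfv]
    congr 2
    funext i
    rw [map_direction]
    simp
  have hcoeff : ∀ m ≤ s, W m ∈ coeffFilt σ (Free x y) ℚ (s ^ 2) := by
    intro m hm
    have hf0 : (map C f : MvPolynomial σ (MvPolynomial (Free x y) ℚ)) ∈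
        coeffFilt σ (Free x y) ℚ 0 := fun u => by
      rw [coeff_map, totalDegree_C]
    have ha : ∀ i, (direction x y (X : Free x y → MvPolynomial (Free x y) ℚ) i).totalDegree
        ≤ 1 := by
      intro i
      unfold direction
      split_ifs
      · exact (totalDegree_X _).le
      · simp
      · simp
    have := isFiltration_coeffFilt.wronskian_mem (m := m) (tangent_mem_coeffFilt y ha hf0)
      fun j _ => planeMonomial_mem_coeffFilt x y e j
    refine isFiltration_coeffFilt.mono ?_ this
    rw [zero_add, mul_one, ← pow_two]
    exact Nat.pow_le_pow_left hm 2
  by_cases hcase : ∃ m, m < s ∧ map C f ∣ W (m + 1)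
  · right
    classical
    set m := Nat.find hcase with hmdef
    obtain ⟨hms, hdvd⟩ := Nat.find_spec hcase
    rw [← hmdef] at hms hdvd
    have hndvd : ¬ map C f ∣ W m := by
      cases hm : m with
      | zero =>
        rw [hW, wronskian_zero]
        exact hprime.not_dvd_one
      | succ l =>
        intro h
        exact Nat.find_min hcase (m := l) (by omega) ⟨by omega, h⟩
    obtain ⟨v, -, hv⟩ := exists_specialisation_not_dvd hf (hcoeff m hms.le) hndvd
    rw [hspec] at hv
    refine ⟨pderiv y f * wronskian (tangent y (direction x y fun i => (v i : ℚ)) f)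
      (planeMonomial ℚ x y e) m, fun h => ?_, ?_, fun p hp => ?_⟩
    · rcases hf.prime.dvd_or_dvd h with h | h
      · exact not_dvd_pderiv hfy h
      · exact hv h
    · refine (totalDegree_mul _ _).trans (add_le_add (totalDegree_pderiv_le y f) ?_)
      have := isFiltration_degFilt.wronskian_mem (m := m)
        (tangent_mem_degFilt y (direction x y fun i => (v i : ℚ)) f)
        (h := planeMonomial ℚ x y e) (b := D)
        fun j hj => mem_degFilt.mpr ((totalDegree_planeMonomial_le x y e j).trans
          (heD j (hj.trans hms)))
      refine (mem_degFilt.mp this).trans ?_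
      gcongr
    · rw [map_mul]
      by_cases hpy : eval p (pderiv y f) = 0
      · rw [hpy, zero_mul]
      · have h0 := eval_wronskian_generic_eq_zero hxy hf hp hpy (e := e) (m := m)
          (fun i j hij => by
            have := @he ⟨i, by omega⟩ ⟨j, by omega⟩ hij
            simpa [Fin.ext_iff] using this)
          (fun j => by rw [hδ]; exact heδ j (by omega)) hdvd
        have h1 := congrArg (eval fun i => (v i : ℚ)) h0
        rw [map_zero, ← eval_map_apply (eval fun i => (v i : ℚ)), ← hW, hspec] at h1
        simp only [eval_C] at h1
        rw [h1, mul_zero]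
  · left
    push Not at hcase
    have hP : ∏ m ∈ Finset.range (s + 1), W m ∈ coeffFilt σ (Free x y) ℚ ((s + 1) * s ^ 2) := by
      have := isFiltration_coeffFilt.prod (Finset.range (s + 1)) W (fun _ => s ^ 2)
        fun m hm => hcoeff m (by simpa [Nat.lt_succ_iff] using hm)
      simpa using this
    have hnd : ¬ map C f ∣ ∏ m ∈ Finset.range (s + 1), W m := by
      intro h
      obtain ⟨m, hm, hdvd⟩ := (hprime.dvd_finsetProd_iff _).mp h
      rw [Finset.mem_range, Nat.lt_succ_iff] at hm
      cases m with
      | zero =>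
        rw [hW, wronskian_zero] at hdvd
        exact hprime.not_dvd_one hdvd
      | succ l => exact hcase l (by omega) hdvd
    obtain ⟨v, hvK, hv⟩ := exists_specialisation_not_dvd hf hP hnd
    refine ⟨v, hvK, fun m hm h => hv ?_⟩
    rw [map_prod]
    refine dvd_trans ?_ (Finset.dvd_prod_of_mem _ (Finset.mem_range.mpr (Nat.lt_succ_of_le hm)))
    rw [hspec]
    exact h

end GenericWronskian

end BombieriPila

namespace BombieriPila

open MvPolynomial

/-! ### Exponents outside an orthant -/

section Exponents

/-- Among the exponents of degree `k`, the one at position `t` if one starts with those whose first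
entry is smaller than `p`. -/
noncomputable def exponentAt (p k t : ℕ) : Fin 2 →₀ ℕ :=
  if t < p then Finsupp.single 0 t + Finsupp.single 1 (k - t)
  else Finsupp.single 0 (k + p - t) + Finsupp.single 1 (t - p)

theorem exponentAt_zero (p k t : ℕ) :
    exponentAt p k t 0 = if t < p then t else k + p - t := by
  unfold exponentAt
  split_ifs <;> simp

theorem exponentAt_one (p k t : ℕ) :
    exponentAt p k t 1 = if t < p then k - t else t - p := by
  unfold exponentAt
  split_ifs <;> simp

theorem degree_exponentAt {p k t : ℕ} (ht : t ≤ k) : (exponentAt p k t).degree = k := by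
  rw [Finsupp.degree_eq_sum, Fin.sum_univ_two, exponentAt_zero, exponentAt_one]
  split_ifs <;> omega

/-- The number of exponents of degree at most `D` outside an orthant whose vertex has degree `d`. -/
def exponentCount (d D : ℕ) : ℕ := ∑ k ∈ Finset.range (D + 1), min (k + 1) d

theorem exists_exponents (δ : Fin 2 →₀ ℕ) (D : ℕ) : ∃ e : ℕ → Fin 2 →₀ ℕ,
    (Function.Injective fun j : Fin (exponentCount δ.degree D) => e j) ∧
    (∀ j < exponentCount δ.degree D, ¬ δ ≤ e j) ∧
    (∀ j < exponentCount δ.degree D, (e j).degree ≤ D) ∧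
    ∑ j ∈ Finset.range (exponentCount δ.degree D), (e j).degree ≤ δ.degree * (D * (D + 1) / 2) := by
  set d := δ.degree with hd
  have hdδ : d = δ 0 + δ 1 := by rw [hd, Finsupp.degree_eq_sum, Fin.sum_univ_two]
  set I := (Finset.range (D + 1)).sigma fun k => Finset.range (min (k + 1) d) with hI
  have hcard : I.card = exponentCount d D := by
    rw [hI, Finset.card_sigma, exponentCount]
    simp
  have hmem : ∀ i ∈ I, i.1 < D + 1 ∧ i.2 < i.1 + 1 ∧ i.2 < d := by
    intro i hi
    rw [hI, Finset.mem_sigma, Finset.mem_range, Finset.mem_range, lt_min_iff] at hi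
    exact hi
  set φ : Fin (exponentCount d D) ≃ I := (I.equivFinOfCardEq hcard).symm
  set e : ℕ → Fin 2 →₀ ℕ := fun j =>
    if hj : j < exponentCount d D then exponentAt (δ 0) (φ ⟨j, hj⟩).1.1 (φ ⟨j, hj⟩).1.2 else 0
    with he
  have hej : ∀ j : Fin (exponentCount d D), e j = exponentAt (δ 0) (φ j).1.1 (φ j).1.2 := by
    intro j
    rw [he]
    simp
  have hdeg : ∀ j : Fin (exponentCount d D), (e j).degree = (φ j).1.1 := by
    intro j
    have := hmem _ (φ j).2
    rw [hej, degree_exponentAt (by omega)]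
  refine ⟨e, fun i j hij => ?_, fun j hj hle => ?_, fun j hj => ?_, ?_⟩
  · have h1 : e i = e j := hij
    have hdij : (φ i).1.1 = (φ j).1.1 := by rw [← hdeg, ← hdeg, h1]
    rw [hej, hej] at h1
    have h2 := DFunLike.congr_fun h1 0
    rw [exponentAt_zero, exponentAt_zero] at h2
    have hi := hmem _ (φ i).2
    have hj := hmem _ (φ j).2
    refine φ.injective (Subtype.ext (Sigma.ext hdij (heq_of_eq ?_)))
    split_ifs at h2 <;> omega
  · have h1 := hej ⟨j, hj⟩
    have h2 := hmem _ (φ ⟨j, hj⟩).2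
    change e j = _ at h1
    have h3 := hle 0
    have h4 := hle 1
    rw [h1, exponentAt_zero] at h3
    rw [h1, exponentAt_one] at h4
    split_ifs at h3 h4 <;> omega
  · have := hmem _ (φ ⟨j, hj⟩).2
    have h1 := hdeg ⟨j, hj⟩
    change (e j).degree = _ at h1
    omega
  · rw [Finset.sum_range (n := exponentCount d D) fun j => (e j).degree]
    simp_rw [hdeg]
    rw [φ.sum_comp (fun i : I => i.1.1), Finset.sum_coe_sort I fun i => i.1, hI,
      Finset.sum_sigma]
    simp only [Finset.sum_const, Finset.card_range, smul_eq_mul]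
    have h := Finset.sum_range_id_mul_two (D + 1)
    rw [Nat.add_sub_cancel, mul_comm (D + 1) D] at h
    rw [← h, Nat.mul_div_cancel _ two_pos, Finset.mul_sum]
    gcongr
    exact min_le_right _ _

theorem exponentCount_le (d D : ℕ) : exponentCount d D ≤ (D + 1) * d := by
  unfold exponentCount
  refine (Finset.sum_le_sum fun k _ => min_le_right (k + 1) d).trans ?_
  simp

theorem two_mul_exponentCount {d : ℕ} (hd : 0 < d) (m : ℕ) :
    2 * exponentCount d (d - 1 + m) = d * (d + 1) + 2 * m * d := by
  induction m with
  | zero =>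
    rw [exponentCount, add_zero, Nat.sub_add_cancel hd]
    have : ∑ k ∈ Finset.range d, min (k + 1) d = ∑ k ∈ Finset.range d, (k + 1) :=
      Finset.sum_congr rfl fun k hk => min_eq_left (Finset.mem_range.mp hk)
    rw [this, Finset.sum_add_distrib, mul_add, mul_comm 2, Finset.sum_range_id_mul_two]
    obtain ⟨d, rfl⟩ := Nat.exists_eq_succ_of_ne_zero hd.ne'
    simp
    ring
  | succ m ih =>
    rw [exponentCount, ← add_assoc, Finset.sum_range_succ, mul_add, ← exponentCount, ih,
      min_eq_right (by omega)]
    ring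

theorem two_mul_exponentCount_real {d D : ℕ} (hd : 0 < d) (hD : d ≤ D) :
    (2 : ℝ) * exponentCount d D = 2 * d * D + d * (3 - d) := by
  obtain ⟨m, rfl⟩ := Nat.exists_eq_add_of_le (show d - 1 ≤ D by omega)
  have h := two_mul_exponentCount hd m
  obtain ⟨d, rfl⟩ := Nat.exists_eq_succ_of_ne_zero hd.ne'
  have h' := congrArg (Nat.cast : ℕ → ℝ) h
  simp only [Nat.succ_eq_add_one, Nat.add_sub_cancel] at h' ⊢
  push_cast at h' ⊢
  rw [h']
  ring

theorem lt_exponentCount {d D : ℕ} (hd : 0 < d) (hD : d ≤ D) : D < exponentCount d D := by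
  have h := two_mul_exponentCount_real hd hD
  have hd' : (1 : ℝ) ≤ d := by exact_mod_cast hd
  have hD' : (d : ℝ) ≤ D := by exact_mod_cast hD
  have : (D : ℝ) < exponentCount d D := by nlinarith
  exact_mod_cast this

/-- The sum of the degrees is about `1 / d` times half the square of the number of exponents. -/
theorem degree_sum_le {d l : ℕ} (hd : 0 < d) (hl : 2 ≤ l) :
    (d : ℝ) * ((d * l) * (d * l + 1) / 2) ≤ (1 / d + 2 / l) *
      (exponentCount d (d * l) * (exponentCount d (d * l) - 1) / 2) := by
  have hd' : (1 : ℝ) ≤ d := by exact_mod_cast hd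
  have hl' : (2 : ℝ) ≤ l := by exact_mod_cast hl
  have h := two_mul_exponentCount_real hd (Nat.le_mul_of_pos_right d (by omega : 0 < l))
  push_cast at h
  set s : ℝ := (exponentCount d (d * l) : ℝ)
  set d' : ℝ := (d : ℝ)
  set l' : ℝ := (l : ℝ)
  have hs : s = d' * (d' * l') + d' * (3 - d') / 2 := by linarith
  have h1 : d' * (d' * l' + 1) * (2 * l' - 1) ≤ s * (2 * l') := by
    rw [hs]; nlinarith
  have h2 : d' * (d' * l') * (2 * l' - 1) ≤ (s - 1) * (2 * l') := by
    rw [hs]; nlinarith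
  have h0 : (0 : ℝ) < d' * l' := by positivity
  have h3 : (d' * (d' * l' + 1) * (2 * l' - 1)) * (d' * (d' * l') * (2 * l' - 1))
      ≤ (s * (2 * l')) * ((s - 1) * (2 * l')) :=
    mul_le_mul h1 h2 (by nlinarith [mul_pos (by linarith : (0 : ℝ) < d') h0])
      (le_trans (by nlinarith [mul_pos (by linarith : (0 : ℝ) < d') h0]) h1)
  have h4 : 4 * l' ^ 3 ≤ (l' + 2 * d') * (2 * l' - 1) ^ 2 := by nlinarith
  have h5 : d' * (d' * l' * (d' * l' + 1) / 2) * (4 * d' * l' ^ 3) ≤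
      (l' + 2 * d') * (s * (s - 1) / 2) * (4 * l' ^ 2) := by
    have e1 := mul_le_mul_of_nonneg_left h3 (by positivity : 0 ≤ l' + 2 * d')
    have e2 := mul_le_mul_of_nonneg_left h4
      (by positivity : 0 ≤ d' * (d' * l' + 1) * (d' * (d' * l')))
    nlinarith
  have h6 : (1 / d' + 2 / l') * (s * (s - 1) / 2)
      = (l' + 2 * d') * (s * (s - 1) / 2) * (4 * l' ^ 2) / (4 * d' * l' ^ 3) := by
    field_simp
  rw [h6, le_div_iff₀ (by positivity)]
  exact h5

theorem exists_le_degree_eq (δ : Fin 2 →₀ ℕ) {d : ℕ} (hd : d ≤ δ.degree) :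
    ∃ δ' ≤ δ, δ'.degree = d := by
  rw [Finsupp.degree_eq_sum, Fin.sum_univ_two] at hd
  refine ⟨Finsupp.single 0 (min d (δ 0)) + Finsupp.single 1 (d - min d (δ 0)), fun i => ?_, ?_⟩
  · fin_cases i
    · simp
    · simp
      omega
  · rw [Finsupp.degree_eq_sum, Fin.sum_univ_two]
    simp

end Exponents

end BombieriPila

namespace BombieriPila

open Finset

/-! ### Divided differences -/

section Rolle

/-- Rolle's theorem, counting zeros. -/
theorem exists_zeros_deriv {f f' : ℝ → ℝ} {I : Set ℝ} (hI : I.OrdConnected)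
    (hf : ∀ x ∈ I, HasDerivAt f (f' x) x) (T : Finset ℝ) (hT : ∀ t ∈ T, t ∈ I)
    (h0 : ∀ t ∈ T, f t = 0) :
    ∃ T' : Finset ℝ, (∀ t ∈ T', t ∈ I ∧ f' t = 0) ∧ T.card ≤ T'.card + 1 := by
  suffices H : ∃ T' : Finset ℝ, (∀ t ∈ T', t ∈ I ∧ f' t = 0 ∧ ∃ u ∈ T, t < u) ∧
      T.card ≤ T'.card + 1 by
    obtain ⟨T', h1, h2⟩ := H
    exact ⟨T', fun t ht => ⟨(h1 t ht).1, (h1 t ht).2.1⟩, h2⟩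
  induction T using Finset.induction_on_max with
  | empty => exact ⟨∅, by simp, by simp⟩
  | insert a T ha ih =>
    obtain ⟨T', h1, h2⟩ := ih (fun t ht => hT t (mem_insert_of_mem ht))
      fun t ht => h0 t (mem_insert_of_mem ht)
    have haT : a ∉ T := fun h => lt_irrefl _ (ha a h)
    rcases T.eq_empty_or_nonempty with rfl | hne
    · exact ⟨∅, by simp, by simp⟩
    have hm := T.max'_mem hne
    set m := T.max' hne
    have hmI := hT m (mem_insert_of_mem hm)
    have haI := hT a (mem_insert_self _ _)
    have hsub : Set.Icc m a ⊆ I := hI.out hmI haI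
    obtain ⟨c, hc, hc0⟩ := exists_hasDerivAt_eq_zero (ha m hm)
      (fun x hx => (hf x (hsub hx)).continuousAt.continuousWithinAt)
      ((h0 m (mem_insert_of_mem hm)).trans (h0 a (mem_insert_self _ _)).symm)
      fun x hx => hf x (hsub (Set.Ioo_subset_Icc_self hx))
    have hcT : c ∉ T' := fun h => by
      obtain ⟨u, hu, hcu⟩ := (h1 c h).2.2
      exact (hcu.trans_le (T.le_max' u hu)).not_gt hc.1
    refine ⟨insert c T', fun t ht => ?_, ?_⟩
    · rcases mem_insert.mp ht with rfl | ht
      · exact ⟨hsub (Set.Ioo_subset_Icc_self hc), hc0, a, mem_insert_self _ _, hc.2⟩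
      · obtain ⟨h3, h4, u, hu, h5⟩ := h1 t ht
        exact ⟨h3, h4, u, mem_insert_of_mem hu, h5⟩
    · rw [card_insert_of_notMem haT, card_insert_of_notMem hcT]
      omega

theorem exists_zero_of_chain {I : Set ℝ} (hI : I.OrdConnected) {k : ℕ} :
    ∀ {d : ℕ → ℝ → ℝ}, (∀ i < k, ∀ x ∈ I, HasDerivAt (d i) (d (i + 1) x) x) →
    ∀ T : Finset ℝ, (∀ t ∈ T, t ∈ I) → (∀ t ∈ T, d 0 t = 0) → k < T.card →
    ∃ x ∈ I, d k x = 0 := by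
  induction k with
  | zero =>
    intro d _ T hT h0 hc
    obtain ⟨t, ht⟩ := card_pos.mp hc
    exact ⟨t, hT t ht, h0 t ht⟩
  | succ k ih =>
    intro d hd T hT h0 hc
    obtain ⟨T', h1, h2⟩ := exists_zeros_deriv hI (hd 0 (by omega)) T hT h0
    exact ih (d := fun i => d (i + 1)) (fun i hi => hd (i + 1) (by omega)) T'
      (fun t ht => (h1 t ht).1) (fun t ht => (h1 t ht).2) (by omega)

end Rolle

section DividedDifference

/-- The divided difference of order `k` of the values `u` at the nodes `t i, …, t (i + k)`. -/
noncomputable def divDiff (t u : ℕ → ℝ) : ℕ → ℕ → ℝ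
  | 0, i => u i
  | k + 1, i => (divDiff t u k (i + 1) - divDiff t u k i) / (t (i + k + 1) - t i)

theorem exists_interpolation {t : ℕ → ℝ} (ht : StrictMono t) (u : ℕ → ℝ) (k : ℕ) : ∀ i : ℕ,
    ∃ p : Polynomial ℝ, p.natDegree ≤ k ∧ p.coeff k = divDiff t u k i ∧
      ∀ j ≤ k, p.eval (t (i + j)) = u (i + j) := by
  induction k with
  | zero =>
    intro i
    refine ⟨Polynomial.C (u i), by simp, by simp [divDiff], fun j hj => ?_⟩
    obtain rfl : j = 0 := by omega
    simp
  | succ k ih =>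
    intro i
    obtain ⟨p, hp, hpc, hpe⟩ := ih i
    obtain ⟨q, hq, hqc, hqe⟩ := ih (i + 1)
    have hne : t (i + k + 1) - t i ≠ 0 := sub_ne_zero.mpr (ht (by omega : i < i + k + 1)).ne'
    set w := t (i + k + 1) - t i with hw
    refine ⟨Polynomial.C w⁻¹ * ((Polynomial.X - Polynomial.C (t i)) * q
      - (Polynomial.X - Polynomial.C (t (i + k + 1))) * p), ?_, ?_, fun j hj => ?_⟩
    · refine (Polynomial.natDegree_C_mul_le _ _).trans ((Polynomial.natDegree_sub_le _ _).trans
        (max_le ?_ ?_)) <;>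
      · refine Polynomial.natDegree_mul_le.trans ?_
        rw [Polynomial.natDegree_X_sub_C]
        omega
    · have hp0 : p.coeff (k + 1) = 0 := Polynomial.coeff_eq_zero_of_natDegree_lt (by omega)
      have hq0 : q.coeff (k + 1) = 0 := Polynomial.coeff_eq_zero_of_natDegree_lt (by omega)
      rw [Polynomial.coeff_C_mul, Polynomial.coeff_sub, sub_mul, sub_mul, Polynomial.coeff_sub,
        Polynomial.coeff_sub, Polynomial.coeff_X_mul, Polynomial.coeff_X_mul,
        Polynomial.coeff_C_mul, Polynomial.coeff_C_mul, hp0, hq0, hpc, hqc, divDiff, ← hw]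
      ring
    · simp only [Polynomial.eval_mul, Polynomial.eval_sub, Polynomial.eval_C, Polynomial.eval_X]
      rw [inv_mul_eq_iff_eq_mul₀ hne]
      rcases Nat.eq_zero_or_pos j with rfl | hj0
      · rw [add_zero, sub_self, zero_mul, zero_sub, ← neg_mul, neg_sub, ← hw,
          show p.eval (t i) = u i from by simpa using hpe 0 (Nat.zero_le _)]
      · have h1 : q.eval (t (i + j)) = u (i + j) := by
          have := hqe (j - 1) (by omega)
          rwa [show i + 1 + (j - 1) = i + j by omega] at this
        rcases Nat.lt_or_ge k j with hjk | hjk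
        · obtain rfl : j = k + 1 := by omega
          rw [h1, ← add_assoc, sub_self, zero_mul, sub_zero]
        · rw [h1, hpe j hjk, hw]
          ring

/-- The mean value theorem for divided differences. -/
theorem exists_divDiff_eq {I : Set ℝ} (hI : I.OrdConnected) {d : ℕ → ℝ → ℝ} {k : ℕ}
    (hd : ∀ i < k, ∀ x ∈ I, HasDerivAt (d i) (d (i + 1) x) x) {t : ℕ → ℝ} (ht : StrictMono t)
    {i : ℕ} (hi : t i ∈ I) (hik : t (i + k) ∈ I) :
    ∃ x ∈ Set.Icc (t i) (t (i + k)), d k x = (k.factorial : ℝ) * divDiff t (fun j => d 0 (t j)) k i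
    := by
  obtain ⟨p, hp, hpc, hpe⟩ := exists_interpolation ht (fun j => d 0 (t j)) k i
  have hsub : Set.Icc (t i) (t (i + k)) ⊆ I := hI.out hi hik
  obtain ⟨x, hx, hx0⟩ := exists_zero_of_chain (I := Set.Icc (t i) (t (i + k)))
    Set.ordConnected_Icc (k := k)
    (d := fun j x => d j x - (Polynomial.derivative^[j] p).eval x)
    (fun j hj x hx => (hd j hj x (hsub hx)).sub (by
      rw [Function.iterate_succ_apply']
      exact Polynomial.hasDerivAt _ _))
    ((range (k + 1)).image fun j => t (i + j))
    (fun y hy => by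
      obtain ⟨j, hj, rfl⟩ := mem_image.mp hy
      rw [mem_range] at hj
      exact ⟨ht.monotone (by omega), ht.monotone (by omega)⟩)
    (fun y hy => by
      obtain ⟨j, hj, rfl⟩ := mem_image.mp hy
      rw [mem_range] at hj
      simp [hpe j (by omega)])
    (by
      rw [card_image_of_injective _ fun a b hab => by simpa using ht.injective hab, card_range]
      omega)
  refine ⟨x, hx, ?_⟩
  have hconst : Polynomial.derivative^[k] p = Polynomial.C ((k.factorial : ℝ) * p.coeff k) := by
    rw [Polynomial.eq_C_of_natDegree_le_zero ((Polynomial.natDegree_iterate_derivative p k).trans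
      (by omega)), Polynomial.coeff_iterate_derivative, zero_add, Nat.descFactorial_self,
      nsmul_eq_mul]
  rw [hconst, Polynomial.eval_C, hpc] at hx0
  linarith

/-- The Leibniz rule for divided differences. -/
theorem divDiff_mul {t : ℕ → ℝ} (ht : StrictMono t) (u w : ℕ → ℝ) (k : ℕ) : ∀ i : ℕ,
    divDiff t (fun j => u j * w j) k i
      = ∑ j ∈ range (k + 1), divDiff t u j i * divDiff t w (k - j) (i + j) := by
  induction k with
  | zero => intro i; simp [divDiff]
  | succ k ih =>
    intro i
    have hne : ∀ {a b : ℕ}, a < b → t b - t a ≠ 0 := fun h => sub_ne_zero.mpr (ht h).ne'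
    have hstep : ∀ (u : ℕ → ℝ) (k i : ℕ), divDiff t u k (i + 1)
        = divDiff t u k i + (t (i + k + 1) - t i) * divDiff t u (k + 1) i := by
      intro u k i
      rw [divDiff]
      field_simp [hne (by omega : i < i + k + 1)]
      ring
    rw [divDiff, div_eq_iff (hne (by omega)), ih, ih]
    have h1 : ∑ j ∈ range (k + 1), divDiff t u j (i + 1) * divDiff t w (k - j) (i + 1 + j)
        = ∑ j ∈ range (k + 1), divDiff t u j i * divDiff t w (k - j) (i + j + 1)
          + ∑ j ∈ range (k + 1), (t (i + j + 1) - t i) * divDiff t u (j + 1) i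
            * divDiff t w (k - j) (i + (j + 1)) := by
      rw [← sum_add_distrib]
      refine sum_congr rfl fun j _ => ?_
      rw [hstep u j i, show i + 1 + j = i + j + 1 by ring, add_assoc i j 1]
      ring
    have h2 : ∑ j ∈ range (k + 1), divDiff t u j i * divDiff t w (k - j) (i + j + 1)
        = ∑ j ∈ range (k + 1), divDiff t u j i * divDiff t w (k - j) (i + j)
          + ∑ j ∈ range (k + 1), (t (i + k + 1) - t (i + j)) * divDiff t u j i
            * divDiff t w (k + 1 - j) (i + j) := by
      rw [← sum_add_distrib]
      refine sum_congr rfl fun j hj => ?_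
      rw [mem_range] at hj
      rw [hstep w (k - j) (i + j), show i + j + (k - j) + 1 = i + k + 1 by omega,
        show k - j + 1 = k + 1 - j by omega]
      ring
    have h3 : ∑ j ∈ range (k + 1), (t (i + j + 1) - t i) * divDiff t u (j + 1) i
            * divDiff t w (k - j) (i + (j + 1))
        = ∑ j ∈ range (k + 2), (t (i + j) - t i) * divDiff t u j i
            * divDiff t w (k + 1 - j) (i + j) := by
      rw [sum_range_succ' _ (k + 1)]
      simp only [add_zero, sub_self, zero_mul]
      refine sum_congr rfl fun j _ => ?_
      rw [show k + 1 - (j + 1) = k - j by omega, add_assoc i j 1]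
    have h4 : ∑ j ∈ range (k + 1), (t (i + k + 1) - t (i + j)) * divDiff t u j i
            * divDiff t w (k + 1 - j) (i + j)
        = ∑ j ∈ range (k + 2), (t (i + k + 1) - t (i + j)) * divDiff t u j i
            * divDiff t w (k + 1 - j) (i + j) := by
      rw [sum_range_succ _ (k + 1), ← add_assoc, sub_self, zero_mul, zero_mul, add_zero]
    rw [h1, h2, h3, h4, add_assoc, add_sub_cancel_left, ← sum_add_distrib, sum_mul]
    exact sum_congr rfl fun j _ => by ring

theorem abs_divDiff_pow_le {t u : ℕ → ℝ} (ht : StrictMono t) {R B : ℝ} (hR : 0 ≤ R) (hB : 0 ≤ B)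
    {N : ℕ} (h : ∀ k i, i + k < N → |divDiff t u k i| ≤ R * B ^ k) {w : ℕ → ℝ} {C : ℝ} {m : ℕ}
    (hC : 0 ≤ C)
    (hw : ∀ k i, i + k < N → |divDiff t w k i| ≤ C * (k + 1) ^ m * B ^ k) (n : ℕ) :
    ∀ k i, i + k < N →
      |divDiff t (fun j => w j * u j ^ n) k i| ≤ C * R ^ n * (k + 1) ^ (m + n) * B ^ k := by
  induction n with
  | zero => simpa using hw
  | succ n ih =>
    intro k i hik
    have : (fun j => w j * u j ^ (n + 1)) = fun j => (w j * u j ^ n) * u j := by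
      funext j; ring
    rw [this, divDiff_mul ht]
    refine (abs_sum_le_sum_abs _ _).trans ?_
    have hterm : ∀ j ∈ range (k + 1), |divDiff t (fun j => w j * u j ^ n) j i
        * divDiff t u (k - j) (i + j)| ≤ C * R ^ (n + 1) * (k + 1) ^ (m + n) * B ^ k := by
      intro j hj
      rw [mem_range] at hj
      have h1 := ih j i (by omega)
      have h2 := h (k - j) (i + j) (by omega)
      rw [abs_mul]
      have hjk : (j : ℝ) ≤ k := by exact_mod_cast (by omega : j ≤ k)
      calc _ ≤ (C * R ^ n * (j + 1) ^ (m + n) * B ^ j) * (R * B ^ (k - j)) :=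
            mul_le_mul h1 h2 (abs_nonneg _) (by positivity)
        _ = C * R ^ (n + 1) * (j + 1) ^ (m + n) * (B ^ j * B ^ (k - j)) := by ring
        _ = C * R ^ (n + 1) * (j + 1) ^ (m + n) * B ^ k := by
            rw [← pow_add, Nat.add_sub_cancel' (by omega)]
        _ ≤ _ := by gcongr
    refine (sum_le_card_nsmul _ _ _ hterm).trans (le_of_eq ?_)
    rw [card_range, nsmul_eq_mul]
    push_cast
    ring

end DividedDifference

section Determinant

theorem abs_det_divDiff_step_le {t : ℕ → ℝ} (ht : StrictMono t) {s : ℕ} {η : ℝ}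
    (hη : ∀ i < s, ∀ j < s, t i - t j ≤ η) (w : ℕ → ℕ → ℝ) (q : ℕ) :
    |(Matrix.of fun r m : Fin s => divDiff t (w m) (min (r : ℕ) q) (r - q : ℕ)).det|
      ≤ η ^ (s - 1 - q) *
        |(Matrix.of fun r m : Fin s => divDiff t (w m) (min (r : ℕ) (q + 1)) (r - (q + 1) : ℕ)).det|
    := by
  rcases s with - | s
  · simp
  set v : Fin (s + 1) → ℝ := fun r => if q < (r : ℕ) then t r - t (r - (q + 1)) else 1 with hv
  set A := (Matrix.of fun r m : Fin (s + 1) =>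
    divDiff t (w m) (min (r : ℕ) (q + 1)) (r - (q + 1) : ℕ)) with hA
  have hdet : (Matrix.of fun r m : Fin (s + 1) =>
      divDiff t (w m) (min (r : ℕ) q) (r - q : ℕ)).det
      = (Matrix.of fun i j => v i * A i j).det := by
    refine Matrix.det_eq_of_forall_row_eq_smul_add_pred
      (fun r : Fin s => if q < (r : ℕ) + 1 then 1 else 0) (fun j => ?_) fun i j => ?_
    · simp [hv, hA]
    · simp only [Matrix.of_apply, hv, hA, Fin.val_succ, Fin.val_castSucc]
      split_ifs with hq
      · have hne : t ((i : ℕ) + 1) - t (i + 1 - (q + 1)) ≠ 0 :=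
          sub_ne_zero.mpr (ht (by omega : (i : ℕ) + 1 - (q + 1) < i + 1)).ne'
        rw [min_eq_right (by omega : q ≤ (i : ℕ) + 1), min_eq_right (by omega : q + 1 ≤ (i : ℕ) + 1),
          min_eq_right (by omega : q ≤ (i : ℕ)), divDiff,
          show (i : ℕ) + 1 - (q + 1) + q + 1 = i + 1 by omega,
          show (i : ℕ) + 1 - (q + 1) + 1 = i + 1 - q by omega,
          show (i : ℕ) + 1 - (q + 1) = i - q by omega]
        rw [show (i : ℕ) + 1 - (q + 1) = i - q by omega] at hne
        field_simp
        ring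
      · rw [min_eq_left (by omega : (i : ℕ) + 1 ≤ q), min_eq_left (by omega : (i : ℕ) + 1 ≤ q + 1),
          show (i : ℕ) + 1 - q = i + 1 - (q + 1) by omega]
        ring
  rw [hdet, Matrix.det_mul_column, abs_mul, abs_prod]
  refine mul_le_mul_of_nonneg_right ?_ (abs_nonneg _)
  have hle : ∀ r : Fin (s + 1), |v r| ≤ if q < (r : ℕ) then η else 1 := by
    intro r
    simp only [hv]
    split_ifs with hq
    · rw [abs_of_pos (sub_pos.mpr (ht (by omega)))]
      exact hη _ r.2 _ (by omega)
    · simp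
  refine (prod_le_prod (fun _ _ => abs_nonneg _) fun r _ => hle r).trans (le_of_eq ?_)
  rw [Fin.prod_univ_eq_prod_range (fun r => if q < r then η else 1), prod_ite, prod_const_one,
    mul_one, prod_const]
  congr 1
  have : (range (s + 1)).filter (fun r => q < r) = Ioc q s := by
    ext r
    simp only [mem_filter, mem_range, mem_Ioc]
    omega
  rw [this, Nat.card_Ioc, Nat.add_sub_cancel]

/-- A determinant of values is small when the nodes are close together. -/
theorem abs_det_le_mul_abs_det_divDiff {t : ℕ → ℝ} (ht : StrictMono t) {s : ℕ} {η : ℝ} (hη0 : 0 ≤ η)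
    (hη : ∀ i < s, ∀ j < s, t i - t j ≤ η) (w : ℕ → ℕ → ℝ) :
    |(Matrix.of fun r m : Fin s => w m r).det|
      ≤ η ^ (∑ q ∈ range s, (s - 1 - q)) *
        |(Matrix.of fun r m : Fin s => divDiff t (w m) r 0).det| := by
  have key : ∀ n, |(Matrix.of fun r m : Fin s => w m r).det|
      ≤ η ^ (∑ q ∈ range n, (s - 1 - q)) *
        |(Matrix.of fun r m : Fin s => divDiff t (w m) (min (r : ℕ) n) (r - n : ℕ)).det| := by
    intro n
    induction n with
    | zero => simp [divDiff]
    | succ n ih =>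
      refine ih.trans ?_
      rw [sum_range_succ, pow_add, mul_assoc]
      exact mul_le_mul_of_nonneg_left (abs_det_divDiff_step_le ht hη w n) (by positivity)
  refine (key s).trans (le_of_eq ?_)
  congr 4
  funext r m
  rw [min_eq_left r.2.le, Nat.sub_eq_zero_of_le r.2.le]

theorem abs_det_le {s : ℕ} {M : Matrix (Fin s) (Fin s) ℝ} {a b : Fin s → ℝ}
    (h : ∀ r m, |M r m| ≤ a r * b m) :
    |M.det| ≤ s.factorial * ((∏ r, a r) * ∏ m, b m) := by
  rw [Matrix.det_apply]
  refine (abs_sum_le_sum_abs _ _).trans ?_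
  have : ∀ τ ∈ (univ : Finset (Equiv.Perm (Fin s))),
      |Equiv.Perm.sign τ • ∏ i, M (τ i) i| ≤ (∏ r, a r) * ∏ m, b m := by
    intro τ _
    rw [Units.smul_def, zsmul_eq_mul, abs_mul, abs_prod]
    have h1 : |((Equiv.Perm.sign τ : ℤ) : ℝ)| = 1 := by
      rw [← Int.cast_abs, Int.isUnit_iff_abs_eq.mp (Units.isUnit _), Int.cast_one]
    rw [h1, one_mul, ← Equiv.prod_comp τ a, ← prod_mul_distrib]
    exact prod_le_prod (fun _ _ => abs_nonneg _) fun i _ => h _ _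
  refine (sum_le_card_nsmul _ _ _ this).trans (le_of_eq ?_)
  rw [card_univ, Fintype.card_perm, Fintype.card_fin, nsmul_eq_mul]

end Determinant

end BombieriPila

namespace BombieriPila

/-! ### Polya's criterion -/

section Polya

variable {A : Type*} [CommRing A]

open Finset

/-- The differential operator of order `k` which annihilates `h 0, …, h (k - 1)`. -/
def wronskianOp (θ : A → A) (h : ℕ → A) (k : ℕ) (F : A) : A :=
  wronskian θ (Function.update h k F) (k + 1)

theorem wronskianOp_self (θ : A → A) (h : ℕ → A) (k : ℕ) :
    wronskianOp θ h k (h k) = wronskian θ h (k + 1) := by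
  rw [wronskianOp, Function.update_eq_self]

theorem wronskianOp_of_lt (θ : A → A) (h : ℕ → A) {j k : ℕ} (hj : j < k) :
    wronskianOp θ h k (h j) = 0 := by
  refine Matrix.det_zero_of_column_eq (i := (⟨j, by omega⟩ : Fin (k + 1))) (j := Fin.last k)
    (by simp [Fin.ext_iff]; omega) fun i => ?_
  simp [Function.update_of_ne hj.ne]

theorem exists_wronskianOp_eq (θ : A → A) (h : ℕ → A) (k : ℕ) : ∃ α : ℕ → A,
    α k = wronskian θ h k ∧
      ∀ F, wronskianOp θ h k F = ∑ i ∈ range (k + 1), α i * θ^[i] F := by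
  set M : Matrix (Fin (k + 1)) (Fin (k + 1)) A := Matrix.of fun i j => θ^[i] (h j)
  set β : Fin (k + 1) → A := fun i =>
    (-1) ^ ((i : ℕ) + k) * (M.submatrix i.succAbove (Fin.last k).succAbove).det with hβ
  refine ⟨fun i => if hi : i < k + 1 then β ⟨i, hi⟩ else 0, ?_, fun F => ?_⟩
  · simp only [lt_add_iff_pos_right, zero_lt_one, dite_true, hβ]
    rw [← two_mul, pow_mul, neg_one_sq, one_pow, one_mul, wronskian]
    congr 1
    ext i j
    have : (⟨k, lt_add_one k⟩ : Fin (k + 1)) = Fin.last k := rfl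
    simp [M, this]
  · rw [sum_range, wronskianOp, wronskian, Matrix.det_succ_column _ (Fin.last k)]
    refine sum_congr rfl fun i _ => ?_
    have hi : (i : ℕ) < k + 1 := i.2
    simp only [hi, dite_true, Matrix.of_apply, Fin.val_last, Function.update_self, hβ]
    rw [mul_right_comm]
    congr 3
    ext a b
    simp [M, Function.update_of_ne b.2.ne]

theorem wronskianOp_sum {R : Type*} [CommRing R] [Algebra R A] (θ : Derivation R A A) (h : ℕ → A)
    (k : ℕ) (c : ℕ → R) (s : Finset ℕ) :
    wronskianOp θ h k (∑ j ∈ s, c j • h j) = ∑ j ∈ s, c j • wronskianOp θ h k (h j) := by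
  obtain ⟨α, -, hα⟩ := exists_wronskianOp_eq θ h k
  have hit : ∀ i (u : ℕ → A), θ^[i] (∑ j ∈ s, c j • u j) = ∑ j ∈ s, c j • θ^[i] (u j) := by
    intro i
    induction i with
    | zero => intro u; rfl
    | succ i ih =>
      intro u
      simp only [Function.iterate_succ_apply]
      rw [map_sum, ← ih]
      simp only [Derivation.map_smul]
  simp only [hα, hit, smul_sum, mul_sum]
  rw [sum_comm]
  simp only [mul_smul_comm]

/-- The recursion for the operators `wronskianOp`. -/
theorem wronskianOp_recursion [IsDomain A] {R : Type*} [CommRing R] [Algebra R A]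
    (θ : Derivation R A A) (h : ℕ → A) (k : ℕ) (hW : wronskian θ h (k + 1) ≠ 0) (F : A) :
    θ (wronskianOp θ h k F) * wronskian θ h (k + 1)
      - wronskianOp θ h k F * θ (wronskian θ h (k + 1))
      = wronskian θ h k * wronskianOp θ h (k + 1) F := by
  obtain ⟨α, hαk, hα⟩ := exists_wronskianOp_eq θ h k
  obtain ⟨β, hβk, hβ⟩ := exists_wronskianOp_eq θ h (k + 1)
  set W := wronskian θ h (k + 1) with hWdef
  obtain ⟨γ, hγ⟩ : ∃ γ : ℕ → A, ∀ F, θ (wronskianOp θ h k F) * W - wronskianOp θ h k F * θ W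
      - wronskian θ h k * wronskianOp θ h (k + 1) F = ∑ i ∈ range (k + 1), γ i * θ^[i] F := by
    refine ⟨fun i => θ (α i) * W + (if i = 0 then 0 else α (i - 1)) * W - α i * θ W
      - wronskian θ h k * β i, fun F => ?_⟩
    have h1 : θ (wronskianOp θ h k F) = ∑ i ∈ range (k + 1), θ (α i) * θ^[i] F
        + ∑ i ∈ range (k + 1), (if i = 0 then 0 else α (i - 1)) * θ^[i] F
        + α k * θ^[k + 1] F := by
      rw [hα, map_sum, add_assoc, sum_range_succ' (fun i => (if i = 0 then 0 else α (i - 1))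
        * θ^[i] F), if_pos rfl, zero_mul, add_zero]
      simp only [Nat.add_one_ne_zero, if_false, Nat.add_sub_cancel]
      rw [← sum_range_succ (fun i => α i * θ^[i + 1] F), ← sum_add_distrib]
      refine sum_congr rfl fun i _ => ?_
      rw [Derivation.leibniz, Function.iterate_succ_apply', smul_eq_mul, smul_eq_mul]
      ring
    rw [h1, hα, hβ, sum_range_succ _ (k + 1), hβk, hαk]
    simp only [add_mul, sub_mul, sum_add_distrib, sum_sub_distrib]
    have e1 : ∀ u : ℕ → A, ∀ v : A, ∑ i ∈ range (k + 1), u i * v * θ^[i] F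
        = (∑ i ∈ range (k + 1), u i * θ^[i] F) * v := fun u v => by
      rw [sum_mul]; exact sum_congr rfl fun i _ => by ring
    have e2 : ∑ i ∈ range (k + 1), wronskian θ h k * β i * θ^[i] F
        = wronskian θ h k * ∑ i ∈ range (k + 1), β i * θ^[i] F := by
      rw [mul_sum]; exact sum_congr rfl fun i _ => by ring
    rw [e1, e1, e1, e2]
    ring
  have hzero : ∀ j < k + 1, ∑ i ∈ range (k + 1), γ i * θ^[i] (h j) = 0 := by
    intro j hj
    rw [← hγ, wronskianOp_of_lt θ h hj, mul_zero, sub_zero]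
    rcases Nat.lt_succ_iff_lt_or_eq.mp hj with hjk | rfl
    · rw [wronskianOp_of_lt θ h hjk, map_zero, zero_mul, zero_mul, sub_zero]
    · rw [wronskianOp_self, ← hWdef]
      ring
  have hγ0 : (fun i : Fin (k + 1) => γ i) = 0 := by
    refine Matrix.eq_zero_of_vecMul_eq_zero hW (funext fun j => ?_)
    have := hzero j j.2
    rw [sum_range] at this
    simpa [Matrix.vecMul, dotProduct] using this
  refine sub_eq_zero.mp ((hγ F).trans ?_)
  refine sum_eq_zero fun i hi => ?_
  have := congrFun hγ0 ⟨i, mem_range.mp hi⟩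
  simp only [Pi.zero_apply] at this
  rw [this, zero_mul]

/-- Polya's criterion: if the Wronskians do not vanish along an arc, then a non-trivial linear
combination of `s` functions has fewer than `s` zeros on it. -/
theorem card_zeros_lt [IsDomain A] [Algebra ℝ A] (θ : Derivation ℝ A A) {I : Set ℝ}
    (hI : I.OrdConnected) (ev : ℝ → A →ₐ[ℝ] ℝ) {w : ℝ → ℝ} (hw : ∀ x ∈ I, w x ≠ 0)
    (hev : ∀ G, ∀ x ∈ I, HasDerivAt (fun x => ev x G) (ev x (θ G) / w x) x) {h : ℕ → A} {s : ℕ}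
    (hs : ∀ k ≤ s, ∀ x ∈ I, ev x (wronskian θ h k) ≠ 0) {c : ℕ → ℝ} (hc : ∃ j < s, c j ≠ 0)
    {T : Finset ℝ} (hT : ∀ t ∈ T, t ∈ I) (h0 : ∀ t ∈ T, ev t (∑ j ∈ range s, c j • h j) = 0) :
    T.card < s := by
  by_contra! hcard
  set F := ∑ j ∈ range s, c j • h j with hF
  have key : ∀ k ≤ s, ∃ T' : Finset ℝ, (∀ t ∈ T', t ∈ I ∧ ev t (wronskianOp θ h k F) = 0) ∧
      s ≤ T'.card + k := by
    intro k hk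
    induction k with
    | zero =>
      refine ⟨T, fun t ht => ⟨hT t ht, ?_⟩, by simpa using hcard⟩
      have : wronskianOp θ h 0 F = F := by simp [wronskianOp, wronskian]
      rw [this, h0 t ht]
    | succ k ih =>
      obtain ⟨T₀, h1, h2⟩ := ih (by omega)
      obtain ⟨T', h3, h4⟩ := exists_zeros_deriv hI
        (fun x hx => (hev (wronskianOp θ h k F) x hx).div (hev (wronskian θ h (k + 1)) x hx)
          (hs (k + 1) hk x hx)) T₀ (fun t ht => (h1 t ht).1) fun t ht => by
          simp only [Pi.div_apply, (h1 t ht).2, zero_div]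
      refine ⟨T', fun t ht => ⟨(h3 t ht).1, ?_⟩, by omega⟩
      have hx := (h3 t ht).1
      have hW : wronskian θ h (k + 1) ≠ 0 := fun h => hs (k + 1) hk t hx (by rw [h, map_zero])
      have h5 := congrArg (ev t) (wronskianOp_recursion θ h k hW F)
      rw [map_sub, map_mul, map_mul, map_mul] at h5
      have h6 := (h3 t ht).2
      rw [div_eq_zero_iff, or_iff_left (pow_ne_zero _ (hs (k + 1) hk t hx)), div_mul_eq_mul_div,
        mul_div_assoc', div_sub_div_same, div_eq_zero_iff, or_iff_left (hw t hx), h5,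
        mul_eq_zero, or_iff_right (hs k (by omega) t hx)] at h6
      exact h6
  obtain ⟨j₀, hj₀, hcj₀⟩ := hc
  have hne : ((range s).filter fun j => c j ≠ 0).Nonempty := ⟨j₀, by simp [hj₀, hcj₀]⟩
  set m := ((range s).filter fun j => c j ≠ 0).max' hne
  have hm : m ∈ (range s).filter fun j => c j ≠ 0 := max'_mem _ hne
  rw [mem_filter, mem_range] at hm
  have htop : wronskianOp θ h m F = c m • wronskian θ h (m + 1) := by
    rw [hF, wronskianOp_sum, sum_eq_single m, wronskianOp_self]
    · intro j hj hjm
      rcases lt_or_gt_of_ne hjm with hlt | hlt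
      · rw [wronskianOp_of_lt θ h hlt, smul_zero]
      · by_cases hcj : c j = 0
        · rw [hcj, zero_smul]
        · exact absurd (le_max' _ j (mem_filter.mpr ⟨hj, hcj⟩)) (not_le.mpr hlt)
    · intro hm'
      exact absurd (mem_range.mpr hm.1) hm'
  obtain ⟨T', h1, h2⟩ := key m hm.1.le
  obtain ⟨t, ht⟩ := card_pos.mp (by omega : 0 < T'.card)
  obtain ⟨htI, ht0⟩ := h1 t ht
  rw [htop, map_smul, smul_eq_zero, or_iff_right hm.2] at ht0
  exact hs (m + 1) hm.1 t htI ht0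

end Polya

end BombieriPila

namespace BombieriPila

open MvPolynomial Filter
open scoped Topology

/-! ### Arcs of plane curves -/

section Branch

theorem hasFDerivAt_eval (F : MvPolynomial (Fin 2) ℝ) (v : ℝ × ℝ) :
    HasFDerivAt (fun v : ℝ × ℝ => eval ![v.1, v.2] F)
      (eval ![v.1, v.2] (pderiv 0 F) • ContinuousLinearMap.fst ℝ ℝ ℝ
        + eval ![v.1, v.2] (pderiv 1 F) • ContinuousLinearMap.snd ℝ ℝ ℝ) v := by
  induction F using MvPolynomial.induction_on with
  | C a => simpa using hasFDerivAt_const a v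
  | add p q hp hq =>
    simp only [map_add]
    refine (hp.add hq).congr_fderiv ?_
    module
  | mul_X p i hp =>
    have hX : HasFDerivAt (fun v : ℝ × ℝ => (![v.1, v.2] : Fin 2 → ℝ) i)
        (eval ![v.1, v.2] (pderiv 0 (X i : MvPolynomial (Fin 2) ℝ)) •
            ContinuousLinearMap.fst ℝ ℝ ℝ
          + eval ![v.1, v.2] (pderiv 1 (X i : MvPolynomial (Fin 2) ℝ)) •
            ContinuousLinearMap.snd ℝ ℝ ℝ) v := by
      fin_cases i
      · simpa [pderiv_X] using hasFDerivAt_fst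
      · simpa [pderiv_X] using hasFDerivAt_snd
    simp only [map_mul, eval_X]
    refine (hp.mul hX).congr_fderiv ?_
    simp only [Derivation.leibniz, map_add, smul_eq_mul, map_mul, eval_X]
    module

theorem contDiff_eval (F : MvPolynomial (Fin 2) ℝ) {n : WithTop ℕ∞} :
    ContDiff ℝ n (fun v : ℝ × ℝ => eval ![v.1, v.2] F) := by
  induction F using MvPolynomial.induction_on with
  | C a => simpa using contDiff_const
  | add p q hp hq => simpa using hp.add hq
  | mul_X p i hp =>
    simp only [map_mul, eval_X]
    refine hp.mul ?_
    fin_cases i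
    · exact contDiff_fst
    · exact contDiff_snd

theorem hasDerivAt_eval_comp (F : MvPolynomial (Fin 2) ℝ) {φ : ℝ → ℝ} {x φ' : ℝ}
    (h : HasDerivAt φ φ' x) :
    HasDerivAt (fun x => eval ![x, φ x] F)
      (eval ![x, φ x] (pderiv 0 F) + eval ![x, φ x] (pderiv 1 F) * φ') x := by
  have := (hasFDerivAt_eval F (x, φ x)).comp_hasDerivAt x ((hasDerivAt_id x).prodMk h)
  simpa using! this

theorem exists_local_branch {F : MvPolynomial (Fin 2) ℝ} {v : ℝ × ℝ}
    (h0 : eval ![v.1, v.2] F = 0) (hY : eval ![v.1, v.2] (pderiv 1 F) ≠ 0) :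
    ∃ ψ : ℝ → ℝ, ψ v.1 = v.2 ∧ (∀ᶠ x in 𝓝 v.1, ContinuousAt ψ x) ∧
      HasDerivAt ψ (-eval ![v.1, v.2] (pderiv 0 F) / eval ![v.1, v.2] (pderiv 1 F)) v.1 ∧
      ∀ᶠ w in 𝓝 v, (eval ![w.1, w.2] F = 0 ↔ ψ w.1 = w.2) := by
  have cdf := (contDiff_eval F (n := 1)).contDiffAt (x := v)
  have hinv : (fderiv ℝ (fun v : ℝ × ℝ => eval ![v.1, v.2] F) v ∘L
      .inr ℝ ℝ ℝ).IsInvertible := by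
    refine ⟨ContinuousLinearEquiv.unitsEquivAut ℝ (Units.mk0 _ hY), ?_⟩
    rw [(hasFDerivAt_eval F v).fderiv]
    ext
    simp
  have hψ0 := cdf.implicitFunction_apply_self one_ne_zero hinv
  have hψC := cdf.contDiffAt_implicitFunction one_ne_zero hinv
  have hψF := cdf.eventually_apply_implicitFunction one_ne_zero hinv
  have hψ := cdf.eventually_apply_eq_iff_implicitFunction one_ne_zero hinv
  set ψ := cdf.implicitFunction one_ne_zero hinv
  refine ⟨ψ, hψ0, ?_, ?_, by simpa only [h0] using hψ⟩
  · filter_upwards [hψC.eventually (by simp)] with x hx using hx.continuousAt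
  · have hd := (hψC.differentiableAt one_ne_zero).hasDerivAt
    have h1 := hasDerivAt_eval_comp F hd
    rw [hψ0] at h1
    have h2 : HasDerivAt (fun x => eval ![x, ψ x] F) 0 v.1 :=
      (hasDerivAt_const v.1 (eval ![v.1, v.2] F)).congr_of_eventuallyEq hψF
    have h3 := h1.unique h2
    refine hd.congr_deriv ?_
    rw [eq_div_iff hY]
    linarith

theorem hasDerivAt_of_eval_eq_zero {F : MvPolynomial (Fin 2) ℝ} {φ : ℝ → ℝ} {x : ℝ}
    (hφ : ContinuousAt φ x) (h0 : ∀ᶠ x in 𝓝 x, eval ![x, φ x] F = 0)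
    (hY : eval ![x, φ x] (pderiv 1 F) ≠ 0) :
    HasDerivAt φ (-eval ![x, φ x] (pderiv 0 F) / eval ![x, φ x] (pderiv 1 F)) x := by
  obtain ⟨ψ, -, -, h1, h2⟩ := exists_local_branch (v := (x, φ x)) h0.self_of_nhds hY
  refine h1.congr_of_eventuallyEq ?_
  have := (continuousAt_id.prodMk hφ).eventually h2
  filter_upwards [this, h0] with t ht ht0 using (ht.mp ht0).symm

end Branch

section DerivativeNumerators

variable {σ R : Type*} [CommRing R]

/-- The numerators of the derivatives of the function `y` on the hypersurface `f = 0`. -/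
noncomputable def derivNum (y : σ) (a : σ → R) (f : MvPolynomial σ R) : ℕ → MvPolynomial σ R
  | 0 => X y
  | k + 1 => pderiv y f * tangent y a f (derivNum y a f k)
      - ((2 * k : ℕ) : MvPolynomial σ R) * (derivNum y a f k * tangent y a f (pderiv y f))

theorem map_derivNum {τ R' : Type*} [CommRing R'] (ρ : MvPolynomial σ R →+* MvPolynomial τ R')
    {y : σ} {a : σ → R} {y' : τ} {a' : τ → R'}
    (hy : ∀ G, ρ (pderiv y G) = pderiv y' (ρ G))
    (ha : ∀ G, ρ (dirDeriv a G) = dirDeriv a' (ρ G)) (hX : ρ (X y) = X y') (f : MvPolynomial σ R)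
    (k : ℕ) : ρ (derivNum y a f k) = derivNum y' a' (ρ f) k := by
  induction k with
  | zero => exact hX
  | succ k ih =>
    simp only [derivNum, map_sub, map_mul, map_natCast, map_tangent ρ hy ha, ih, hy]

theorem totalDegree_derivNum_le [Fintype σ] (y : σ) (a : σ → R) (f : MvPolynomial σ R) (k : ℕ) :
    (derivNum y a f k).totalDegree ≤ 1 + k * (2 * f.totalDegree) := by
  rw [← mem_degFilt]
  induction k with
  | zero =>
    rw [mem_degFilt, derivNum]
    cases subsingleton_or_nontrivial R
    · rw [Subsingleton.elim (X y : MvPolynomial σ R) 0, totalDegree_zero]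
      exact Nat.zero_le _
    · simp
  | succ k ih =>
    have hP := isFiltration_degFilt (σ := σ) (R := R)
    have hfy : pderiv y f ∈ degFilt σ R f.totalDegree :=
      mem_degFilt.mpr (totalDegree_pderiv_le y f)
    have h1 := hP.mul hfy (tangent_mem_degFilt y a f _ _ ih)
    have h2 := hP.mul ih (tangent_mem_degFilt y a f _ _ hfy)
    have h3 : ((2 * k : ℕ) : MvPolynomial σ R) ∈ degFilt σ R 0 := by
      rw [mem_degFilt, ← map_natCast (C : R →+* MvPolynomial σ R), totalDegree_C]
    refine AddSubgroup.sub_mem _ (hP.mono ?_ h1) (hP.mono ?_ (hP.mul h3 h2))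
    · linarith
    · linarith

end DerivativeNumerators

section Arc

/-- The graph of `φ` over the interval `(α, β)` consists of points of the curve `F = 0` where
`∂F/∂y` does not vanish. -/
structure IsArc (F : MvPolynomial (Fin 2) ℝ) (α β : ℝ) (φ : ℝ → ℝ) : Prop where
  continuousOn : ContinuousOn φ (Set.Ioo α β)
  eval_eq_zero : ∀ x ∈ Set.Ioo α β, eval ![x, φ x] F = 0
  eval_pderiv_ne_zero : ∀ x ∈ Set.Ioo α β, eval ![x, φ x] (pderiv 1 F) ≠ 0

variable {F : MvPolynomial (Fin 2) ℝ} {α β : ℝ} {φ : ℝ → ℝ}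

theorem IsArc.hasDerivAt (h : IsArc F α β φ) {x : ℝ} (hx : x ∈ Set.Ioo α β) :
    HasDerivAt φ (-eval ![x, φ x] (pderiv 0 F) / eval ![x, φ x] (pderiv 1 F)) x :=
  hasDerivAt_of_eval_eq_zero (h.continuousOn.continuousAt (Ioo_mem_nhds hx.1 hx.2))
    (by filter_upwards [Ioo_mem_nhds hx.1 hx.2] with t ht using h.eval_eq_zero t ht)
    (h.eval_pderiv_ne_zero x hx)

theorem IsArc.hasDerivAt_eval (h : IsArc F α β φ) (G : MvPolynomial (Fin 2) ℝ) {x : ℝ}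
    (hx : x ∈ Set.Ioo α β) :
    HasDerivAt (fun x => eval ![x, φ x] G)
      (eval ![x, φ x] (tangent 1 ![1, 0] F G) / eval ![x, φ x] (pderiv 1 F)) x := by
  refine (hasDerivAt_eval_comp G (h.hasDerivAt hx)).congr_deriv ?_
  have := h.eval_pderiv_ne_zero x hx
  rw [tangent_apply, dirDeriv_fin_two, map_sub, map_mul, map_mul]
  field_simp
  ring

/-- The derivatives of the function whose graph is an arc of the curve `F = 0`. -/
noncomputable def arcDeriv (F : MvPolynomial (Fin 2) ℝ) (φ : ℝ → ℝ) (k : ℕ) (x : ℝ) : ℝ :=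
  eval ![x, φ x] (derivNum 1 ![1, 0] F k) / eval ![x, φ x] (pderiv 1 F) ^ (2 * k)

theorem arcDeriv_zero (F : MvPolynomial (Fin 2) ℝ) (φ : ℝ → ℝ) (x : ℝ) :
    arcDeriv F φ 0 x = φ x := by
  simp [arcDeriv, derivNum]

theorem IsArc.hasDerivAt_arcDeriv (h : IsArc F α β φ) (k : ℕ) {x : ℝ}
    (hx : x ∈ Set.Ioo α β) : HasDerivAt (arcDeriv F φ k) (arcDeriv F φ (k + 1) x) x := by
  have hne := h.eval_pderiv_ne_zero x hx
  refine ((h.hasDerivAt_eval _ hx).div ((h.hasDerivAt_eval (pderiv 1 F) hx).pow (2 * k))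
    (pow_ne_zero _ hne)).congr_deriv ?_
  simp only [arcDeriv, derivNum, map_sub, map_mul, map_natCast, Pi.pow_apply]
  set u := eval ![x, φ x] (pderiv 1 F)
  rcases k with - | k
  · simp
    field_simp
  · rw [show 2 * (k + 1) - 1 = 2 * k + 1 by omega]
    push_cast
    field_simp
    ring

theorem IsArc.arcDeriv_nonneg_or_nonpos (h : IsArc F α β φ) {k : ℕ}
    (hk : (∀ x ∈ Set.Ioo α β, eval ![x, φ x] (derivNum 1 ![1, 0] F k) ≠ 0) ∨
      ∀ x ∈ Set.Ioo α β, eval ![x, φ x] (derivNum 1 ![1, 0] F k) = 0) :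
    (∀ x ∈ Set.Ioo α β, 0 ≤ arcDeriv F φ k x) ∨ ∀ x ∈ Set.Ioo α β, arcDeriv F φ k x ≤ 0 := by
  rcases hk with hk | hk
  · have hne : ∀ x ∈ Set.Ioo α β, arcDeriv F φ k x ≠ 0 := fun x hx =>
      div_ne_zero (hk x hx) (pow_ne_zero _ (h.eval_pderiv_ne_zero x hx))
    have hcont : ContinuousOn (arcDeriv F φ k) (Set.Ioo α β) := fun x hx =>
      (h.hasDerivAt_arcDeriv k hx).continuousAt.continuousWithinAt
    by_contra! hcon
    obtain ⟨⟨x, hx, hx0⟩, y, hy, hy0⟩ := hcon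
    obtain ⟨z, hz, hz0⟩ := isPreconnected_Ioo.intermediate_value hx hy hcont
      (Set.mem_Icc.mpr ⟨hx0.le, hy0.le⟩)
    exact hne z hz hz0
  · left
    intro x hx
    rw [arcDeriv, hk x hx, zero_div]

end Arc

section DerivativeBound

variable {α β R : ℝ} {d : ℕ → ℝ → ℝ} {s : ℕ}

theorem abs_divDiff_equispaced_le {x h : ℝ} (hh : 0 < h) {u : ℕ → ℝ} {k : ℕ} {i : ℕ}
    (hu : ∀ j ≤ k, |u (i + j)| ≤ R) :
    (k.factorial : ℝ) * |divDiff (fun j => x + j * h) u k i| ≤ R * (2 / h) ^ k := by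
  induction k generalizing i with
  | zero => simpa [divDiff] using hu 0 le_rfl
  | succ k ih =>
    have h1 := ih (i := i) fun j hj => hu j (by omega)
    have h2 := ih (i := i + 1) fun j hj => by
      rw [add_assoc, add_comm 1]
      exact hu (j + 1) (by omega)
    have hden : x + ((i + k + 1 : ℕ) : ℝ) * h - (x + i * h) = (k + 1) * h := by
      push_cast; ring
    rw [divDiff, hden, abs_div, abs_of_pos (by positivity : (0 : ℝ) < (k + 1) * h),
      Nat.factorial_succ]
    have h3 := abs_sub (divDiff (fun j => x + j * h) u k (i + 1))
      (divDiff (fun j => x + j * h) u k i)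
    have h4 : (k.factorial : ℝ) * |divDiff (fun j => x + j * h) u k (i + 1)
        - divDiff (fun j => x + j * h) u k i| ≤ 2 * (R * (2 / h) ^ k) := by
      have := mul_le_mul_of_nonneg_left h3 (Nat.cast_nonneg (α := ℝ) k.factorial)
      rw [mul_add] at this
      linarith
    generalize |divDiff (fun j => x + j * h) u k (i + 1)
      - divDiff (fun j => x + j * h) u k i| = z at h4 ⊢
    push_cast
    rw [pow_succ]
    calc _ = (k.factorial : ℝ) * z / h := by field_simp
      _ ≤ 2 * (R * (2 / h) ^ k) / h := by gcongr
      _ = _ := by ring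

theorem exists_abs_le_of_chain (hd : ∀ i < s, ∀ x ∈ Set.Ioo α β, HasDerivAt (d i) (d (i + 1) x) x)
    (hR : ∀ x ∈ Set.Ioo α β, |d 0 x| ≤ R) {k : ℕ} (hk : k ≤ s) {x h : ℝ} (hh : 0 < h)
    (hx : x ∈ Set.Ioo α β) (hx' : x + k * h ∈ Set.Ioo α β) :
    ∃ z ∈ Set.Icc x (x + k * h), |d k z| ≤ R * (2 / h) ^ k := by
  have ht : StrictMono fun j : ℕ => x + j * h := fun i j hij => by
    have : (i : ℝ) < j := by exact_mod_cast hij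
    simp only
    gcongr
  obtain ⟨z, hz, hz'⟩ := exists_divDiff_eq (I := Set.Ioo α β) Set.ordConnected_Ioo
    (fun i hi => hd i (hi.trans_le hk)) ht (i := 0) (by simpa using hx) (by simpa using hx')
  refine ⟨z, by simpa using hz, ?_⟩
  rw [hz', abs_mul, Nat.abs_cast]
  refine abs_divDiff_equispaced_le hh fun j hj => hR _ ?_
  have hj' : (j : ℝ) ≤ k := by exact_mod_cast hj
  have : (j : ℝ) * h ≤ k * h := by gcongr
  have : 0 ≤ (j : ℝ) * h := by positivity
  simp only [zero_add]
  exact ⟨by linarith [hx.1], by linarith [hx'.2]⟩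

/-- Bounds for the derivatives of a function all of whose derivatives have constant sign. -/
theorem abs_chain_le (hd : ∀ i < s, ∀ x ∈ Set.Ioo α β, HasDerivAt (d i) (d (i + 1) x) x)
    (hR : ∀ x ∈ Set.Ioo α β, |d 0 x| ≤ R)
    (hsign : ∀ k, 1 ≤ k → k ≤ s →
      (∀ x ∈ Set.Ioo α β, 0 ≤ d k x) ∨ ∀ x ∈ Set.Ioo α β, d k x ≤ 0)
    {k : ℕ} (hk : k < s) {L x : ℝ} (hL : 0 < L) (hx : α + L ≤ x) (hx' : x ≤ β - L) :
    |d k x| ≤ k.factorial * (R * (8 / L) ^ k) := by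
  have hxI : x ∈ Set.Ioo α β := ⟨by linarith, by linarith⟩
  rcases Nat.eq_zero_or_pos k with rfl | hk0
  · simpa using hR x hxI
  have hR0 : 0 ≤ R := (abs_nonneg _).trans (hR x hxI)
  set h := L / (k + 1) with hh
  have hh0 : 0 < h := by positivity
  have hkh : k * h < L := by
    have : (k + 1) * h = L := by rw [hh]; field_simp
    linarith
  have hkh0 : 0 ≤ k * h := by positivity
  have hfin : R * (2 / h) ^ k ≤ k.factorial * (R * (8 / L) ^ k) := by
    have h1 : (k + 1) ^ k ≤ k.factorial * 4 ^ k := by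
      refine (Nat.pow_succ_le_ascFactorial (k + 1) k).trans ?_
      rw [Nat.ascFactorial_eq_factorial_mul_choose]
      refine Nat.mul_le_mul_left _ ((Nat.choose_le_two_pow _ _).trans (le_of_eq ?_))
      rw [show (4 : ℕ) = 2 ^ 2 by norm_num, ← pow_mul]
      congr 1
      omega
    have h2 : ((k : ℝ) + 1) ^ k ≤ k.factorial * 4 ^ k := by exact_mod_cast h1
    have h3 : (2 / h) ^ k = (2 / L) ^ k * (k + 1) ^ k := by
      rw [← mul_pow, hh]; congr 1; field_simp
    have h4 : (8 / L) ^ k = (2 / L) ^ k * 4 ^ k := by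
      rw [← mul_pow]; congr 1; ring
    rw [h3, h4]
    calc R * ((2 / L) ^ k * (k + 1) ^ k) ≤ R * ((2 / L) ^ k * (k.factorial * 4 ^ k)) := by gcongr
      _ = _ := by ring
  obtain ⟨ζ, hζ, hζ'⟩ : ∃ ζ : ℝ, (ζ = 1 ∨ ζ = -1) ∧ ∀ y ∈ Set.Ioo α β, |d k y| = ζ * d k y := by
    rcases hsign k hk0 hk.le with hs | hs
    · exact ⟨1, Or.inl rfl, fun y hy => by rw [abs_of_nonneg (hs y hy), one_mul]⟩
    · exact ⟨-1, Or.inr rfl, fun y hy => by rw [abs_of_nonpos (hs y hy), neg_one_mul]⟩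
  have hder : ∀ y ∈ Set.Ioo α β, HasDerivAt (fun y => ζ * d k y) (ζ * d (k + 1) y) y :=
    fun y hy => (hd k hk y hy).const_mul ζ
  have hcont : ContinuousOn (fun y => ζ * d k y) (Set.Ioo α β) := fun y hy =>
    (hder y hy).continuousAt.continuousWithinAt
  have hmono : MonotoneOn (fun y => ζ * d k y) (Set.Ioo α β) ∨
      AntitoneOn (fun y => ζ * d k y) (Set.Ioo α β) := by
    have hcase : (∀ y ∈ Set.Ioo α β, 0 ≤ ζ * d (k + 1) y) ∨
        ∀ y ∈ Set.Ioo α β, ζ * d (k + 1) y ≤ 0 := by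
      rcases hsign (k + 1) (by omega) (by omega) with hs | hs <;> rcases hζ with rfl | rfl
      · exact Or.inl fun y hy => by linarith [hs y hy]
      · exact Or.inr fun y hy => by linarith [hs y hy]
      · exact Or.inr fun y hy => by linarith [hs y hy]
      · exact Or.inl fun y hy => by linarith [hs y hy]
    rcases hcase with hs | hs
    · left
      refine monotoneOn_of_deriv_nonneg (convex_Ioo α β) hcont (fun y hy => ?_) fun y hy => ?_
      · rw [interior_Ioo] at hy
        exact (hder y hy).differentiableAt.differentiableWithinAt
      · rw [interior_Ioo] at hy
        rw [(hder y hy).deriv]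
        exact hs y hy
    · right
      refine antitoneOn_of_deriv_nonpos (convex_Ioo α β) hcont (fun y hy => ?_) fun y hy => ?_
      · rw [interior_Ioo] at hy
        exact (hder y hy).differentiableAt.differentiableWithinAt
      · rw [interior_Ioo] at hy
        rw [(hder y hy).deriv]
        exact hs y hy
  rcases hmono with hm | hm
  · obtain ⟨z, hz, hz'⟩ := exists_abs_le_of_chain hd hR hk.le hh0 hxI
      ⟨by linarith, by linarith⟩
    have hzI : z ∈ Set.Ioo α β := ⟨by linarith [hz.1], by linarith [hz.2]⟩
    refine le_trans ?_ (hz'.trans hfin)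
    rw [hζ' x hxI, hζ' z hzI]
    exact hm hxI hzI hz.1
  · obtain ⟨z, hz, hz'⟩ := exists_abs_le_of_chain hd hR hk.le hh0
      (x := x - k * h) ⟨by linarith, by linarith⟩ (by rwa [sub_add_cancel])
    rw [sub_add_cancel] at hz
    have hzI : z ∈ Set.Ioo α β := ⟨by linarith [hz.1], by linarith [hz.2]⟩
    refine le_trans ?_ (hz'.trans hfin)
    rw [hζ' x hxI, hζ' z hzI]
    exact hm hzI hxI hz.2

end DerivativeBound

end BombieriPila

namespace BombieriPila

open MvPolynomial Finset

/-! ### Counting integer points on an arc -/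

section Spread

theorem exists_strictMono_nodes (U : Finset ℤ) :
    ∃ t : ℕ → ℝ, StrictMono t ∧ ∀ j < U.card, ∃ x ∈ U, t j = x := by
  obtain ⟨b, hb⟩ := U.bddAbove
  refine ⟨fun j => if h : j < U.card then ((U.orderEmbOfFin rfl ⟨j, h⟩ : ℤ) : ℝ)
    else (b : ℝ) + 1 + j, fun i j hij => ?_, fun j hj => ?_⟩
  · simp only
    by_cases hj : j < U.card
    · rw [dif_pos hj, dif_pos (hij.trans hj)]
      exact_mod_cast (U.orderEmbOfFin rfl).strictMono (by exact hij)
    · rw [dif_neg hj]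
      have hij' : (i : ℝ) < j := by exact_mod_cast hij
      by_cases hi : i < U.card
      · rw [dif_pos hi]
        have h1 : ((U.orderEmbOfFin rfl ⟨i, hi⟩ : ℤ) : ℝ) ≤ b := by
          exact_mod_cast hb (U.orderEmbOfFin_mem rfl ⟨i, hi⟩)
        have : (0 : ℝ) ≤ j := Nat.cast_nonneg _
        linarith
      · rw [dif_neg hi]
        linarith
  · exact ⟨_, U.orderEmbOfFin_mem rfl ⟨j, hj⟩, by simp [hj]⟩

variable {α β R : ℝ} {φ : ℝ → ℝ} {d : ℕ → ℝ → ℝ} {s : ℕ}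

theorem abs_divDiff_id_le {t : ℕ → ℝ} (ht : StrictMono t) {B : ℝ} (hB : 0 ≤ B) (hRB : 1 ≤ R * B)
    (htR : ∀ j < s, |t j| ≤ R) (k i : ℕ) (hik : i + k < s) : |divDiff t t k i| ≤ R * B ^ k := by
  have h1 : ∀ i, divDiff t t 1 i = 1 := fun i => by
    have := ht (Nat.lt_succ_self i)
    simp only [divDiff, add_zero]
    exact div_self (by simp only [Nat.succ_eq_add_one] at this; linarith)
  have h2 : ∀ k i, divDiff t t (k + 2) i = 0 := by
    intro k
    induction k with
    | zero => intro i; rw [divDiff, h1, h1]; simp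
    | succ k ih => intro i; rw [divDiff, ih, ih]; simp
  have hR : 0 ≤ R := (abs_nonneg _).trans (htR i (by omega))
  match k with
  | 0 => simpa [divDiff] using htR i (by omega)
  | 1 => rw [h1]; simpa using hRB
  | k + 2 => rw [h2, abs_zero]; positivity

/-- The divided differences of a function all of whose derivatives have constant sign. -/
theorem abs_divDiff_chain_le
    (hd : ∀ i < s, ∀ x ∈ Set.Ioo α β, HasDerivAt (d i) (d (i + 1) x) x)
    (hR : ∀ x ∈ Set.Ioo α β, |d 0 x| ≤ R)
    (hsign : ∀ k, 1 ≤ k → k ≤ s →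
      (∀ x ∈ Set.Ioo α β, 0 ≤ d k x) ∨ ∀ x ∈ Set.Ioo α β, d k x ≤ 0)
    {L : ℝ} (hL : 0 < L) {t : ℕ → ℝ} (ht : StrictMono t)
    (htL : ∀ j < s, α + L ≤ t j ∧ t j ≤ β - L) (k i : ℕ) (hik : i + k < s) :
    |divDiff t (fun j => d 0 (t j)) k i| ≤ R * (8 / L) ^ k := by
  have hmem : ∀ j < s, t j ∈ Set.Ioo α β := fun j hj =>
    ⟨by linarith [(htL j hj).1], by linarith [(htL j hj).2]⟩
  obtain ⟨z, hz, hz'⟩ := exists_divDiff_eq Set.ordConnected_Ioo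
    (fun i hi => hd i (by omega)) ht (hmem i (by omega)) (hmem (i + k) hik)
  have h1 := abs_chain_le hd hR hsign (k := k) (by omega) hL
    ((htL i (by omega)).1.trans hz.1) (hz.2.trans (htL _ hik).2)
  rw [hz', abs_mul, Nat.abs_cast] at h1
  exact le_of_mul_le_mul_left h1 (by positivity)

theorem sum_range_sub_one_sub (s : ℕ) : ∑ q ∈ range s, (s - 1 - q) = s * (s - 1) / 2 := by
  rw [sum_range_reflect (fun q => q) s, sum_range_id]

theorem abs_det_monomial_le {R B Λ : ℝ} {s D : ℕ} (hR : 1 ≤ R) (hB : 0 ≤ B) (hRB : 1 ≤ R * B)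
    {t u : ℕ → ℝ} (ht : StrictMono t) (htR : ∀ j < s, |t j| ≤ R)
    (hu : ∀ k i, i + k < s → |divDiff t u k i| ≤ R * B ^ k)
    {e : ℕ → Fin 2 →₀ ℕ} (heD : ∀ j < s, (e j).degree ≤ D) (hD : D < s) (hs : 2 ≤ s)
    (hΛ : R ^ (∑ j ∈ range s, (e j).degree) ≤ Λ ^ (s * (s - 1) / 2))
    {η : ℝ} (hη0 : 0 ≤ η) (hη : ∀ i < s, ∀ j < s, t i - t j ≤ η) :
    |(Matrix.of fun r m : Fin s => t r ^ e m 0 * u r ^ e m 1).det|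
      ≤ (η * B * s ^ 4 * Λ) ^ (s * (s - 1) / 2) := by
  have hs0 : (1 : ℝ) ≤ s := by exact_mod_cast (by omega : 1 ≤ s)
  have hdeg : ∀ u : Fin 2 →₀ ℕ, u 0 + u 1 = u.degree := fun u => by
    rw [Finsupp.degree_eq_sum, Fin.sum_univ_two]
  have hone : ∀ k i, i + k < s →
      |divDiff t (fun _ => (1 : ℝ)) k i| ≤ 1 * ((k : ℝ) + 1) ^ 0 * B ^ k := by
    have : ∀ k i, divDiff t (fun _ => (1 : ℝ)) (k + 1) i = 0 := by
      intro k
      induction k with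
      | zero => intro i; simp [divDiff]
      | succ k ih => intro i; rw [divDiff, ih, ih]; simp
    rintro (- | k) i -
    · simp [divDiff]
    · rw [this, abs_zero]; positivity
  have hpow : ∀ a b k i, i + k < s → |divDiff t (fun j => t j ^ a * u j ^ b) k i|
      ≤ R ^ (a + b) * (k + 1) ^ (a + b) * B ^ k := by
    intro a b k i hik
    have h1 := abs_divDiff_pow_le ht (zero_le_one.trans hR) hB
      (abs_divDiff_id_le ht hB hRB htR) zero_le_one hone a
    simp only [one_mul, zero_add] at h1
    have h2 := abs_divDiff_pow_le ht (zero_le_one.trans hR) hB hu (by positivity) h1 b k i hik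
    rwa [← pow_add] at h2
  have hentry : ∀ r m : Fin s, |divDiff t (fun j => t j ^ e m 0 * u j ^ e m 1) r 0|
      ≤ B ^ (r : ℕ) * (R ^ (e m).degree * (s : ℝ) ^ D) := by
    intro r m
    refine (hpow _ _ r 0 (by have := r.2; omega)).trans ?_
    rw [hdeg]
    have h1 : ((r : ℕ) : ℝ) + 1 ≤ s := by exact_mod_cast r.2
    have h2 : (((r : ℕ) : ℝ) + 1) ^ (e m).degree ≤ (s : ℝ) ^ D :=
      (pow_le_pow_left₀ (by positivity) h1 _).trans (pow_le_pow_right₀ hs0 (heD m m.2))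
    calc _ ≤ R ^ (e m).degree * (s : ℝ) ^ D * B ^ (r : ℕ) := by gcongr
      _ = _ := by ring
  have h1 := abs_det_le_mul_abs_det_divDiff ht hη0 hη fun m r => t r ^ e m 0 * u r ^ e m 1
  have h2 := abs_det_le (M := Matrix.of fun r m : Fin s =>
    divDiff t (fun j => t j ^ e m 0 * u j ^ e m 1) r 0) hentry
  refine h1.trans ((mul_le_mul_of_nonneg_left h2 (by positivity)).trans ?_)
  rw [sum_range_sub_one_sub, prod_pow_eq_pow_sum, Fin.sum_univ_eq_sum_range (fun i => i) s,
    sum_range_id, prod_mul_distrib, prod_pow_eq_pow_sum,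
    Fin.sum_univ_eq_sum_range (fun i => (e i).degree) s, prod_const, card_univ, Fintype.card_fin,
    mul_pow, mul_pow, mul_pow, ← pow_mul, ← pow_mul]
  have h3 : (s.factorial : ℝ) * (s : ℝ) ^ (D * s) ≤ (s : ℝ) ^ (4 * (s * (s - 1) / 2)) := by
    have h4 : (s.factorial : ℝ) ≤ (s : ℝ) ^ s := by exact_mod_cast Nat.factorial_le_pow s
    calc _ ≤ (s : ℝ) ^ s * (s : ℝ) ^ (D * s) := by gcongr
      _ = (s : ℝ) ^ ((D + 1) * s) := by rw [← pow_add]; ring_nf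
      _ ≤ _ := by
        refine pow_le_pow_right₀ hs0 ?_
        have h5 : 2 * (s * (s - 1) / 2) = s * (s - 1) :=
          Nat.two_mul_div_two_of_even (Nat.even_mul_pred_self s)
        have h6 : (D + 1) * s ≤ 2 * (s - 1) * s := Nat.mul_le_mul_right _ (by omega)
        calc (D + 1) * s ≤ 2 * (s - 1) * s := h6
          _ = 2 * (s * (s - 1)) := by ring
          _ = 2 * (2 * (s * (s - 1) / 2)) := by rw [h5]
          _ ≤ _ := by omega
  calc _ = η ^ (s * (s - 1) / 2) * B ^ (s * (s - 1) / 2) *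
        (s.factorial * (s : ℝ) ^ (D * s)) * R ^ ∑ j ∈ range s, (e j).degree := by ring
    _ ≤ η ^ (s * (s - 1) / 2) * B ^ (s * (s - 1) / 2) *
        (s : ℝ) ^ (4 * (s * (s - 1) / 2)) * Λ ^ (s * (s - 1) / 2) := by gcongr
    _ = _ := by ring

end Spread

section Growth

/-- A finite set of integers whose points are spread out away from `α` has few points. -/
theorem card_le_of_spread {α R M : ℝ} {s : ℕ} (hM : 1 ≤ M) (hR : 1 ≤ R) {T : Finset ℤ}
    (hT : ∀ x ∈ T, α < x ∧ (x : ℝ) ≤ α + R)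
    (hU : ∀ U ⊆ T, U.card = s → ∀ L : ℝ, 0 < L → (∀ x ∈ U, α + L ≤ x) →
      ∃ x ∈ U, ∃ y ∈ U, L ≤ M * ((x : ℝ) - y)) :
    (T.card : ℝ) ≤ 1 + s * (1 + 2 * M * Real.log R) := by
  rcases T.eq_empty_or_nonempty with rfl | hne
  · have := Real.log_nonneg hR
    simp only [card_empty, Nat.cast_zero]
    positivity
  set x₀ := T.min' hne
  have hx₀ : x₀ ∈ T := T.min'_mem hne
  set ε := 1 / M with hε
  have hM0 : 0 < M := by linarith
  have hε0 : 0 < ε := by positivity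
  have hε1 : ε ≤ 1 := by rw [hε, div_le_one hM0]; exact hM
  have hlog : ε / 2 ≤ Real.log (1 + ε) := by
    refine le_trans ?_ (Real.one_sub_inv_le_log_of_pos (by linarith))
    rw [show (1 : ℝ) - (1 + ε)⁻¹ = ε / (1 + ε) by field_simp; ring]
    gcongr
    linarith
  have hlog0 : 0 < Real.log (1 + ε) := by linarith
  set g : ℤ → ℕ := fun x => ⌊Real.log (x - α) / Real.log (1 + ε)⌋₊ with hg
  have hT1 : ∀ x ∈ T.erase x₀, 1 ≤ (x : ℝ) - α := fun x hx => by
    have h1 : x₀ < x := lt_of_le_of_ne (T.min'_le x (mem_of_mem_erase hx)) (ne_of_mem_erase hx).symm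
    have h2 : (x₀ : ℝ) + 1 ≤ x := by exact_mod_cast h1
    linarith [(hT x₀ hx₀).1]
  have hmaps : ∀ x ∈ T.erase x₀, g x ∈ range (⌊Real.log R / Real.log (1 + ε)⌋₊ + 1) := by
    intro x hx
    rw [mem_range, Nat.lt_succ_iff]
    refine Nat.floor_le_floor ?_
    gcongr
    · linarith [hT1 x hx]
    · linarith [(hT x (mem_of_mem_erase hx)).2]
  have hfib : ∀ j ∈ range (⌊Real.log R / Real.log (1 + ε)⌋₊ + 1),
      ((T.erase x₀).filter fun x => g x = j).card ≤ s := by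
    intro j _
    by_contra! hcard
    obtain ⟨U, hUsub, hUcard⟩ := exists_subset_card_eq hcard.le
    have hmem : ∀ x ∈ U, x ∈ T.erase x₀ ∧ g x = j := fun x hx => mem_filter.mp (hUsub hx)
    have hbd : ∀ x ∈ U, (1 + ε) ^ j ≤ x - α ∧ x - α < (1 + ε) ^ (j + 1) := by
      intro x hx
      obtain ⟨hx1, hx2⟩ := hmem x hx
      have h1 := hT1 x hx1
      have h1' : 0 < (x : ℝ) - α := by linarith
      rw [hg] at hx2
      rw [Nat.floor_eq_iff (div_nonneg (Real.log_nonneg h1) hlog0.le), le_div_iff₀ hlog0,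
        div_lt_iff₀ hlog0] at hx2
      constructor
      · rw [← Real.log_le_log_iff (by positivity) h1', Real.log_pow]
        exact hx2.1
      · rw [← Real.log_lt_log_iff h1' (by positivity), Real.log_pow]
        push_cast
        exact hx2.2
    obtain ⟨x, hx, y, hy, hxy⟩ := hU U (fun x hx => mem_of_mem_erase (hmem x hx).1) hUcard
      ((1 + ε) ^ j) (by positivity) fun x hx => by linarith [(hbd x hx).1]
    have h1 : (x : ℝ) - y < ε * (1 + ε) ^ j := by
      have := (hbd x hx).2
      have := (hbd y hy).1
      rw [pow_succ] at *
      linarith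
    have h2 : M * (ε * (1 + ε) ^ j) = (1 + ε) ^ j := by
      rw [← mul_assoc, hε, mul_one_div_cancel hM0.ne', one_mul]
    have h3 := mul_lt_mul_of_pos_left h1 hM0
    linarith
  have hcard := card_le_mul_card_image_of_maps_to hmaps s hfib
  rw [card_range] at hcard
  have hcard' : T.card ≤ 1 + s * (⌊Real.log R / Real.log (1 + ε)⌋₊ + 1) := by
    have := card_erase_add_one hx₀
    omega
  have hfl : (⌊Real.log R / Real.log (1 + ε)⌋₊ : ℝ) ≤ 2 * M * Real.log R := by
    refine (Nat.floor_le (div_nonneg (Real.log_nonneg hR) hlog0.le)).trans ?_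
    rw [div_le_iff₀ hlog0]
    have h1 := mul_le_mul_of_nonneg_left hlog (mul_nonneg hM0.le (Real.log_nonneg hR))
    have h2 : M * Real.log R * (ε / 2) = Real.log R / 2 := by
      rw [hε]; field_simp
    nlinarith
  calc (T.card : ℝ) ≤ ((1 + s * (⌊Real.log R / Real.log (1 + ε)⌋₊ + 1) : ℕ) : ℝ) := by
        exact_mod_cast hcard'
    _ = 1 + s * (1 + (⌊Real.log R / Real.log (1 + ε)⌋₊ : ℝ)) := by push_cast; ring
    _ ≤ _ := by gcongr

theorem card_le_of_spread_Ioo {α β R M : ℝ} {s : ℕ} (hM : 1 ≤ M) (hR : 1 ≤ R)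
    (hαβ : β - α ≤ 2 * R) {T : Finset ℤ}
    (hT : ∀ x ∈ T, (x : ℝ) ∈ Set.Ioo α β)
    (hU : ∀ U ⊆ T, U.card = s → ∀ L : ℝ, 0 < L → (∀ x ∈ U, α + L ≤ x ∧ (x : ℝ) ≤ β - L) →
      ∃ x ∈ U, ∃ y ∈ U, L ≤ M * ((x : ℝ) - y)) :
    (T.card : ℝ) ≤ 2 * (1 + s * (1 + 2 * M * Real.log R)) := by
  set p : ℤ → Prop := fun x => (x : ℝ) ≤ (α + β) / 2 with hp
  have h1 : ((T.filter p).card : ℝ) ≤ 1 + s * (1 + 2 * M * Real.log R) := by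
    refine card_le_of_spread (α := α) hM hR (fun x hx => ?_) fun U hUT hUs L hL hUL => ?_
    · rw [mem_filter] at hx
      exact ⟨(hT x hx.1).1, by linarith [hx.2]⟩
    · refine hU U (hUT.trans (filter_subset _ _)) hUs L hL fun x hx => ⟨hUL x hx, ?_⟩
      have := (mem_filter.mp (hUT hx)).2
      linarith [hUL x hx]
  have h2 : ((T.filter fun x => ¬ p x).card : ℝ) ≤ 1 + s * (1 + 2 * M * Real.log R) := by
    have hinj : Function.Injective fun x : ℤ => -x := neg_injective
    rw [← card_image_of_injective _ hinj]
    refine card_le_of_spread (α := -β) hM hR (fun x hx => ?_) fun U hUT hUs L hL hUL => ?_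
    · obtain ⟨y, hy, rfl⟩ := mem_image.mp hx
      rw [mem_filter] at hy
      have h3 := hT y hy.1
      have h4 := hy.2
      rw [hp, not_le] at h4
      push_cast
      exact ⟨by linarith [h3.2], by linarith⟩
    · have hsub : U.image (fun x => -x) ⊆ T.filter fun x => ¬ p x := by
        intro x hx
        obtain ⟨y, hy, rfl⟩ := mem_image.mp hx
        obtain ⟨z, hz, rfl⟩ := mem_image.mp (hUT hy)
        simpa using hz
      obtain ⟨x, hx, y, hy, hxy⟩ := hU (U.image fun x => -x) (hsub.trans (filter_subset _ _))
        ((card_image_of_injective _ hinj).trans hUs) L hL fun x hx => by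
          have h4 := (mem_filter.mp (hsub hx)).2
          obtain ⟨y, hy, rfl⟩ := mem_image.mp hx
          have h3 := hUL y hy
          rw [hp, not_le] at h4
          push_cast at h4 ⊢
          exact ⟨by linarith, by linarith⟩
      obtain ⟨x', hx', rfl⟩ := mem_image.mp hx
      obtain ⟨y', hy', rfl⟩ := mem_image.mp hy
      refine ⟨y', hy', x', hx', ?_⟩
      push_cast at hxy
      linarith
  have := card_filter_add_card_filter_not (s := T) p
  have : (T.card : ℝ) = (T.filter p).card + (T.filter fun x => ¬ p x).card := by
    exact_mod_cast this.symm
  linarith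

end Growth

section ArcCount

variable {F : MvPolynomial (Fin 2) ℝ} {α β R Λ : ℝ} {φ : ℝ → ℝ} {s D : ℕ} {e : ℕ → Fin 2 →₀ ℕ}

theorem eval_monomial_fin_two (u : Fin 2 →₀ ℕ) (x y : ℝ) :
    eval ![x, y] (monomial u 1) = x ^ u 0 * y ^ u 1 := by
  rw [eval_monomial, one_mul, Finsupp.prod_fintype _ _ (fun i => pow_zero _), Fin.prod_univ_two]
  rfl

theorem IsArc.det_ne_zero (h : IsArc F α β φ)
    (hW : ∀ k ≤ s, ∀ x ∈ Set.Ioo α β, eval ![x, φ x]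
      (wronskian (tangent 1 ![1, 0] F) (fun j => monomial (e j) 1) k) ≠ 0)
    {t : ℕ → ℝ} (ht : StrictMono t) (htI : ∀ j < s, t j ∈ Set.Ioo α β) :
    (Matrix.of fun r m : Fin s => t r ^ e m 0 * φ (t r) ^ e m 1).det ≠ 0 := by
  intro hdet
  obtain ⟨v, hv0, hv⟩ := Matrix.exists_mulVec_eq_zero_iff.mpr hdet
  set c : ℕ → ℝ := fun j => if hj : j < s then v ⟨j, hj⟩ else 0 with hc
  have hlt := card_zeros_lt (tangent 1 ![1, 0] F) (I := Set.Ioo α β) Set.ordConnected_Ioo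
    (fun x => aeval ![x, φ x]) (w := fun x => eval ![x, φ x] (pderiv 1 F))
    h.eval_pderiv_ne_zero (fun G x hx => by simpa [aeval_eq_eval] using h.hasDerivAt_eval G hx)
    (h := fun j => monomial (e j) 1) (s := s) (fun k hk x hx => by
      simpa [aeval_eq_eval] using hW k hk x hx) (c := c)
    (by
      obtain ⟨i, hi⟩ := Function.ne_iff.mp hv0
      exact ⟨i, i.2, by simpa [hc] using hi⟩)
    (T := (range s).image t)
    (fun x hx => by
      obtain ⟨j, hj, rfl⟩ := mem_image.mp hx
      exact htI j (mem_range.mp hj))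
    (fun x hx => by
      obtain ⟨j, hj, rfl⟩ := mem_image.mp hx
      have h1 := congrFun hv ⟨j, mem_range.mp hj⟩
      rw [map_sum, ← Fin.sum_univ_eq_sum_range
        (fun i => aeval ![t j, φ (t j)] (c i • (monomial (e i) (1 : ℝ)))) s]
      refine Eq.trans (sum_congr rfl fun i _ => ?_) h1
      change _ = t j ^ e i 0 * φ (t j) ^ e i 1 * v i
      rw [map_smul, aeval_eq_eval]
      rw [eval_monomial_fin_two]
      simp [hc, mul_comm])
  rw [card_image_of_injective _ ht.injective, card_range] at hlt
  exact hlt.false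

theorem IsArc.card_le (h : IsArc F α β φ) (hR : 1 ≤ R) (hα : -R ≤ α) (hβ : β ≤ R)
    (hφ : ∀ x ∈ Set.Ioo α β, |φ x| ≤ R)
    (hQ : ∀ k, 1 ≤ k → k ≤ s → (∀ x ∈ Set.Ioo α β, eval ![x, φ x] (derivNum 1 ![1, 0] F k) ≠ 0) ∨
      ∀ x ∈ Set.Ioo α β, eval ![x, φ x] (derivNum 1 ![1, 0] F k) = 0)
    (hW : ∀ k ≤ s, ∀ x ∈ Set.Ioo α β, eval ![x, φ x]
      (wronskian (tangent 1 ![1, 0] F) (fun j => monomial (e j) 1) k) ≠ 0)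
    (heD : ∀ j < s, (e j).degree ≤ D) (hD : D < s) (hs : 2 ≤ s) (hΛ1 : 1 ≤ Λ)
    (hΛ : R ^ (∑ j ∈ range s, (e j).degree) ≤ Λ ^ (s * (s - 1) / 2))
    {T : Finset ℤ} (hT : ∀ x ∈ T, (x : ℝ) ∈ Set.Ioo α β ∧ ∃ y : ℤ, φ x = y) :
    (T.card : ℝ) ≤ 2 * (1 + s * (1 + 2 * (8 * s ^ 4 * Λ) * Real.log R)) := by
  have hs0 : (1 : ℝ) ≤ s := by exact_mod_cast (by omega : 1 ≤ s)
  have hM : 1 ≤ 8 * (s : ℝ) ^ 4 * Λ := by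
    have := one_le_pow₀ hs0 (n := 4)
    nlinarith
  refine card_le_of_spread_Ioo hM hR (by linarith) (fun x hx => (hT x hx).1) ?_
  intro U hUT hUs L hL hUL
  obtain ⟨t, ht, htU⟩ := exists_strictMono_nodes U
  rw [hUs] at htU
  have htL : ∀ j < s, α + L ≤ t j ∧ t j ≤ β - L := fun j hj => by
    obtain ⟨x, hx, hxt⟩ := htU j hj
    rw [hxt]
    exact hUL x hx
  have htI : ∀ j < s, t j ∈ Set.Ioo α β := fun j hj =>
    ⟨by linarith [(htL j hj).1], by linarith [(htL j hj).2]⟩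
  have hLR : L ≤ R := by linarith [(htL 0 (by omega)).1, (htL 0 (by omega)).2]
  obtain ⟨x, hx, hxt⟩ := htU (s - 1) (by omega)
  obtain ⟨y, hy, hyt⟩ := htU 0 (by omega)
  refine ⟨x, hx, y, hy, ?_⟩
  rw [← hxt, ← hyt]
  set η := t (s - 1) - t 0 with hη
  have hη0 : 0 ≤ η := sub_nonneg.mpr (ht.monotone (Nat.zero_le _))
  have hηt : ∀ i < s, ∀ j < s, t i - t j ≤ η := fun i hi j hj => by
    have h1 := ht.monotone (show i ≤ s - 1 by omega)
    have h2 := ht.monotone (Nat.zero_le j)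
    linarith
  have hB : 0 ≤ 8 / L := by positivity
  have hRB : 1 ≤ R * (8 / L) := by
    rw [mul_div_assoc', one_le_div hL]; linarith
  have hdd : ∀ k i, i + k < s → |divDiff t (fun j => φ (t j)) k i| ≤ R * (8 / L) ^ k := by
    have := abs_divDiff_chain_le (d := arcDeriv F φ) (R := R) (s := s)
      (fun i _ x hx => h.hasDerivAt_arcDeriv i hx)
      (fun x hx => by rw [arcDeriv_zero]; exact hφ x hx)
      (fun k hk hks => h.arcDeriv_nonneg_or_nonpos (hQ k hk hks)) hL ht htL
    simpa only [arcDeriv_zero] using this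
  have hle := abs_det_monomial_le hR hB hRB ht (fun j hj => abs_le.mpr
    ⟨by linarith [(htI j hj).1], by linarith [(htI j hj).2]⟩) hdd heD hD hs hΛ hη0 hηt
  have hne := h.det_ne_zero hW ht htI
  have hint : ∃ z : ℤ, (Matrix.of fun r m : Fin s => t r ^ e m 0 * φ (t r) ^ e m 1).det = z := by
    have : ∀ j : Fin s, ∃ a b : ℤ, t j = a ∧ φ (t j) = b := fun j => by
      obtain ⟨x, hx, hxt⟩ := htU j j.2
      obtain ⟨y, hy⟩ := (hT x (hUT hx)).2
      exact ⟨x, y, hxt, by rw [hxt, hy]⟩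
    choose a b ha hb using this
    refine ⟨(Matrix.of fun r m : Fin s => a r ^ e m 0 * b r ^ e m 1).det, ?_⟩
    rw [← eq_intCast (Int.castRingHom ℝ), RingHom.map_det]
    congr 1
    ext r m
    change t r ^ e m 0 * φ (t r) ^ e m 1 = ((a r ^ e m 0 * b r ^ e m 1 : ℤ) : ℝ)
    rw [hb, ha]
    push_cast
    rfl
  obtain ⟨z, hz⟩ := hint
  have hge : 1 ≤ |(Matrix.of fun r m : Fin s => t r ^ e m 0 * φ (t r) ^ e m 1).det| := by
    rw [hz] at hne ⊢
    have : z ≠ 0 := by exact_mod_cast hne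
    exact_mod_cast Int.one_le_abs this
  have hone := hge.trans hle
  by_contra! hcon
  have hlt : η * (8 / L) * s ^ 4 * Λ < 1 := by
    rw [show η * (8 / L) * s ^ 4 * Λ = 8 * s ^ 4 * Λ * η / L by ring, div_lt_one hL]
    exact hcon
  have hexp : s * (s - 1) / 2 ≠ 0 := by
    have : 2 * 1 ≤ s * (s - 1) := Nat.mul_le_mul hs (by omega)
    omega
  exact absurd hone (not_le.mpr (pow_lt_one₀ (by positivity) hlt hexp))

end ArcCount

end BombieriPila

namespace BombieriPila

open Filter
open scoped Topology

/-! ### Continuation of branches -/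

section Continuation

/-- Near each of its points, the set `Z` is the graph of a continuous function. -/
def IsLocallyGraph (Z : Set (ℝ × ℝ)) : Prop :=
  ∀ v ∈ Z, ∃ ψ : ℝ → ℝ, ψ v.1 = v.2 ∧ (∀ᶠ x in 𝓝 v.1, ContinuousAt ψ x) ∧
    ∀ᶠ w in 𝓝 v, (w ∈ Z ↔ ψ w.1 = w.2)

/-- The graph of `φ` over `[v.1, b)` is contained in `Z` and starts at `v`. -/
structure IsBranch (Z : Set (ℝ × ℝ)) (v : ℝ × ℝ) (b : ℝ) (φ : ℝ → ℝ) : Prop where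
  lt : v.1 < b
  continuousOn : ContinuousOn φ (Set.Ico v.1 b)
  apply_fst : φ v.1 = v.2
  mem : ∀ x ∈ Set.Ico v.1 b, (x, φ x) ∈ Z

variable {Z : Set (ℝ × ℝ)} {v v' : ℝ × ℝ} {b b' : ℝ} {φ φ' : ℝ → ℝ}

theorem IsLocallyGraph.eqOn (hZ : IsLocallyGraph Z) {I : Set ℝ} (hI : IsPreconnected I)
    (hφ : ContinuousOn φ I) (hφ' : ContinuousOn φ' I) (h : ∀ x ∈ I, (x, φ x) ∈ Z)
    (h' : ∀ x ∈ I, (x, φ' x) ∈ Z) {x₀ : ℝ} (hx₀ : x₀ ∈ I) (h0 : φ x₀ = φ' x₀) :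
    Set.EqOn φ φ' I := by
  rw [isPreconnected_iff_preconnectedSpace] at hI
  have hc := continuousOn_iff_continuous_domRestrict.mp hφ
  have hc' := continuousOn_iff_continuous_domRestrict.mp hφ'
  have hclopen : IsClopen {x : I | φ x = φ' x} := by
    refine ⟨isClosed_eq hc hc', isOpen_iff_mem_nhds.mpr fun x hx => ?_⟩
    obtain ⟨ψ, -, -, hψ⟩ := hZ _ (h x x.2)
    have h1 : Tendsto (fun x' : I => ((x' : ℝ), φ x')) (𝓝 x) (𝓝 ((x : ℝ), φ x)) :=
      (continuous_subtype_val.prodMk hc).tendsto x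
    have h2 : Tendsto (fun x' : I => ((x' : ℝ), φ' x')) (𝓝 x) (𝓝 ((x : ℝ), φ x)) := by
      rw [show φ x = φ' x from hx]
      exact (continuous_subtype_val.prodMk hc').tendsto x
    filter_upwards [h1.eventually hψ, h2.eventually hψ] with x' hx1 hx2
    exact (hx1.mp (h x' x'.2)).symm.trans (hx2.mp (h' x' x'.2))
  have := hclopen.eq_univ ⟨⟨x₀, hx₀⟩, h0⟩
  intro x hx
  exact this.symm.subset (Set.mem_univ (⟨x, hx⟩ : I))

theorem IsLocallyGraph.exists_pos (hZ : IsLocallyGraph Z) (hv : v ∈ Z) :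
    ∃ ψ : ℝ → ℝ, ∃ δ > 0, ψ v.1 = v.2 ∧ ContinuousOn ψ (Set.Ioo (v.1 - δ) (v.1 + δ)) ∧
      (∀ x ∈ Set.Ioo (v.1 - δ) (v.1 + δ), (x, ψ x) ∈ Z) ∧
      ∀ᶠ w in 𝓝 v, w ∈ Z → ψ w.1 = w.2 := by
  obtain ⟨ψ, h1, h2, h3⟩ := hZ v hv
  have h4 : Tendsto (fun x => (x, ψ x)) (𝓝 v.1) (𝓝 v) := by
    have := (continuousAt_id (x := v.1)).prodMk h2.self_of_nhds
    simpa [ContinuousAt, h1] using this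
  obtain ⟨δ, hδ, hball⟩ := Metric.eventually_nhds_iff_ball.mp (h2.and (h4.eventually h3))
  rw [Real.ball_eq_Ioo] at hball
  exact ⟨ψ, δ, hδ, h1, fun x hx => (hball x hx).1.continuousWithinAt,
    fun x hx => (hball x hx).2.mpr rfl, h3.mono fun w hw => hw.mp⟩

theorem IsBranch.eqOn (hZ : IsLocallyGraph Z) (h : IsBranch Z v b φ) (h' : IsBranch Z v b' φ') :
    Set.EqOn φ φ' (Set.Ico v.1 (min b b')) := by
  have h1 : Set.Ico v.1 (min b b') ⊆ Set.Ico v.1 b := Set.Ico_subset_Ico_right (min_le_left _ _)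
  have h2 : Set.Ico v.1 (min b b') ⊆ Set.Ico v.1 b' := Set.Ico_subset_Ico_right (min_le_right _ _)
  exact hZ.eqOn isPreconnected_Ico (h.continuousOn.mono h1) (h'.continuousOn.mono h2)
    (fun x hx => h.mem x (h1 hx)) (fun x hx => h'.mem x (h2 hx))
    (Set.left_mem_Ico.mpr (lt_min h.lt h'.lt)) (h.apply_fst.trans h'.apply_fst.symm)

/-- A branch of `Z` that cannot be continued. -/
structure IsMaxBranch (Z : Set (ℝ × ℝ)) (v : ℝ × ℝ) (b : ℝ) (φ : ℝ → ℝ) : Prop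
    extends IsBranch Z v b φ where
  notMem : ∀ y, Tendsto φ (𝓝[<] b) (𝓝 y) → (b, y) ∉ Z

theorem IsBranch.exists_extension (hZ : IsLocallyGraph Z) (h : IsBranch Z v b φ) {y : ℝ}
    (hy : Tendsto φ (𝓝[<] b) (𝓝 y)) (hmem : (b, y) ∈ Z) : ∃ b' > b, ∃ φ', IsBranch Z v b' φ' := by
  obtain ⟨ψ, δ, hδ, -, h2, h3, h4⟩ := hZ.exists_pos hmem
  have h5 : ∀ᶠ x in 𝓝[<] b, ψ x = φ x := by
    have h6 : Tendsto (fun x => (x, φ x)) (𝓝[<] b) (𝓝 (b, y)) := by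
      rw [nhds_prod_eq]
      exact (tendsto_nhdsWithin_of_tendsto_nhds tendsto_id).prodMk hy
    filter_upwards [h6.eventually h4, Ico_mem_nhdsLT h.lt] with x hx hxI using hx (h.mem x hxI)
  obtain ⟨c, hc, hcb⟩ := (mem_nhdsLT_iff_exists_Ioo_subset' h.lt).mp h5
  have hcb' : ∀ x, c < x → x < b → ψ x = φ x := fun x h1 h2 => hcb ⟨h1, h2⟩
  refine ⟨b + δ, by linarith, fun x => if x < b then φ x else ψ x, by linarith [h.lt], ?_, ?_, ?_⟩
  · intro x hx
    by_cases hxb : x < b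
    · have h6 : ContinuousWithinAt φ (Set.Ico v.1 (b + δ)) x := by
        refine (h.continuousOn x ⟨hx.1, hxb⟩).mono_of_mem_nhdsWithin ?_
        filter_upwards [self_mem_nhdsWithin, mem_nhdsWithin_of_mem_nhds (Iio_mem_nhds hxb)]
          with z hz hz' using ⟨hz.1, hz'⟩
      refine h6.congr_of_eventuallyEq ?_ (if_pos hxb)
      filter_upwards [mem_nhdsWithin_of_mem_nhds (Iio_mem_nhds hxb)] with z hz using if_pos hz
    · have hxb' : b ≤ x := not_lt.mp hxb
      have h6 : ContinuousAt ψ x :=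
        h2.continuousAt (Ioo_mem_nhds (by simp only; linarith) hx.2)
      refine (h6.congr ?_).continuousWithinAt
      filter_upwards [Ioi_mem_nhds (lt_of_lt_of_le hc hxb')] with z hz
      split_ifs with hzb
      · exact hcb' z hz hzb
      · rfl
  · simp only [if_pos h.lt, h.apply_fst]
  · intro x hx
    by_cases hxb : x < b
    · simp only [if_pos hxb]
      exact h.mem x ⟨hx.1, hxb⟩
    · simp only [if_neg hxb]
      exact h3 x ⟨by linarith, hx.2⟩

theorem IsLocallyGraph.exists_isMaxBranch (hZ : IsLocallyGraph Z) {R : ℝ} (hR : ∀ w ∈ Z, w.1 < R)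
    (hv : v ∈ Z) : ∃ b φ, IsMaxBranch Z v b φ := by
  set S : Set ℝ := {b | ∃ φ, IsBranch Z v b φ} with hS
  have hne : S.Nonempty := by
    obtain ⟨ψ, δ, hδ, h1, h2, h3, -⟩ := hZ.exists_pos hv
    have hsub : Set.Ico v.1 (v.1 + δ) ⊆ Set.Ioo (v.1 - δ) (v.1 + δ) := fun x hx =>
      ⟨by linarith [hx.1], hx.2⟩
    exact ⟨v.1 + δ, ψ, by linarith, h2.mono hsub, h1, fun x hx => h3 x (hsub hx)⟩
  have hbdd : BddAbove S := by
    refine ⟨R, fun b hb => ?_⟩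
    obtain ⟨φ, hφ⟩ := hb
    by_contra! hcon
    have := hR _ (hφ.mem (max v.1 R) ⟨le_max_left _ _, max_lt hφ.lt hcon⟩)
    exact absurd this (not_lt.mpr (le_max_right _ _))
  set B := sSup S with hB
  have hlt : v.1 < B := by
    obtain ⟨b, φ, hφ⟩ := hne
    exact hφ.lt.trans_le (le_csSup hbdd ⟨φ, hφ⟩)
  have hex : ∀ x, x < B → ∃ b φ, x < b ∧ IsBranch Z v b φ := fun x hx => by
    obtain ⟨b, ⟨φ, hφ⟩, hb⟩ := exists_lt_of_lt_csSup hne hx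
    exact ⟨b, φ, hb, hφ⟩
  choose! β Φ hβ hΦ using hex
  set φ : ℝ → ℝ := fun x => Φ x x with hφ
  have heq : ∀ b φ', IsBranch Z v b φ' → Set.EqOn φ φ' (Set.Ico v.1 b) := by
    intro b φ' h x hx
    have hxB : x < B := hx.2.trans_le (le_csSup hbdd ⟨φ', h⟩)
    exact (hΦ x hxB).eqOn hZ h ⟨hx.1, lt_min (hβ x hxB) hx.2⟩
  have hbr : IsBranch Z v B φ := by
    refine ⟨hlt, fun x hx => ?_, ?_, fun x hx => ?_⟩
    · have h1 := heq _ _ (hΦ x hx.2)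
      have h2 := ((hΦ x hx.2).continuousOn.congr h1) x ⟨hx.1, hβ x hx.2⟩
      refine h2.mono_of_mem_nhdsWithin ?_
      filter_upwards [self_mem_nhdsWithin, mem_nhdsWithin_of_mem_nhds (Iio_mem_nhds (hβ x hx.2))]
        with z hz hz' using ⟨hz.1, hz'⟩
    · exact (hΦ v.1 hlt).apply_fst
    · exact (hΦ x hx.2).mem x ⟨hx.1, hβ x hx.2⟩
  refine ⟨B, φ, hbr, fun y hy hmem => ?_⟩
  obtain ⟨b', hb', φ', hφ'⟩ := hbr.exists_extension hZ hy hmem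
  exact absurd (le_csSup hbdd ⟨φ', hφ'⟩) (not_le.mpr hb')

/-- The maximal branch starting at a point of a maximal branch has the same end. -/
theorem IsMaxBranch.eqOn (hZ : IsLocallyGraph Z) (h : IsMaxBranch Z v b φ)
    (h' : IsMaxBranch Z v' b' φ') (h1 : v.1 ≤ v'.1) (h2 : v'.1 < b) (h3 : φ v'.1 = v'.2) :
    b' = b ∧ Set.EqOn φ φ' (Set.Ico v'.1 b) := by
  have heq : Set.EqOn φ φ' (Set.Ico v'.1 (min b b')) := by
    have hs1 : Set.Ico v'.1 (min b b') ⊆ Set.Ico v.1 b := Set.Ico_subset_Ico h1 (min_le_left _ _)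
    have hs2 : Set.Ico v'.1 (min b b') ⊆ Set.Ico v'.1 b' :=
      Set.Ico_subset_Ico_right (min_le_right _ _)
    exact hZ.eqOn isPreconnected_Ico (h.continuousOn.mono hs1) (h'.continuousOn.mono hs2)
      (fun x hx => h.mem x (hs1 hx)) (fun x hx => h'.mem x (hs2 hx))
      (Set.left_mem_Ico.mpr (lt_min h2 h'.lt)) (h3.trans h'.apply_fst.symm)
  have hb : b' = b := by
    rcases lt_trichotomy b' b with hlt | rfl | hlt
    · exfalso
      rw [min_eq_right hlt.le] at heq
      have hmem : b' ∈ Set.Ioo v.1 b := ⟨h1.trans_lt h'.lt, hlt⟩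
      refine h'.notMem (φ b') ?_ (h.mem b' ⟨hmem.1.le, hmem.2⟩)
      have hc := (h.continuousOn.continuousAt (Ico_mem_nhds hmem.1 hmem.2)).tendsto
      refine (hc.mono_left nhdsWithin_le_nhds).congr' ?_
      filter_upwards [Ico_mem_nhdsLT h'.lt] with x hx using heq hx
    · rfl
    · exfalso
      rw [min_eq_left hlt.le] at heq
      refine h.notMem (φ' b) ?_ (h'.mem b ⟨h2.le, hlt⟩)
      have hc := (h'.continuousOn.continuousAt (Ico_mem_nhds h2 hlt)).tendsto
      refine (hc.mono_left nhdsWithin_le_nhds).congr' ?_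
      filter_upwards [Ico_mem_nhdsLT h2] with x hx using (heq hx).symm
  subst hb
  rw [min_self] at heq
  exact ⟨rfl, heq⟩

/-- Any finite set of points of `Z` is covered by maximal branches that are pairwise disjoint. -/
theorem exists_disjoint_branches (hZ : IsLocallyGraph Z) {b : ℝ × ℝ → ℝ} {φ : ℝ × ℝ → ℝ → ℝ}
    {P : Finset (ℝ × ℝ)} (hP : ∀ p ∈ P, IsMaxBranch Z p (b p) (φ p)) :
    ∃ M ⊆ P, (∀ q ∈ P, ∃ p ∈ M, q.1 ∈ Set.Ico p.1 (b p) ∧ φ p q.1 = q.2) ∧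
      ∀ p ∈ M, ∀ p' ∈ M, p ≠ p' → b p = b p' →
        ∀ x, p.1 ≤ x → p'.1 ≤ x → x < b p → φ p x ≠ φ p' x := by
  classical
  set Q : ℝ × ℝ → ℝ × ℝ → Prop := fun p q => q.1 ∈ Set.Ico p.1 (b p) ∧ φ p q.1 = q.2 with hQ
  have htrans : ∀ p' ∈ P, ∀ p ∈ P, ∀ q ∈ P, Q p' p → Q p q → Q p' q := by
    intro p' hp' p hp q hq h1 h2
    obtain ⟨hb, heq⟩ := (hP p' hp').eqOn hZ (hP p hp) h1.1.1 h1.1.2 h1.2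
    exact ⟨⟨h1.1.1.trans h2.1.1, hb ▸ h2.1.2⟩, (heq ⟨h2.1.1, hb ▸ h2.1.2⟩).trans h2.2⟩
  refine ⟨P.filter fun p => ∀ p' ∈ P, Q p' p → p' = p, Finset.filter_subset _ _, ?_, ?_⟩
  · intro q hq
    have hne : (P.filter fun p => Q p q).Nonempty :=
      ⟨q, Finset.mem_filter.mpr ⟨hq, ⟨le_rfl, (hP q hq).lt⟩, (hP q hq).apply_fst⟩⟩
    obtain ⟨p, hp, hmin⟩ := Finset.exists_min_image _ (fun p => p.1) hne
    rw [Finset.mem_filter] at hp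
    refine ⟨p, Finset.mem_filter.mpr ⟨hp.1, fun p' hp' h1 => ?_⟩, hp.2⟩
    have h2 := hmin p' (Finset.mem_filter.mpr ⟨hp', htrans p' hp' p hp.1 q hq h1 hp.2⟩)
    have h3 : p'.1 = p.1 := le_antisymm h1.1.1 h2
    refine Prod.ext h3 ?_
    rw [← (hP p' hp').apply_fst, h3, h1.2]
  · have key : ∀ p ∈ P, ∀ p' ∈ P, b p = b p' → p.1 ≤ p'.1 →
        ∀ x, p'.1 ≤ x → x < b p → φ p x = φ p' x → Q p p' := by
      intro p hp p' hp' hb hle x hx hxb heq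
      have hs : Set.Ico p'.1 (b p) ⊆ Set.Ico p.1 (b p) := Set.Ico_subset_Ico_left hle
      have hlt : p'.1 < b p := hx.trans_lt hxb
      have := hZ.eqOn isPreconnected_Ico ((hP p hp).continuousOn.mono hs)
        (hb ▸ (hP p' hp').continuousOn) (fun x hx => (hP p hp).mem x (hs hx))
        (fun x hx => (hP p' hp').mem x (hb ▸ hx)) ⟨hx, hxb⟩ heq ⟨le_rfl, hlt⟩
      exact ⟨⟨hle, hlt⟩, this.trans (hP p' hp').apply_fst⟩
    intro p hp p' hp' hne hb x hx hx' hxb heq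
    rw [Finset.mem_filter] at hp hp'
    rcases le_total p.1 p'.1 with hle | hle
    · exact hne (hp'.2 p hp.1 (key p hp.1 p' hp'.1 hb hle x hx' hxb heq))
    · exact hne (hp.2 p' hp'.1 (key p' hp'.1 p hp.1 hb.symm hle x hx (hb ▸ hxb) heq.symm)).symm

end Continuation

end BombieriPila

namespace BombieriPila

open MvPolynomial Filter Finset
open scoped Topology

/-! ### Branches of plane curves and intersection numbers -/

section RootsNear

/-- Arbitrarily close to `v`, some vertical line carries at least `k` zeros of `u`. -/
def RootsNear (k : ℕ) (u : MvPolynomial (Fin 2) ℝ) (v : ℝ × ℝ) : Prop :=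
  ∀ η > 0, ∃ x, |x - v.1| < η ∧ ∃ T : Finset ℝ, k ≤ T.card ∧
    ∀ t ∈ T, |t - v.2| < η ∧ eval ![x, t] u = 0

variable {k : ℕ} {u w : MvPolynomial (Fin 2) ℝ} {v : ℝ × ℝ}

theorem RootsNear.of_dvd (h : RootsNear k u v) (huw : u ∣ w) : RootsNear k w v := by
  obtain ⟨c, rfl⟩ := huw
  intro η hη
  obtain ⟨x, hx, T, hT, h0⟩ := h η hη
  exact ⟨x, hx, T, hT, fun t ht => ⟨(h0 t ht).1, by rw [map_mul, (h0 t ht).2, zero_mul]⟩⟩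

theorem hasDerivAt_eval_snd (u : MvPolynomial (Fin 2) ℝ) (x y : ℝ) :
    HasDerivAt (fun y => eval ![x, y] u) (eval ![x, y] (pderiv 1 u)) y := by
  have := (hasFDerivAt_eval u (x, y)).comp_hasDerivAt y ((hasDerivAt_const y x).prodMk
    (hasDerivAt_id y))
  simpa using! this

theorem RootsNear.pderiv (h : RootsNear (k + 1) u v) : RootsNear k (pderiv 1 u) v := by
  intro η hη
  obtain ⟨x, hx, T, hT, h0⟩ := h η hη
  obtain ⟨T', h1, h2⟩ := exists_zeros_deriv (I := Set.Ioo (v.2 - η) (v.2 + η))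
    Set.ordConnected_Ioo (fun y _ => hasDerivAt_eval_snd u x y) T
    (fun t ht => by
      have := abs_lt.mp (h0 t ht).1
      exact ⟨by linarith, by linarith⟩) fun t ht => (h0 t ht).2
  refine ⟨x, hx, T', by omega, fun t ht => ⟨?_, (h1 t ht).2⟩⟩
  have := (h1 t ht).1
  exact abs_lt.mpr ⟨by linarith [this.1], by linarith [this.2]⟩

theorem RootsNear.eval_eq_zero (h : RootsNear (k + 1) u v) : eval ![v.1, v.2] u = 0 := by
  by_contra hne
  have hcont := (contDiff_eval u (n := 0)).continuous
  obtain ⟨η, hη, hball⟩ := Metric.eventually_nhds_iff_ball.mp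
    (hcont.continuousAt.eventually_ne hne)
  obtain ⟨x, hx, T, hT, h0⟩ := h η hη
  obtain ⟨t, ht⟩ := card_pos.mp (by omega : 0 < T.card)
  refine hball (x, t) ?_ (h0 t ht).2
  rw [Metric.mem_ball, Prod.dist_eq, max_lt_iff, Real.dist_eq, Real.dist_eq]
  exact ⟨hx, (h0 t ht).1⟩

theorem eval_aeval_C_X (b y : ℝ) (u : MvPolynomial (Fin 2) ℝ) :
    (aeval ![Polynomial.C b, Polynomial.X] u : Polynomial ℝ).eval y = eval ![b, y] u := by
  induction u using MvPolynomial.induction_on with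
  | C a => simp
  | add p q hp hq => simp [hp, hq]
  | mul_X p i hp =>
    rw [map_mul, Polynomial.eval_mul, hp, map_mul, aeval_X, eval_X]
    fin_cases i <;> simp

theorem derivative_aeval_C_X (b : ℝ) (u : MvPolynomial (Fin 2) ℝ) :
    Polynomial.derivative (aeval ![Polynomial.C b, Polynomial.X] u : Polynomial ℝ)
      = aeval ![Polynomial.C b, Polynomial.X] (MvPolynomial.pderiv 1 u) := by
  induction u using MvPolynomial.induction_on with
  | C a => simp
  | add p q hp hq => simp [hp, hq]
  | mul_X p i hp =>
    rw [map_mul, Polynomial.derivative_mul, hp, Derivation.leibniz, map_add, smul_eq_mul,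
      smul_eq_mul, map_mul, map_mul, aeval_X, pderiv_X]
    fin_cases i <;> simp [mul_comm, add_comm]

theorem RootsNear.pow_dvd (h : RootsNear k u v) :
    (Polynomial.X - Polynomial.C v.2) ^ k ∣
      (aeval ![Polynomial.C v.1, Polynomial.X] u : Polynomial ℝ) := by
  induction k generalizing u with
  | zero => simp
  | succ k ih =>
    set p : Polynomial ℝ := aeval ![Polynomial.C v.1, Polynomial.X] u with hp
    have hroot : p.IsRoot v.2 := by
      rw [Polynomial.IsRoot, hp, eval_aeval_C_X, h.eval_eq_zero]
    rcases eq_or_ne p 0 with h0 | h0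
    · rw [h0]; exact dvd_zero _
    have hd := ih h.pderiv
    rw [← derivative_aeval_C_X, ← hp] at hd
    have hd0 : Polynomial.derivative p ≠ 0 := by
      intro hd0
      have hc := Polynomial.eq_C_of_derivative_eq_zero hd0
      rw [hc, Polynomial.IsRoot, Polynomial.eval_C] at hroot
      rw [hroot, map_zero] at hc
      exact h0 hc
    rw [← Polynomial.le_rootMultiplicity_iff hd0,
      Polynomial.derivative_rootMultiplicity_of_root hroot] at hd
    rw [← Polynomial.le_rootMultiplicity_iff h0]
    have := (Polynomial.rootMultiplicity_pos h0).mpr hroot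
    omega

/-- The total number of branches of a curve ending at its common zeros with `G`. -/
theorem sum_rootsNear_le {F q G : MvPolynomial (Fin 2) ℝ} (hqG : IsRelPrime q G) (hq : q ≠ 0)
    (hG : G ≠ 0) (hqF : q ∣ F) (hFG : MvPolynomial.pderiv 1 F ∣ G) (E : Finset (ℝ × ℝ))
    (k : ℝ × ℝ → ℕ) (hk : ∀ v ∈ E, RootsNear (k v) q v) (hG0 : ∀ v ∈ E, eval ![v.1, v.2] G = 0) :
    ∑ v ∈ E, k v ≤ 2 * (q.totalDegree * G.totalDegree) := by
  classical
  set m : ℝ × ℝ → ℕ := fun v => if k v ≤ 1 then k v else k v - 1 with hm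
  have hkm : ∀ v, k v ≤ 2 * m v := fun v => by
    simp only [hm]; split_ifs <;> omega
  have hmk : ∀ v, m v ≤ k v := fun v => by
    simp only [hm]; split_ifs <;> omega
  have hq' : ∀ v ∈ E, (Polynomial.X - Polynomial.C v.2) ^ m v ∣
      (aeval ![Polynomial.C v.1, Polynomial.X] q : Polynomial ℝ) := fun v hv =>
    (pow_dvd_pow _ (hmk v)).trans (hk v hv).pow_dvd
  have hG' : ∀ v ∈ E, (Polynomial.X - Polynomial.C v.2) ^ m v ∣
      (aeval ![Polynomial.C v.1, Polynomial.X] G : Polynomial ℝ) := by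
    intro v hv
    simp only [hm]
    split_ifs with h1
    · refine (pow_dvd_pow _ h1).trans ?_
      rw [pow_one, Polynomial.dvd_iff_isRoot, Polynomial.IsRoot, eval_aeval_C_X]
      exact hG0 v hv
    · have h2 := (hk v hv).of_dvd hqF
      rw [show k v = k v - 1 + 1 by omega] at h2
      exact (h2.pderiv.of_dvd hFG).pow_dvd
  set h : ℝ → Polynomial ℝ := fun b =>
    ∏ v ∈ E with v.1 = b, (Polynomial.X - Polynomial.C v.2) ^ m v with hh
  have hdvd : ∀ (u : MvPolynomial (Fin 2) ℝ),
      (∀ v ∈ E, (Polynomial.X - Polynomial.C v.2) ^ m v ∣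
        (aeval ![Polynomial.C v.1, Polynomial.X] u : Polynomial ℝ)) →
      ∀ b, h b ∣ (aeval ![Polynomial.C b, Polynomial.X] u : Polynomial ℝ) := by
    intro u hu b
    refine Finset.prod_dvd_of_coprime ?_ fun v hv => ?_
    · intro v hv v' hv' hne
      have h1 := (mem_filter.mp (mem_coe.mp hv)).2
      have h2 := (mem_filter.mp (mem_coe.mp hv')).2
      refine IsCoprime.pow (Polynomial.isCoprime_X_sub_C_of_isUnit_sub ?_)
      refine isUnit_iff_ne_zero.mpr (sub_ne_zero.mpr fun h3 => hne ?_)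
      exact Prod.ext (h1.trans h2.symm) h3
    · obtain ⟨hvE, rfl⟩ := mem_filter.mp hv
      exact hu v hvE
  have hmonic : ∀ b, (h b).Monic := fun b =>
    Polynomial.monic_prod_of_monic _ _ fun v _ => (Polynomial.monic_X_sub_C _).pow _
  have hnat : ∀ b, (h b).natDegree = ∑ v ∈ E with v.1 = b, m v := fun b => by
    rw [hh, Polynomial.natDegree_prod_of_monic _ _
      fun v _ => (Polynomial.monic_X_sub_C _).pow _]
    exact sum_congr rfl fun v _ => by
      rw [(Polynomial.monic_X_sub_C _).natDegree_pow, Polynomial.natDegree_X_sub_C, mul_one]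
  have key := sum_natDegree_le hq hG hqG (E.image Prod.fst) h (fun b _ => (hmonic b).ne_zero)
    (fun b _ => hdvd q hq' b) fun b _ => hdvd G hG' b
  simp only [hnat] at key
  rw [sum_fiberwise_of_maps_to fun v hv => mem_image_of_mem _ hv] at key
  calc ∑ v ∈ E, k v ≤ ∑ v ∈ E, 2 * m v := sum_le_sum fun v _ => hkm v
    _ = 2 * ∑ v ∈ E, m v := by rw [mul_sum]
    _ ≤ _ := by gcongr

theorem exists_isRelPrime_factor {F : MvPolynomial (Fin 2) ℝ} (hF : F ≠ 0)
    (G : MvPolynomial (Fin 2) ℝ) : ∃ q, q ∣ F ∧ IsRelPrime q G ∧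
      ∀ p, eval p F = 0 → eval p G ≠ 0 → eval p q = 0 := by
  have hwf : WellFounded (DvdNotUnit (α := MvPolynomial (Fin 2) ℝ)) := wellFounded_dvdNotUnit
  induction F using hwf.induction with
  | _ F ih =>
    by_cases hrel : IsRelPrime F G
    · exact ⟨F, dvd_rfl, hrel, fun p h _ => h⟩
    rw [IsRelPrime] at hrel
    push Not at hrel
    obtain ⟨c, ⟨F', rfl⟩, hcG, hc⟩ := hrel
    have hF' : F' ≠ 0 := right_ne_zero_of_mul hF
    obtain ⟨q, h1, h2, h3⟩ := ih F' ⟨hF', c, hc, mul_comm _ _⟩ hF'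
    refine ⟨q, h1.trans (dvd_mul_left _ _), h2, fun p h0 hG => h3 p ?_ hG⟩
    rw [map_mul] at h0
    refine (mul_eq_zero.mp h0).resolve_left fun h => hG ?_
    obtain ⟨w, rfl⟩ := hcG
    rw [map_mul, h, zero_mul]

end RootsNear

end BombieriPila

namespace BombieriPila

open MvPolynomial Filter Finset
open scoped Topology

/-! ### Integer points on plane curves -/

section PlaneCount

variable {F G : MvPolynomial (Fin 2) ℝ} {α β R Λ : ℝ} {φ : ℝ → ℝ} {s D : ℕ}
  {e : ℕ → Fin 2 →₀ ℕ}

theorem IsArc.exists_tendsto (h : IsArc F α β φ) (hαβ : α < β)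
    (hφ : ∀ x ∈ Set.Ioo α β, |φ x| ≤ R)
    (hQ : (∀ x ∈ Set.Ioo α β, eval ![x, φ x] (derivNum 1 ![1, 0] F 1) ≠ 0) ∨
      ∀ x ∈ Set.Ioo α β, eval ![x, φ x] (derivNum 1 ![1, 0] F 1) = 0) :
    ∃ y, Tendsto φ (𝓝[<] β) (𝓝 y) := by
  have hne : (Set.Ioo α β).Nonempty := Set.nonempty_Ioo.mpr hαβ
  have hder : ∀ x ∈ Set.Ioo α β, HasDerivAt φ (arcDeriv F φ 1 x) x := fun x hx => by
    simpa only [funext (arcDeriv_zero F φ)] using h.hasDerivAt_arcDeriv 0 hx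
  have hd : DifferentiableOn ℝ φ (interior (Set.Ioo α β)) := fun x hx => by
    rw [interior_Ioo] at hx
    exact (hder x hx).differentiableAt.differentiableWithinAt
  rcases h.arcDeriv_nonneg_or_nonpos hQ with hs | hs
  · refine ⟨_, (monotoneOn_of_deriv_nonneg (convex_Ioo α β) h.continuousOn hd fun x hx =>
      ?_).tendsto_nhdsWithin_Ioo_left hne ⟨R, ?_⟩⟩
    · rw [interior_Ioo] at hx
      rw [(hder x hx).deriv]
      exact hs x hx
    · rintro _ ⟨x, hx, rfl⟩
      exact (abs_le.mp (hφ x hx)).2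
  · refine ⟨_, (antitoneOn_of_deriv_nonpos (convex_Ioo α β) h.continuousOn hd fun x hx =>
      ?_).tendsto_nhdsWithin_Ioo_left hne ⟨-R, ?_⟩⟩
    · rw [interior_Ioo] at hx
      rw [(hder x hx).deriv]
      exact hs x hx
    · rintro _ ⟨x, hx, rfl⟩
      exact (abs_le.mp (hφ x hx)).1

/-- The points of the curve `F = 0` in an open square at which `G` does not vanish. -/
def openCurve (F G : MvPolynomial (Fin 2) ℝ) (R : ℝ) : Set (ℝ × ℝ) :=
  {v | |v.1| < R ∧ |v.2| < R ∧ eval ![v.1, v.2] F = 0 ∧ eval ![v.1, v.2] G ≠ 0}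

theorem eval_ne_zero_of_dvd {F' : MvPolynomial (Fin 2) ℝ} (hFG : F' ∣ G) {p : Fin 2 → ℝ}
    (h : eval p G ≠ 0) : eval p F' ≠ 0 := by
  obtain ⟨c, rfl⟩ := hFG
  rw [map_mul] at h
  exact left_ne_zero_of_mul h

theorem isLocallyGraph_openCurve (hFG : pderiv 1 F ∣ G) (R : ℝ) :
    IsLocallyGraph (openCurve F G R) := by
  rintro v ⟨h1, h2, h3, h4⟩
  obtain ⟨ψ, hψ1, hψ2, -, hψ3⟩ := exists_local_branch h3 (eval_ne_zero_of_dvd hFG h4)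
  refine ⟨ψ, hψ1, hψ2, ?_⟩
  filter_upwards [hψ3, (contDiff_eval G (n := 0)).continuous.continuousAt.eventually_ne h4,
    (continuous_abs.comp continuous_fst).continuousAt.eventually_lt continuousAt_const h1,
    (continuous_abs.comp continuous_snd).continuousAt.eventually_lt continuousAt_const h2]
    with w hw1 hw2 hw3 hw4
  exact ⟨fun h => hw1.mp h.2.2.1, fun h => ⟨hw3, hw4, hw1.mpr h, hw2⟩⟩

theorem IsBranch.isArc {v : ℝ × ℝ} {b : ℝ} (hFG : pderiv 1 F ∣ G)
    (h : IsBranch (openCurve F G R) v b φ) : IsArc F v.1 b φ where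
  continuousOn := h.continuousOn.mono Set.Ioo_subset_Ico_self
  eval_eq_zero x hx := (h.mem x (Set.Ioo_subset_Ico_self hx)).2.2.1
  eval_pderiv_ne_zero x hx :=
    eval_ne_zero_of_dvd hFG (h.mem x (Set.Ioo_subset_Ico_self hx)).2.2.2

theorem IsBranch.le_of_openCurve {v : ℝ × ℝ} {b : ℝ} (h : IsBranch (openCurve F G R) v b φ) :
    b ≤ R := by
  by_contra! hcon
  have := (h.mem (max v.1 R) ⟨le_max_left _ _, max_lt h.lt hcon⟩).1
  exact absurd ((le_abs_self _).trans_lt this) (not_lt.mpr (le_max_right _ _))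

theorem IsMaxBranch.eval_end_eq_zero {v : ℝ × ℝ} {b y : ℝ}
    (hbox : ∀ x y, |x| = R ∨ |y| = R → eval ![x, y] G = 0)
    (h : IsMaxBranch (openCurve F G R) v b φ) (hy : Tendsto φ (𝓝[<] b) (𝓝 y)) :
    eval ![b, y] G = 0 := by
  by_contra hne
  have hlim : Tendsto (fun x => (x, φ x)) (𝓝[<] b) (𝓝 (b, y)) := by
    rw [nhds_prod_eq]
    exact (tendsto_nhdsWithin_of_tendsto_nhds tendsto_id).prodMk hy
  have hev : ∀ᶠ x in 𝓝[<] b, (x, φ x) ∈ openCurve F G R := by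
    filter_upwards [Ico_mem_nhdsLT h.lt] with x hx using h.mem x hx
  have h1 : |b| ≤ R := le_of_tendsto
    ((continuous_abs.comp continuous_fst).continuousAt.tendsto.comp hlim)
    (hev.mono fun x hx => hx.1.le)
  have h2 : |y| ≤ R := le_of_tendsto
    ((continuous_abs.comp continuous_snd).continuousAt.tendsto.comp hlim)
    (hev.mono fun x hx => hx.2.1.le)
  have h3 : eval ![b, y] F = 0 := by
    have hc : Tendsto (fun v : ℝ × ℝ => eval ![v.1, v.2] F) (𝓝 (b, y)) (𝓝 (eval ![b, y] F)) :=
      (contDiff_eval F (n := 0)).continuous.tendsto (b, y)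
    have hc' := Tendsto.comp hc hlim
    rw [Function.comp_def] at hc'
    have hz : (fun _ => 0) =ᶠ[𝓝[<] b] fun x => eval ![x, φ x] F :=
      hev.mono fun x hx => hx.2.2.1.symm
    exact tendsto_nhds_unique hc' (tendsto_const_nhds.congr' hz)
  exact h.notMem y hy ⟨lt_of_le_of_ne h1 fun h => hne (hbox _ _ (Or.inl h)),
    lt_of_le_of_ne h2 fun h => hne (hbox _ _ (Or.inr h)), h3, hne⟩

/-- Disjoint maximal branches are few. -/
theorem card_branches_le (hFG : pderiv 1 F ∣ G)
    (hbox : ∀ x y, |x| = R ∨ |y| = R → eval ![x, y] G = 0) (hG : G ≠ 0)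
    {b y : ℝ × ℝ → ℝ} {φ : ℝ × ℝ → ℝ → ℝ} {M : Finset (ℝ × ℝ)}
    (hM : ∀ p ∈ M, IsMaxBranch (openCurve F G R) p (b p) (φ p))
    (hy : ∀ p ∈ M, Tendsto (φ p) (𝓝[<] b p) (𝓝 (y p)))
    (hdisj : ∀ p ∈ M, ∀ p' ∈ M, p ≠ p' → b p = b p' →
      ∀ x, p.1 ≤ x → p'.1 ≤ x → x < b p → φ p x ≠ φ p' x) :
    M.card ≤ 2 * (F.totalDegree * G.totalDegree) := by
  classical
  have hF : F ≠ 0 := by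
    rintro rfl
    rw [map_zero, zero_dvd_iff] at hFG
    exact hG hFG
  obtain ⟨q, hqF, hqG, hq⟩ := exists_isRelPrime_factor hF G
  have hq0 : q ≠ 0 := by
    rintro rfl
    exact hF (zero_dvd_iff.mp hqF)
  set endPt : ℝ × ℝ → ℝ × ℝ := fun p => (b p, y p) with hend
  have key := sum_rootsNear_le hqG hq0 hG hqF hFG (M.image endPt)
    (fun v => (M.filter fun p => endPt p = v).card) ?_ ?_
  · rw [← card_eq_sum_card_image] at key
    refine key.trans ?_
    gcongr
    exact totalDegree_le_of_dvd_of_isDomain hqF hF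
  · intro v hv η hη
    set Mv := M.filter fun p => endPt p = v with hMv
    have hmem : ∀ p ∈ Mv, p ∈ M ∧ b p = v.1 ∧ y p = v.2 := fun p hp => by
      obtain ⟨h1, h2⟩ := mem_filter.mp hp
      exact ⟨h1, congrArg Prod.fst h2, congrArg Prod.snd h2⟩
    have hev : ∀ᶠ x in 𝓝[<] v.1, ∀ p ∈ Mv, |φ p x - v.2| < η ∧ x ∈ Set.Ico p.1 v.1 := by
      rw [eventually_all_finset]
      intro p hp
      obtain ⟨h1, h2, h3⟩ := hmem p hp
      have h4 := hy p h1
      have h5 := (hM p h1).lt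
      rw [h2] at h4 h5
      rw [h3] at h4
      have h6 := h4.eventually (Metric.ball_mem_nhds _ hη)
      filter_upwards [h6, Ico_mem_nhdsLT h5] with x hx hx' using ⟨by
        rwa [Real.dist_eq] at hx, hx'⟩
    have hev' : ∀ᶠ x in 𝓝[<] v.1, |x - v.1| < η := by
      filter_upwards [mem_nhdsWithin_of_mem_nhds (Metric.ball_mem_nhds v.1 hη)] with x hx
      rwa [Metric.mem_ball, Real.dist_eq] at hx
    obtain ⟨x, hx1, hx2⟩ := (hev.and hev').exists
    refine ⟨x, hx2, Mv.image fun p => φ p x, le_of_eq (card_image_of_injOn ?_).symm, ?_⟩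
    · intro p hp p' hp' heq
      rw [mem_coe] at hp hp'
      by_contra hne
      obtain ⟨h1, h2, -⟩ := hmem p hp
      obtain ⟨h1', h2', -⟩ := hmem p' hp'
      exact hdisj p h1 p' h1' hne (h2.trans h2'.symm) x (hx1 p hp).2.1 (hx1 p' hp').2.1
        (h2.symm ▸ (hx1 p hp).2.2) heq
    · intro t ht
      obtain ⟨p, hp, rfl⟩ := mem_image.mp ht
      obtain ⟨h1, h2, -⟩ := hmem p hp
      have h3 := (hM p h1).mem x (h2.symm ▸ (hx1 p hp).2)
      exact ⟨(hx1 p hp).1, hq _ h3.2.2.1 h3.2.2.2⟩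
  · intro v hv
    obtain ⟨p, hp, rfl⟩ := mem_image.mp hv
    exact (hM p hp).eval_end_eq_zero hbox (hy p hp)

/-- An upper bound for the number of integer points on an arc. -/
noncomputable def arcBound (s : ℕ) (Λ R : ℝ) : ℝ :=
  2 * (1 + s * (1 + 2 * (8 * s ^ 4 * Λ) * Real.log R))

theorem card_points_le (hR : 1 ≤ R) (hFG : pderiv 1 F ∣ G)
    (hbox : ∀ x y, |x| = R ∨ |y| = R → eval ![x, y] G = 0)
    (hQ : ∀ k, 1 ≤ k → k ≤ s →
      (∀ v, eval v F = 0 → eval v G ≠ 0 → eval v (derivNum 1 ![1, 0] F k) ≠ 0) ∨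
      ∀ v, eval v F = 0 → eval v G ≠ 0 → eval v (derivNum 1 ![1, 0] F k) = 0)
    (hW : ∀ k ≤ s, ∀ v, eval v F = 0 → eval v G ≠ 0 →
      eval v (wronskian (tangent 1 ![1, 0] F) (fun j => monomial (e j) 1) k) ≠ 0)
    (heD : ∀ j < s, (e j).degree ≤ D) (hD : D < s) (hs : 2 ≤ s) (hΛ1 : 1 ≤ Λ)
    (hΛ : R ^ (∑ j ∈ range s, (e j).degree) ≤ Λ ^ (s * (s - 1) / 2))
    {P : Finset (ℤ × ℤ)} (hP : ∀ p ∈ P, ((p.1 : ℝ), (p.2 : ℝ)) ∈ openCurve F G R) :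
    (P.card : ℝ) ≤ 2 * (F.totalDegree * G.totalDegree) * (1 + arcBound s Λ R) := by
  classical
  have hB : 0 ≤ arcBound s Λ R := by
    have := Real.log_nonneg hR
    rw [arcBound]
    positivity
  rcases P.eq_empty_or_nonempty with rfl | ⟨p₀, hp₀⟩
  · simp only [card_empty, Nat.cast_zero]
    positivity
  have hG : G ≠ 0 := by
    rintro rfl
    exact (hP p₀ hp₀).2.2.2 (map_zero _)
  have hZ := isLocallyGraph_openCurve hFG R
  have hmax : ∀ p, p ∈ openCurve F G R → ∃ b φ, IsMaxBranch (openCurve F G R) p b φ := fun p hp =>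
    hZ.exists_isMaxBranch (R := R) (fun w hw => (le_abs_self _).trans_lt hw.1) hp
  choose! b φ hbφ using hmax
  set ι : ℤ × ℤ → ℝ × ℝ := fun p => ((p.1 : ℝ), (p.2 : ℝ)) with hι
  have hP' : ∀ p ∈ P.image ι, p ∈ openCurve F G R := fun p hp => by
    obtain ⟨z, hz, rfl⟩ := mem_image.mp hp
    exact hP z hz
  obtain ⟨M, hMP, hcov, hdisj⟩ := exists_disjoint_branches hZ fun p hp => hbφ p (hP' p hp)
  have hM : ∀ p ∈ M, IsMaxBranch (openCurve F G R) p (b p) (φ p) := fun p hp =>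
    hbφ p (hP' p (hMP hp))
  have hIoo : ∀ p ∈ M, ∀ x ∈ Set.Ioo p.1 (b p), (x, φ p x) ∈ openCurve F G R := fun p hp x hx =>
    (hM p hp).mem x (Set.Ioo_subset_Ico_self hx)
  have hQ' : ∀ p ∈ M, ∀ k, 1 ≤ k → k ≤ s →
      (∀ x ∈ Set.Ioo p.1 (b p), eval ![x, φ p x] (derivNum 1 ![1, 0] F k) ≠ 0) ∨
      ∀ x ∈ Set.Ioo p.1 (b p), eval ![x, φ p x] (derivNum 1 ![1, 0] F k) = 0 := by
    intro p hp k hk hks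
    rcases hQ k hk hks with h | h
    · exact Or.inl fun x hx => h _ (hIoo p hp x hx).2.2.1 (hIoo p hp x hx).2.2.2
    · exact Or.inr fun x hx => h _ (hIoo p hp x hx).2.2.1 (hIoo p hp x hx).2.2.2
  have harc : ∀ p ∈ M, IsArc F p.1 (b p) (φ p) := fun p hp => (hM p hp).isArc hFG
  have hlim : ∀ p, p ∈ M → ∃ y, Tendsto (φ p) (𝓝[<] b p) (𝓝 y) := fun p hp =>
    (harc p hp).exists_tendsto (hM p hp).lt (fun x hx => (hIoo p hp x hx).2.1.le)
      (hQ' p hp 1 le_rfl (by omega))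
  choose! y hy using hlim
  have hMcard := card_branches_le hFG hbox hG hM hy hdisj
  set A : ℝ × ℝ → Finset (ℤ × ℤ) := fun p =>
    P.filter fun z => (z.1 : ℝ) ∈ Set.Ico p.1 (b p) ∧ φ p z.1 = z.2 with hA
  have hcard : ∀ p ∈ M, ((A p).card : ℝ) ≤ 1 + arcBound s Λ R := by
    intro p hp
    have hAmem : ∀ z ∈ A p, (z.1 : ℝ) ∈ Set.Ico p.1 (b p) ∧ φ p z.1 = z.2 := fun z hz =>
      (mem_filter.mp hz).2
    have hinj : ∀ z ∈ A p, ∀ z' ∈ A p, z.1 = z'.1 → z = z' := fun z hz z' hz' h => by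
      refine Prod.ext h ?_
      have h1 := (hAmem z hz).2
      rw [h, (hAmem z' hz').2] at h1
      exact_mod_cast h1.symm
    set T := ((A p).filter fun z => p.1 < z.1).image Prod.fst with hT
    have h1 : (((A p).filter fun z => p.1 < z.1).card : ℝ) ≤ arcBound s Λ R := by
      rw [← card_image_of_injOn (f := Prod.fst) fun z hz z' hz' h =>
        hinj z (mem_filter.mp (mem_coe.mp hz)).1 z' (mem_filter.mp (mem_coe.mp hz')).1 h]
      refine (harc p hp).card_le hR ?_ (hM p hp).le_of_openCurve
        (fun x hx => (hIoo p hp x hx).2.1.le) (hQ' p hp)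
        (fun k hk x hx => hW k hk _ (hIoo p hp x hx).2.2.1 (hIoo p hp x hx).2.2.2)
        heD hD hs hΛ1 hΛ fun x hx => ?_
      · exact (abs_lt.mp (hP' p (hMP hp)).1).1.le
      · obtain ⟨z, hz, rfl⟩ := mem_image.mp hx
        obtain ⟨hz1, hz2⟩ := mem_filter.mp hz
        exact ⟨⟨hz2, (hAmem z hz1).1.2⟩, z.2, (hAmem z hz1).2⟩
    have h2 : ((A p).filter fun z => ¬ p.1 < z.1).card ≤ 1 := by
      rw [Finset.card_le_one]
      intro z hz z' hz'
      obtain ⟨hz1, hz2⟩ := mem_filter.mp hz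
      obtain ⟨hz1', hz2'⟩ := mem_filter.mp hz'
      refine hinj z hz1 z' hz1' ?_
      have h3 := (hAmem z hz1).1.1
      have h4 := (hAmem z' hz1').1.1
      have h5 : (z.1 : ℝ) = z'.1 := by linarith
      exact_mod_cast h5
    have h3 := card_filter_add_card_filter_not (s := A p) fun z => p.1 < z.1
    have h4 : ((A p).card : ℝ) = ((A p).filter fun z => p.1 < z.1).card
        + ((A p).filter fun z => ¬ p.1 < z.1).card := by exact_mod_cast h3.symm
    have h5 : (((A p).filter fun z => ¬ p.1 < z.1).card : ℝ) ≤ 1 := by exact_mod_cast h2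
    linarith
  have hsub : P ⊆ M.biUnion A := fun z hz => by
    obtain ⟨p, hp, h⟩ := hcov (ι z) (mem_image_of_mem _ hz)
    exact mem_biUnion.mpr ⟨p, hp, mem_filter.mpr ⟨hz, h⟩⟩
  calc (P.card : ℝ) ≤ ((∑ p ∈ M, (A p).card : ℕ) : ℝ) := by
        exact_mod_cast (card_le_card hsub).trans card_biUnion_le
    _ = ∑ p ∈ M, ((A p).card : ℝ) := by push_cast; rfl
    _ ≤ ∑ _p ∈ M, (1 + arcBound s Λ R) := sum_le_sum hcard
    _ = M.card * (1 + arcBound s Λ R) := by rw [sum_const, nsmul_eq_mul]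
    _ ≤ _ := by
      gcongr
      exact_mod_cast hMcard

end PlaneCount

end BombieriPila

namespace BombieriPila

open MvPolynomial Finset

/-! ### Slicing a hypersurface -/

section RealSlice

variable {σ : Type*} [DecidableEq σ]

/-- Restriction of rational polynomials to a plane, with real coefficients. -/
noncomputable def realSlice (y : σ) (c a : σ → ℚ) :
    MvPolynomial σ ℚ →+* MvPolynomial (Fin 2) ℝ :=
  (map (Rat.castHom ℝ)).comp (slice y c a).toRingHom

theorem realSlice_apply (y : σ) (c a : σ → ℚ) (G : MvPolynomial σ ℚ) :
    realSlice y c a G = map (Rat.castHom ℝ) (slice y c a G) := rfl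

theorem realSlice_pderiv (y : σ) (c a : σ → ℚ) (G : MvPolynomial σ ℚ) :
    realSlice y c a (pderiv y G) = pderiv 1 (realSlice y c a G) := by
  rw [realSlice_apply, slice_pderiv, map_pderiv_map, realSlice_apply]

theorem map_castHom_direction :
    (fun i => Rat.castHom ℝ ((![1, 0] : Fin 2 → ℚ) i)) = (![1, 0] : Fin 2 → ℝ) := by
  funext i
  fin_cases i <;> simp

theorem realSlice_dirDeriv {y : σ} (c : σ → ℚ) {a : σ → ℚ} (ha : a y = 0)
    (G : MvPolynomial σ ℚ) :
    realSlice y c a (dirDeriv a G) = dirDeriv ![1, 0] (realSlice y c a G) := by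
  rw [realSlice_apply, slice_dirDeriv c ha, map_dirDeriv_map, map_castHom_direction,
    realSlice_apply]

theorem realSlice_tangent {y : σ} (c : σ → ℚ) {a : σ → ℚ} (ha : a y = 0)
    (f G : MvPolynomial σ ℚ) : realSlice y c a (tangent y a f G)
      = tangent 1 ![1, 0] (realSlice y c a f) (realSlice y c a G) := by
  rw [realSlice_apply, slice_tangent c ha, map_tangent_map, map_castHom_direction,
    realSlice_apply, realSlice_apply]

theorem totalDegree_realSlice_le (y : σ) (c a : σ → ℚ) (G : MvPolynomial σ ℚ) :
    (realSlice y c a G).totalDegree ≤ G.totalDegree := by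
  refine totalDegree_map_le (ι := Rat.castHom ℝ) (fun i => ?_) (fun r => ?_) G
  · rw [realSlice_apply, slice_X]
    split_ifs
    · rw [map_X]
      exact (totalDegree_X _).le
    · rw [map_add, map_mul, map_C, map_C, map_X]
      refine (totalDegree_add _ _).trans (max_le (by rw [totalDegree_C]; exact Nat.zero_le _)
        ((totalDegree_mul _ _).trans ?_))
      rw [totalDegree_C, zero_add]
      exact (totalDegree_X _).le
  · rw [realSlice_apply, slice_C, map_C]

theorem eval_realSlice (y : σ) (c a : σ → ℚ) (P : Fin 2 → ℚ) (G : MvPolynomial σ ℚ) :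
    eval (fun i => (P i : ℝ)) (realSlice y c a G)
      = (eval (fun i => if i = y then P 1 else c i + a i * P 0) G : ℚ) := by
  rw [← eval_slice]
  exact eval_map_apply (Rat.castHom ℝ) P _

variable {x y : σ}

/-- The number of integer points on a planar slice of a hypersurface that avoid the zeros of a
suitable auxiliary polynomial. -/
theorem card_realSlice_le (hxy : x ≠ y) {f g : MvPolynomial σ ℚ} {c a : σ → ℚ} (hc : c x = 0)
    (ha : a x = 1) (ha' : a y = 0) {e : ℕ → Fin 2 →₀ ℕ} {s D N : ℕ} {Λ : ℝ}
    (hfg : pderiv y f ∣ g) (hWg : ∀ m ≤ s, wronskian (tangent y a f) (planeMonomial ℚ x y e) m ∣ g)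
    (hQg : ∀ k ≤ s, f ∣ derivNum y a f k ∨ derivNum y a f k ∣ g)
    (heD : ∀ j < s, (e j).degree ≤ D) (hD : D < s) (hs : 2 ≤ s) (hΛ1 : 1 ≤ Λ)
    (hΛ : (N + 1 : ℝ) ^ (∑ j ∈ range s, (e j).degree) ≤ Λ ^ (s * (s - 1) / 2))
    {P : Finset (ℤ × ℤ)} (hN : ∀ p ∈ P, |p.1| ≤ N ∧ |p.2| ≤ N)
    (hPf : ∀ p ∈ P, eval ![(p.1 : ℝ), (p.2 : ℝ)] (realSlice y c a f) = 0)
    (hPg : ∀ p ∈ P, eval ![(p.1 : ℝ), (p.2 : ℝ)] (realSlice y c a g) ≠ 0) :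
    (P.card : ℝ) ≤ 2 * (f.totalDegree * (g.totalDegree + 4)) * (1 + arcBound s Λ (N + 1)) := by
  set ρ := realSlice y c a with hρ
  set R : ℝ := N + 1 with hRdef
  have hR : 1 ≤ R := by rw [hRdef]; linarith [(Nat.cast_nonneg N : (0 : ℝ) ≤ N)]
  set G : MvPolynomial (Fin 2) ℝ := ρ g * ((X 0 ^ 2 - C (R ^ 2)) * (X 1 ^ 2 - C (R ^ 2))) with hG
  have hdvd : ∀ q, q ∣ g → ρ q ∣ G := fun q hq => (map_dvd ρ hq).mul_right _
  have hdegX : ∀ i : Fin 2, (X i ^ 2 - C (R ^ 2) : MvPolynomial (Fin 2) ℝ).totalDegree ≤ 2 :=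
    fun i => (totalDegree_sub _ _).trans (max_le (totalDegree_X_pow _ _).le
      ((totalDegree_C _).le.trans (Nat.zero_le _)))
  have hevalG : ∀ u w : ℝ, eval ![u, w] G
      = eval ![u, w] (ρ g) * ((u ^ 2 - R ^ 2) * (w ^ 2 - R ^ 2)) := fun u w => by
    simp [hG]
  have hGdeg : G.totalDegree ≤ g.totalDegree + 4 :=
    (totalDegree_mul _ _).trans (add_le_add (totalDegree_realSlice_le _ _ _ _)
      ((totalDegree_mul _ _).trans (add_le_add (hdegX 0) (hdegX 1))))
  have hB : 0 ≤ arcBound s Λ R := by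
    have := Real.log_nonneg hR
    rw [arcBound]
    positivity
  have hX : ρ (X y) = X 1 := by rw [hρ, realSlice_apply, slice_X, if_pos rfl, map_X]
  have hρQ : ∀ k, ρ (derivNum y a f k) = derivNum 1 ![1, 0] (ρ f) k := fun k =>
    map_derivNum ρ (realSlice_pderiv y c a) (realSlice_dirDeriv c ha') hX f k
  have hρW : ∀ m, ρ (wronskian (tangent y a f) (planeMonomial ℚ x y e) m)
      = wronskian (tangent 1 ![1, 0] (ρ f)) (fun j => monomial (e j) 1) m := fun m =>
    map_wronskian ρ (realSlice_tangent c ha' f) (fun j => by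
      rw [hρ, realSlice_apply, slice_planeMonomial hxy hc ha, map_monomial, map_one]) m
  have key := card_points_le (F := ρ f) (G := G) (R := R) (s := s) (e := e) (D := D) (Λ := Λ)
    hR (by rw [← realSlice_pderiv]; exact hdvd _ hfg) ?_ ?_ ?_ heD hD hs hΛ1 hΛ (P := P) ?_
  · refine key.trans ?_
    gcongr
    · exact totalDegree_realSlice_le _ _ _ _
    · exact_mod_cast hGdeg
  · intro u w h
    rw [hevalG]
    rcases h with h | h
    · simp [← h]
    · simp [← h]
  · intro k _ hk
    rw [← hρQ]
    rcases hQg k hk with h | h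
    · exact Or.inr fun v hv _ => by
        obtain ⟨q, hq⟩ := map_dvd ρ h
        rw [hq, map_mul, hv, zero_mul]
    · exact Or.inl fun v _ hv => eval_ne_zero_of_dvd (hdvd _ h) hv
  · intro k hk v _ hv
    rw [← hρW]
    exact eval_ne_zero_of_dvd (hdvd _ (hWg k hk)) hv
  · intro p hp
    obtain ⟨h1, h2⟩ := hN p hp
    have h1' : |(p.1 : ℝ)| < R := by
      have : |(p.1 : ℝ)| ≤ N := by exact_mod_cast h1
      linarith
    have h2' : |(p.2 : ℝ)| < R := by
      have : |(p.2 : ℝ)| ≤ N := by exact_mod_cast h2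
      linarith
    have hne : ∀ t : ℝ, |t| < R → t ^ 2 - R ^ 2 ≠ 0 := fun t ht => by
      have := sq_lt_sq' (abs_lt.mp ht).1 (abs_lt.mp ht).2
      linarith
    refine ⟨h1', h2', hPf p hp, ?_⟩
    rw [hevalG]
    exact mul_ne_zero (hPg p hp) (mul_ne_zero (hne _ h1') (hne _ h2'))

end RealSlice

section Auxiliary

variable {σ : Type*} [Fintype σ] {x y : σ}

/-- An auxiliary polynomial of controlled degree not vanishing on the hypersurface and divisible by
the polynomials governing the slices. -/
theorem exists_auxiliary {f : MvPolynomial σ ℚ} (hf : Irreducible f) (hfy : pderiv y f ≠ 0)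
    {a : σ → ℚ} {e : ℕ → Fin 2 →₀ ℕ} {s D : ℕ} (heD : ∀ j < s, (e j).degree ≤ D)
    (hW : ∀ m ≤ s, ¬ f ∣ wronskian (tangent y a f) (planeMonomial ℚ x y e) m) :
    ∃ g, ¬ f ∣ g ∧ g.totalDegree ≤ f.totalDegree + (s + 1) * (s * (D + s * f.totalDegree))
        + (s + 1) * (1 + s * (2 * f.totalDegree)) ∧
      pderiv y f ∣ g ∧ (∀ m ≤ s, wronskian (tangent y a f) (planeMonomial ℚ x y e) m ∣ g) ∧
      ∀ k ≤ s, f ∣ derivNum y a f k ∨ derivNum y a f k ∣ g := by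
  classical
  set W := wronskian (tangent y a f) (planeMonomial ℚ x y e) with hWdef
  set T := (range (s + 1)).filter fun k => ¬ f ∣ derivNum y a f k with hT
  refine ⟨pderiv y f * (∏ m ∈ range (s + 1), W m) * ∏ k ∈ T, derivNum y a f k, fun h => ?_, ?_,
    (dvd_mul_right _ _).mul_right _, fun m hm => ?_, fun k hk => ?_⟩
  · rcases hf.prime.dvd_or_dvd h with h | h
    · rcases hf.prime.dvd_or_dvd h with h | h
      · exact not_dvd_pderiv hfy h
      · obtain ⟨m, hm, h⟩ := (Prime.dvd_finsetProd_iff hf.prime _).mp h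
        exact hW m (Nat.lt_succ_iff.mp (mem_range.mp hm)) h
    · obtain ⟨k, hk, h⟩ := (Prime.dvd_finsetProd_iff hf.prime _).mp h
      exact (mem_filter.mp hk).2 h
  · refine (totalDegree_mul _ _).trans (add_le_add ((totalDegree_mul _ _).trans
      (add_le_add (totalDegree_pderiv_le y f) ?_)) ?_)
    · refine (totalDegree_finsetProd _ _).trans ((sum_le_card_nsmul _ _
        (s * (D + s * f.totalDegree)) fun m hm => ?_).trans (by simp))
      have hms : m ≤ s := Nat.lt_succ_iff.mp (mem_range.mp hm)
      have := isFiltration_degFilt.wronskian_mem (m := m) (tangent_mem_degFilt y a f)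
        (h := planeMonomial ℚ x y e) (b := D)
        fun j hj => mem_degFilt.mpr ((totalDegree_planeMonomial_le x y e j).trans
          (heD j (hj.trans_le hms)))
      refine (mem_degFilt.mp this).trans ?_
      gcongr
    · refine (totalDegree_finsetProd _ _).trans ((sum_le_card_nsmul _ _
        (1 + s * (2 * f.totalDegree)) fun k hk => ?_).trans ?_)
      · have hks : k ≤ s := Nat.lt_succ_iff.mp (mem_range.mp (mem_filter.mp hk).1)
        refine (totalDegree_derivNum_le y a f k).trans ?_
        gcongr
      · rw [smul_eq_mul]
        gcongr
        exact (card_filter_le _ _).trans (card_range _).le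
  · exact ((dvd_prod_of_mem W (mem_range.mpr (Nat.lt_succ_of_le hm))).mul_left _).mul_right _
  · by_cases h : f ∣ derivNum y a f k
    · exact Or.inl h
    · exact Or.inr ((dvd_prod_of_mem _ (mem_filter.mpr
        ⟨mem_range.mpr (Nat.lt_succ_of_le hk), h⟩)).mul_left _)

end Auxiliary

section Count

variable {σ : Type*} [Fintype σ] [DecidableEq σ] {x y : σ}

theorem card_free (hxy : x ≠ y) : Fintype.card (Free x y) = Fintype.card σ - 2 := by
  rw [Fintype.card_subtype, ← card_pair hxy, ← card_univ, ← card_sdiff_of_subset (subset_univ _)]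
  congr 1
  ext i
  simp

theorem card_box (τ : Type*) [Fintype τ] [DecidableEq τ] (B : ℕ) :
    (box τ B).card = (2 * B + 1) ^ Fintype.card τ := by
  rw [box, Fintype.card_piFinset]
  simp only [Int.card_Icc, prod_const, card_univ]
  congr 1
  omega

/-- The number of integer points on a hypersurface, given a good direction for slicing. -/
theorem card_le_of_direction (hxy : x ≠ y) {f : MvPolynomial σ ℚ} (hf : Irreducible f)
    (hfy : pderiv y f ≠ 0) {v : Free x y → ℕ} {K : ℕ} (hv : ∀ i, v i ≤ K)
    {e : ℕ → Fin 2 →₀ ℕ} {s D N E : ℕ} {Λ : ℝ}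
    (hW : ∀ m ≤ s, ¬ f ∣ wronskian (tangent y (direction x y fun i => (v i : ℚ)) f)
      (planeMonomial ℚ x y e) m)
    (heD : ∀ j < s, (e j).degree ≤ D) (hD : D < s) (hs : 2 ≤ s) (hΛ1 : 1 ≤ Λ)
    (hΛ : (N + 1 : ℝ) ^ (∑ j ∈ range s, (e j).degree) ≤ Λ ^ (s * (s - 1) / 2))
    (hE : f.totalDegree + (s + 1) * (s * (D + s * f.totalDegree))
        + (s + 1) * (1 + s * (2 * f.totalDegree)) ≤ E)
    {S : Finset (σ → ℤ)} (hS : S ⊆ box σ N) (hSf : ∀ z ∈ S, eval (fun i => (z i : ℚ)) f = 0) :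
    (S.card : ℝ) ≤ f.totalDegree * E * (Fintype.card σ * (2 * N) + 1) ^ (Fintype.card σ - 2)
      + (2 * ((1 + K) * N) + 1) ^ (Fintype.card σ - 2) *
        (2 * (f.totalDegree * (E + 4)) * (1 + arcBound s Λ (N + 1))) := by
  classical
  set a : σ → ℚ := direction x y fun i => (v i : ℚ) with hadef
  obtain ⟨g, hfg, hgdeg, hgy, hgW, hgQ⟩ := exists_auxiliary hf hfy heD hW
  replace hgdeg := hgdeg.trans hE
  have hg0 : g ≠ 0 := fun h => hfg (h ▸ dvd_zero f)
  have hB : 0 ≤ arcBound s Λ (N + 1) := by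
    have := Real.log_nonneg (show (1 : ℝ) ≤ N + 1 by
      linarith [(Nat.cast_nonneg N : (0 : ℝ) ≤ N)])
    rw [arcBound]
    positivity
  have hSN : ∀ z ∈ S, ∀ i, |z i| ≤ N := fun z hz i => by
    have := Fintype.mem_piFinset.mp (hS hz) i
    rw [mem_Icc] at this
    exact abs_le.mpr this
  set S₀ := S.filter fun z => eval (fun i => (z i : ℚ)) g = 0 with hS₀
  set S₁ := S.filter fun z => ¬ eval (fun i => (z i : ℚ)) g = 0 with hS₁
  have hsplit : S₀.card + S₁.card = S.card := card_filter_add_card_filter_not _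
  have h0 : (S₀.card : ℝ) ≤ f.totalDegree * E *
      (Fintype.card σ * (2 * N) + 1) ^ (Fintype.card σ - 2) := by
    have := card_common_zeros_le hxy hf.ne_zero hg0 (hf.isRelPrime_iff_not_dvd.mpr hfg) (R := N)
      ((filter_subset _ _).trans hS : S₀ ⊆ _)
      (fun z hz => hSf z (mem_filter.mp hz).1) (fun z hz => (mem_filter.mp hz).2)
    calc (S₀.card : ℝ) ≤ ((f.totalDegree * g.totalDegree *
        (Fintype.card σ * (2 * N) + 1) ^ (Fintype.card σ - 2) : ℕ) : ℝ) := by exact_mod_cast this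
      _ ≤ _ := by
        push_cast
        gcongr
  set key : (σ → ℤ) → Free x y → ℤ := fun z i => z i - v i * z x with hkey
  have hmaps : ∀ z ∈ S₁, key z ∈ box (Free x y) ((1 + K) * N) := by
    intro z hz
    refine Fintype.mem_piFinset.mpr fun i => ?_
    rw [mem_Icc, ← abs_le]
    have h1 := hSN z (mem_filter.mp hz).1 i
    have h2 := hSN z (mem_filter.mp hz).1 x
    have h3 : ((v i : ℕ) : ℤ) ≤ K := by exact_mod_cast hv i
    calc |z i - v i * z x| ≤ |z i| + |(v i : ℤ) * z x| := abs_sub _ _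
      _ ≤ N + K * N := by
        rw [abs_mul, Nat.abs_cast]
        gcongr
      _ = ((1 + K) * N : ℕ) := by push_cast; ring
  have hfib : ∀ c ∈ box (Free x y) ((1 + K) * N), ((S₁.filter fun z => key z = c).card : ℝ) ≤
      2 * (f.totalDegree * (E + 4)) * (1 + arcBound s Λ (N + 1)) := by
    intro c _
    set c' : σ → ℚ := fun i => if h : i ≠ x ∧ i ≠ y then (c ⟨i, h⟩ : ℚ) else 0 with hc'
    set T := S₁.filter fun z => key z = c with hT
    have hpt : ∀ z ∈ T, ∀ i, (z i : ℚ) = if i = y then (z y : ℚ) else c' i + a i * z x := by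
      intro z hz i
      have hz' := (mem_filter.mp hz).2
      split_ifs with hiy
      · rw [hiy]
      · by_cases hix : i = x
        · subst hix
          simp [hc', hadef, direction]
        · have := congrFun hz' ⟨i, hix, hiy⟩
          simp only [hc', hadef, direction, hix, hiy, ne_eq, not_false_eq_true, and_self,
            dif_pos, ← this, hkey]
          push_cast
          ring
    have hev : ∀ z ∈ T, ∀ G, eval ![(z x : ℝ), (z y : ℝ)] (realSlice y c' a G)
        = (eval (fun i => (z i : ℚ)) G : ℚ) := by
      intro z hz G
      have h1 := eval_realSlice y c' a ![(z x : ℚ), (z y : ℚ)] G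
      have h2 : (fun i => ((![(z x : ℚ), (z y : ℚ)] i : ℚ) : ℝ)) = ![(z x : ℝ), (z y : ℝ)] := by
        funext i
        fin_cases i <;> simp
      rw [h2] at h1
      rw [h1]
      congr 2
      have : (fun i => (z i : ℚ)) = fun i => if i = y then (z y : ℚ) else c' i + a i * z x :=
        funext (hpt z hz)
      rw [this]
      simp
    have hinj : Set.InjOn (fun z : σ → ℤ => (z x, z y)) T := by
      intro z hz z' hz' h
      rw [mem_coe] at hz hz'
      obtain ⟨hx, hy⟩ := Prod.mk.inj h
      funext i
      have : (z i : ℚ) = z' i := by rw [hpt z hz, hpt z' hz', hx, hy]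
      exact_mod_cast this
    rw [← card_image_of_injOn hinj]
    refine (card_realSlice_le (N := N) (Λ := Λ) (c := c') (g := g) hxy (by simp [hc'])
      (direction_x _) (direction_y hxy _) hgy hgW hgQ heD hD hs hΛ1 hΛ ?_ ?_ ?_).trans ?_
    · intro p hp
      obtain ⟨z, hz, rfl⟩ := mem_image.mp hp
      have := hSN z (mem_filter.mp (mem_filter.mp hz).1).1
      exact ⟨this x, this y⟩
    · intro p hp
      obtain ⟨z, hz, rfl⟩ := mem_image.mp hp
      rw [hev z hz, hSf z (mem_filter.mp (mem_filter.mp hz).1).1, Rat.cast_zero]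
    · intro p hp
      obtain ⟨z, hz, rfl⟩ := mem_image.mp hp
      rw [hev z hz, Rat.cast_ne_zero]
      exact (mem_filter.mp (mem_filter.mp hz).1).2
    · gcongr
  have h1 : (S₁.card : ℝ) ≤ (2 * ((1 + K) * N) + 1) ^ (Fintype.card σ - 2) *
        (2 * (f.totalDegree * (E + 4)) * (1 + arcBound s Λ (N + 1))) := by
    rw [card_eq_sum_card_fiberwise hmaps, Nat.cast_sum]
    refine (sum_le_card_nsmul _ _ _ hfib).trans ?_
    rw [card_box, card_free hxy, nsmul_eq_mul]
    push_cast
    rfl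
  rw [← hsplit, Nat.cast_add]
  exact add_le_add h0 h1

end Count

end BombieriPila

namespace BombieriPila

open MvPolynomial Finset

/-! ### Integer points on hypersurfaces -/

section Hypersurface

theorem exists_pderiv_ne_zero {σ : Type*} {f : MvPolynomial σ ℚ} (hf : f.totalDegree ≠ 0) :
    ∃ y, pderiv y f ≠ 0 := by
  classical
  by_contra! h
  refine hf (Nat.le_zero.mp (Finset.sup_le fun u hu => ?_))
  have hu0 : u = 0 := by
    by_contra hne
    obtain ⟨y, hy⟩ := Finsupp.ne_iff.mp hne
    rw [Finsupp.zero_apply] at hy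
    have h1 := coeff_pderiv (i := y) f (u - Finsupp.single y 1)
    rw [h y, coeff_zero, tsub_add_cancel_of_le (Finsupp.single_le_iff.mpr
      (Nat.one_le_iff_ne_zero.mpr hy))] at h1
    refine mul_ne_zero (mem_support_iff.mp hu) ?_ h1.symm
    positivity
  simp [hu0]

theorem rpow_sum_degree_le {d l M : ℕ} (hd : 0 < d) (hl : 2 ≤ l) {r : ℝ} (hr : 1 ≤ r)
    (hM : M ≤ min d l * (min d l * l * (min d l * l + 1) / 2)) {s : ℕ}
    (hs : s = exponentCount (min d l) (min d l * l)) :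
    r ^ M ≤ (r ^ ((1 : ℝ) / d + 3 / l)) ^ (s * (s - 1) / 2) := by
  set p := min d l with hp
  have hp0 : 0 < p := lt_min hd (by omega)
  have hl0 : (0 : ℝ) < l := by exact_mod_cast (by omega : 0 < l)
  have hd0 : (0 : ℝ) < d := by exact_mod_cast hd
  rw [← Real.rpow_natCast, ← Real.rpow_natCast, ← Real.rpow_mul (by linarith)]
  refine Real.rpow_le_rpow_of_exponent_le hr ?_
  have h1 : (1 : ℝ) / p ≤ 1 / d + 1 / l := by
    rcases min_choice d l with h | h
    · rw [hp, h]
      have : (0 : ℝ) ≤ 1 / l := by positivity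
      linarith
    · rw [hp, h]
      have : (0 : ℝ) ≤ 1 / d := by positivity
      linarith
  have h2 : ((s * (s - 1) / 2 : ℕ) : ℝ) = s * (s - 1) / 2 := by
    have hs1 : 1 ≤ s := by
      have := lt_exponentCount hp0 (Nat.le_mul_of_pos_right p (by omega : 0 < l))
      omega
    rw [Nat.cast_div (Nat.even_mul_pred_self s).two_dvd (by norm_num), Nat.cast_mul,
      Nat.cast_sub hs1]
    norm_num
  have h3 := degree_sum_le hp0 hl
  rw [← hs] at h3
  rw [h2]
  have hs0 : (0 : ℝ) ≤ s * (s - 1) / 2 := by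
    rw [← h2]
    positivity
  calc (M : ℝ) ≤ ((p * (p * l * (p * l + 1) / 2) : ℕ) : ℝ) := by exact_mod_cast hM
    _ ≤ p * ((p * l) * (p * l + 1) / 2) := by
      rw [Nat.cast_mul]
      gcongr
      refine Nat.cast_div_le.trans (le_of_eq ?_)
      push_cast
      ring
    _ ≤ _ := h3
    _ ≤ _ := by
      refine mul_le_mul_of_nonneg_right ?_ hs0
      have : (3 : ℝ) / l = 1 / l + 2 / l := by ring
      linarith

variable {σ : Type*} [Fintype σ] [DecidableEq σ]

/-- The number of integer points on a hypersurface, with a free parameter `l`. -/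
theorem card_le_of_irreducible {x y : σ} (hxy : x ≠ y) {f : MvPolynomial σ ℚ} (hf : Irreducible f)
    (hfy : pderiv y f ≠ 0) (hd : 0 < f.totalDegree) {l N s D E K : ℕ} {Λ : ℝ} (hl : 2 ≤ l)
    (hDl : D = min f.totalDegree l * l) (hs : s = exponentCount (min f.totalDegree l) D)
    (hΛ : Λ = (N + 1 : ℝ) ^ ((1 : ℝ) / f.totalDegree + 3 / l))
    (hE : f.totalDegree + (s + 1) * (s * (D + s * f.totalDegree))
        + (s + 1) * (1 + s * (2 * f.totalDegree)) ≤ E) (hK : (s + 1) * s ^ 2 ≤ K)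
    {S : Finset (σ → ℤ)} (hS : S ⊆ box σ N) (hSf : ∀ z ∈ S, eval (fun i => (z i : ℚ)) f = 0) :
    (S.card : ℝ) ≤ f.totalDegree * E * (Fintype.card σ * (2 * N) + 1) ^ (Fintype.card σ - 2)
      + (2 * ((1 + K) * N) + 1) ^ (Fintype.card σ - 2) *
        (2 * (f.totalDegree * (E + 4)) * (1 + arcBound s Λ (N + 1))) := by
  have hN : (1 : ℝ) ≤ N + 1 := by linarith [(Nat.cast_nonneg N : (0 : ℝ) ≤ N)]
  have hp0 : 0 < min f.totalDegree l := lt_min hd (by omega)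
  have hDs : D < s := by
    rw [hs, hDl]
    exact lt_exponentCount hp0 (Nat.le_mul_of_pos_right _ (by omega))
  have hlD : l ≤ D := hDl ▸ Nat.le_mul_of_pos_left l hp0
  have hΛ1 : 1 ≤ Λ := hΛ ▸ Real.one_le_rpow hN (by positivity)
  have hB : 0 ≤ arcBound s Λ (N + 1) := by
    have := Real.log_nonneg hN
    rw [arcBound]
    positivity
  obtain ⟨δ, hδd, hδ⟩ := exists_degree_genericSlice hxy hd.ne'
  obtain ⟨δ', hδδ', hδ'⟩ := exists_le_degree_eq δ (d := min f.totalDegree l)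
    (hδd ▸ min_le_left _ _)
  obtain ⟨e, he, heδ, heD, hsum⟩ := exists_exponents δ' D
  rw [hδ', ← hs] at he heδ heD hsum
  rw [hDl] at hsum
  rcases exists_direction_or_exists_hypersurface hxy hf hfy hδ he
    (fun j hj h => heδ j hj (hδδ'.trans h)) heD with ⟨v, hv, hW⟩ | ⟨g, hfg, hgdeg, hg⟩
  · refine card_le_of_direction hxy hf hfy (fun i => (hv i).trans hK) hW heD hDs (by omega) hΛ1
      ?_ hE hS hSf
    rw [hΛ]
    exact rpow_sum_degree_le hd hl hN hsum (hDl ▸ hs)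
  · have hg0 : g ≠ 0 := fun h => hfg (h ▸ dvd_zero f)
    have key := card_common_zeros_le hxy hf.ne_zero hg0 (hf.isRelPrime_iff_not_dvd.mpr hfg) hS hSf
      fun z hz => hg _ (hSf z hz)
    have hgE : g.totalDegree ≤ E := by
      refine hgdeg.trans (le_trans ?_ hE)
      rw [add_assoc]
      refine Nat.add_le_add_left ((Nat.le_mul_of_pos_left _ s.succ_pos).trans
        (Nat.le_add_right _ _)) _
    refine le_add_of_le_of_nonneg ?_ (by positivity)
    calc (S.card : ℝ) ≤ ((f.totalDegree * g.totalDegree *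
        (Fintype.card σ * (2 * N) + 1) ^ (Fintype.card σ - 2) : ℕ) : ℝ) := by exact_mod_cast key
      _ ≤ _ := by
        push_cast
        gcongr

end Hypersurface

section Estimates

theorem exponentCount_min_le (d : ℕ) {l : ℕ} (hl : 2 ≤ l) :
    exponentCount (min d l) (min d l * l) ≤ 2 * l ^ 3 := by
  refine (exponentCount_le _ _).trans ?_
  have h1 : min d l ≤ l := min_le_right _ _
  calc (min d l * l + 1) * min d l ≤ (l * l + 1) * l := by gcongr
    _ ≤ (l * l + l * l) * l := by
      gcongr
      nlinarith
    _ = 2 * l ^ 3 := by ring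

theorem auxiliary_degree_le {d D s l : ℕ} (hd : 1 ≤ d) (hl : 1 ≤ l) (hs : s ≤ 2 * l ^ 3)
    (hD : D ≤ l ^ 2) : d + (s + 1) * (s * (D + s * d)) + (s + 1) * (1 + s * (2 * d))
      ≤ 34 * d * l ^ 9 := by
  have hl3 : 1 ≤ l ^ 3 := Nat.one_le_pow _ _ hl
  have hs1 : s + 1 ≤ 3 * l ^ 3 := by omega
  have h1 : D + s * d ≤ 3 * (d * l ^ 3) := by
    calc D + s * d ≤ l ^ 3 * d + 2 * l ^ 3 * d := by
          gcongr
          calc D ≤ l ^ 2 := hD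
            _ ≤ l ^ 3 := Nat.pow_le_pow_right hl (by norm_num)
            _ ≤ l ^ 3 * d := Nat.le_mul_of_pos_right _ hd
      _ = 3 * (d * l ^ 3) := by ring
  have h2 : 1 + s * (2 * d) ≤ 5 * (d * l ^ 3) := by
    calc 1 + s * (2 * d) ≤ d * l ^ 3 + 2 * l ^ 3 * (2 * d) := by
          gcongr
          exact Nat.mul_pos hd hl3
      _ = 5 * (d * l ^ 3) := by ring
  calc d + (s + 1) * (s * (D + s * d)) + (s + 1) * (1 + s * (2 * d))
      ≤ d * l ^ 9 + 3 * l ^ 3 * (2 * l ^ 3 * (3 * (d * l ^ 3)))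
        + 3 * l ^ 3 * (5 * (d * l ^ 3)) := by
        gcongr
        exact Nat.le_mul_of_pos_right _ (by positivity)
    _ = 19 * d * l ^ 9 + 15 * d * l ^ 6 := by ring
    _ ≤ 19 * d * l ^ 9 + 15 * d * l ^ 9 := by
        gcongr
        norm_num
    _ = 34 * d * l ^ 9 := by ring

theorem one_add_arcBound_le {s l : ℕ} {Λ R : ℝ} (hl : 1 ≤ l) (hs : s ≤ 2 * l ^ 3) (hΛ : 1 ≤ Λ)
    (hR0 : 0 ≤ Real.log R) (hR : Real.log R ≤ l) : 1 + arcBound s Λ R ≤ 1031 * l ^ 16 * Λ := by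
  have hl' : (1 : ℝ) ≤ l := by exact_mod_cast hl
  have hs' : (s : ℝ) ≤ 2 * l ^ 3 := by exact_mod_cast hs
  have hl16 : (1 : ℝ) ≤ l ^ 16 * Λ := one_le_mul_of_one_le_of_one_le (one_le_pow₀ hl') hΛ
  have hl3 : (l : ℝ) ^ 3 ≤ l ^ 16 * Λ :=
    (pow_le_pow_right₀ hl' (by norm_num)).trans (le_mul_of_one_le_right (by positivity) hΛ)
  rw [arcBound]
  generalize Real.log R = t at hR0 hR ⊢
  calc 1 + 2 * (1 + s * (1 + 2 * (8 * s ^ 4 * Λ) * t))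
      ≤ 1 + 2 * (1 + 2 * l ^ 3 * (1 + 2 * (8 * (2 * l ^ 3) ^ 4 * Λ) * l)) := by gcongr
    _ = 3 + 4 * l ^ 3 + 1024 * (l ^ 16 * Λ) := by ring
    _ ≤ _ := by linarith

theorem rpow_le_of_log_le {d l : ℕ} (hd : 0 < d) (hl : 0 < l) {R H : ℝ} (hR : 1 ≤ R) (hH : 1 ≤ H)
    (hRH : R ≤ 2 * H) (hlog : Real.log R ≤ l) :
    R ^ ((1 : ℝ) / d + 3 / l) ≤ 2 * Real.exp 3 * H ^ ((1 : ℝ) / d) := by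
  have hd' : (1 : ℝ) ≤ d := by exact_mod_cast hd
  have hl' : (0 : ℝ) < l := by exact_mod_cast hl
  rw [Real.rpow_add (by linarith)]
  have h1 : R ^ ((1 : ℝ) / d) ≤ 2 * H ^ ((1 : ℝ) / d) := by
    calc R ^ ((1 : ℝ) / d) ≤ (2 * H) ^ ((1 : ℝ) / d) :=
        Real.rpow_le_rpow (by linarith) hRH (by positivity)
      _ = 2 ^ ((1 : ℝ) / d) * H ^ ((1 : ℝ) / d) :=
        Real.mul_rpow (by norm_num) (by linarith)
      _ ≤ 2 ^ (1 : ℝ) * H ^ ((1 : ℝ) / d) := by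
        gcongr
        · norm_num
        · exact div_le_one_of_le₀ hd' (by linarith)
      _ = _ := by rw [Real.rpow_one]
  have h2 : R ^ ((3 : ℝ) / l) ≤ Real.exp 3 := by
    rw [Real.rpow_def_of_pos (by linarith)]
    gcongr
    calc Real.log R * (3 / l) ≤ l * (3 / l) := by gcongr
      _ = 3 := by field_simp
  calc R ^ ((1 : ℝ) / d) * R ^ ((3 : ℝ) / l) ≤ 2 * H ^ ((1 : ℝ) / d) * Real.exp 3 := by gcongr
    _ = _ := by ring

end Estimates

/-- The number of integer points of height at most `H` on an irreducible hypersurface. -/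
theorem card_integer_points_le {n d : ℕ} (hn : 1 < n) (hd : 0 < d) {f : MvPolynomial (Fin n) ℚ}
    (hf : Irreducible f) (hfd : f.totalDegree = d) {H : ℝ} (hH : 2 < H) :
    (Nat.card {x : Fin n → ℤ // (∀ i, |(x i : ℝ)| ≤ H) ∧ eval (fun i => (x i : ℚ)) f = 0} : ℝ) ≤
      ((34 * (2 * n + 1) ^ (n - 2) + 27 ^ (n - 2) * (156712 * Real.exp 3)) *
        6 ^ (9 * (n - 2) + 25)) * (d : ℝ) ^ 2 * H ^ ((n : ℝ) - 2 + 1 / (d : ℝ)) *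
        Real.log H ^ (9 * (n - 2) + 25) := by
  classical
  obtain ⟨y, hfy⟩ := exists_pderiv_ne_zero (hfd.symm ▸ hd.ne' : f.totalDegree ≠ 0)
  obtain ⟨x, hxy⟩ : ∃ x, x ≠ y := by
    have : Nontrivial (Fin n) := Fin.nontrivial_iff_two_le.mpr hn
    exact exists_ne y
  set N := ⌊H⌋₊ with hN
  set l := ⌈2 * Real.log H⌉₊ + 1 with hl
  have hlogH : 1 / 2 < Real.log H := by
    have h1 : Real.log 2 < Real.log H := Real.log_lt_log (by norm_num) hH
    have h2 := Real.log_two_gt_d9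
    linarith
  have hl2 : 2 ≤ l := by
    have : 0 < ⌈2 * Real.log H⌉₊ := Nat.ceil_pos.mpr (by linarith)
    omega
  have hl6 : (l : ℝ) ≤ 6 * Real.log H := by
    have := Nat.ceil_lt_add_one (show 0 ≤ 2 * Real.log H by linarith)
    rw [hl]
    push_cast
    linarith
  have hNH : (N : ℝ) ≤ H := Nat.floor_le (by linarith)
  have hN0 : (0 : ℝ) ≤ N := Nat.cast_nonneg N
  have hNH2 : (N : ℝ) + 1 ≤ 2 * H := by linarith
  have hlogN : Real.log (N + 1) ≤ l := by
    have h1 : Real.log (N + 1) ≤ Real.log (H ^ 2) :=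
      Real.log_le_log (by linarith) (by nlinarith)
    rw [Real.log_pow] at h1
    have := Nat.le_ceil (2 * Real.log H)
    rw [hl]
    push_cast at h1 ⊢
    linarith
  set S := (box (Fin n) N).filter fun z => eval (fun i => (z i : ℚ)) f = 0 with hS
  have hcard : Nat.card {x : Fin n → ℤ // (∀ i, |(x i : ℝ)| ≤ H) ∧
      eval (fun i => (x i : ℚ)) f = 0} = S.card := by
    rw [← Nat.card_eq_finsetCard]
    refine Nat.card_congr (Equiv.subtypeEquivRight fun z => ?_)
    rw [hS, mem_filter, box, Fintype.mem_piFinset]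
    refine and_congr_left fun _ => forall_congr' fun i => ?_
    rw [mem_Icc, ← abs_le, ← Int.cast_abs]
    constructor
    · intro h
      have h1 : (((z i).natAbs : ℕ) : ℝ) ≤ H := by rwa [Nat.cast_natAbs]
      rw [Int.abs_eq_natAbs]
      exact_mod_cast Nat.le_floor h1
    · intro h
      have : ((|z i| : ℤ) : ℝ) ≤ N := by exact_mod_cast h
      exact this.trans hNH
  rw [hcard]
  set D := min d l * l with hD
  set s := exponentCount (min d l) D with hs
  have hs3 : s ≤ 2 * l ^ 3 := exponentCount_min_le d hl2
  have hD2 : D ≤ l ^ 2 := by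
    rw [hD, pow_two]
    exact Nat.mul_le_mul_right _ (min_le_right _ _)
  have hK : (s + 1) * s ^ 2 ≤ 12 * l ^ 9 := by
    have hl3 : 1 ≤ l ^ 3 := Nat.one_le_pow _ _ (by omega)
    calc (s + 1) * s ^ 2 ≤ (3 * l ^ 3) * (2 * l ^ 3) ^ 2 := by
          gcongr
          omega
      _ = 12 * l ^ 9 := by ring
  set Λ := (N + 1 : ℝ) ^ ((1 : ℝ) / d + 3 / l) with hΛ
  have hΛ1 : 1 ≤ Λ := Real.one_le_rpow (by linarith) (by positivity)
  have hE := auxiliary_degree_le hd (by omega : 1 ≤ l) hs3 hD2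
  have key := card_le_of_irreducible (N := N) (E := 34 * d * l ^ 9) (Λ := Λ) hxy hf hfy (hfd.symm ▸ hd) hl2 (by rw [hfd])
    (by rw [hfd]) (by rw [hfd]) (by rw [hfd]; exact hE) hK (filter_subset _ _ : S ⊆ _)
    fun z hz => (mem_filter.mp hz).2
  rw [hfd, Fintype.card_fin] at key
  push_cast at key
  refine key.trans ?_
  have hl1 : (1 : ℝ) ≤ l := by exact_mod_cast (by omega : 1 ≤ l)
  have hd1 : (1 : ℝ) ≤ d := by exact_mod_cast hd
  have hHd : 1 ≤ H ^ ((1 : ℝ) / d) := Real.one_le_rpow (by linarith) (by positivity)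
  have hHn : H ^ ((n : ℝ) - 2 + 1 / (d : ℝ)) = H ^ (n - 2) * H ^ ((1 : ℝ) / d) := by
    rw [Real.rpow_add (by linarith), ← Real.rpow_natCast H (n - 2), Nat.cast_sub hn]
    norm_num
  have hA := one_add_arcBound_le (R := N + 1) (by omega : 1 ≤ l) hs3 hΛ1
    (Real.log_nonneg (by linarith)) hlogN
  have hΛH := rpow_le_of_log_le (R := N + 1) hd (by omega : 0 < l) (by linarith)
    (by linarith : 1 ≤ H) hNH2 hlogN
  rw [← hΛ] at hΛH
  have hl9 : (1 : ℝ) ≤ l ^ 9 := one_le_pow₀ hl1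
  have hA0 : 0 ≤ 1 + arcBound s Λ (N + 1) := by
    have := Real.log_nonneg (show (1 : ℝ) ≤ N + 1 by linarith)
    rw [arcBound]
    positivity
  have hfirst : (d : ℝ) * (34 * d * l ^ 9) * (n * (2 * N) + 1) ^ (n - 2) ≤
      34 * (2 * n + 1) ^ (n - 2) * d ^ 2 * (H ^ (n - 2) * H ^ ((1 : ℝ) / d)) *
        l ^ (9 * (n - 2) + 25) := by
    calc (d : ℝ) * (34 * d * l ^ 9) * (n * (2 * N) + 1) ^ (n - 2)
        ≤ d * (34 * d * l ^ (9 * (n - 2) + 25)) * ((2 * n + 1) * H) ^ (n - 2) := by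
          gcongr
          · omega
          · have : (n : ℝ) * N ≤ n * H := by gcongr
            linarith
      _ = 34 * (2 * n + 1) ^ (n - 2) * d ^ 2 * (H ^ (n - 2) * 1) *
          l ^ (9 * (n - 2) + 25) := by rw [mul_pow]; ring
      _ ≤ _ := by gcongr
  have hsecond : (2 * ((1 + 12 * l ^ 9) * N) + 1 : ℝ) ^ (n - 2) *
      (2 * (d * (34 * d * l ^ 9 + 4)) * (1 + arcBound s Λ (N + 1))) ≤
      27 ^ (n - 2) * (156712 * Real.exp 3) * d ^ 2 * (H ^ (n - 2) * H ^ ((1 : ℝ) / d)) *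
        l ^ (9 * (n - 2) + 25) := by
    have hbase : (2 * ((1 + 12 * l ^ 9) * N) + 1 : ℝ) ≤ 27 * l ^ 9 * H := by
      have h1 : (1 + 12 * l ^ 9 : ℝ) * N ≤ 13 * l ^ 9 * H := by
        gcongr
        linarith
      have h2 : (1 : ℝ) ≤ l ^ 9 * H := one_le_mul_of_one_le_of_one_le hl9 (by linarith)
      linarith
    have hdeg : (34 * d * l ^ 9 + 4 : ℝ) ≤ 38 * d * l ^ 9 := by
      have := one_le_mul_of_one_le_of_one_le hd1 hl9
      linarith
    calc (2 * ((1 + 12 * l ^ 9) * N) + 1 : ℝ) ^ (n - 2) *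
        (2 * (d * (34 * d * l ^ 9 + 4)) * (1 + arcBound s Λ (N + 1)))
        ≤ (27 * l ^ 9 * H) ^ (n - 2) * (2 * (d * (38 * d * l ^ 9)) *
          (1031 * l ^ 16 * (2 * Real.exp 3 * H ^ ((1 : ℝ) / d)))) := by
          gcongr
          exact hA.trans (by gcongr)
      _ = _ := by
        rw [mul_pow, mul_pow, ← pow_mul, pow_add]
        ring
  calc _ ≤ _ := add_le_add hfirst hsecond
    _ = (34 * (2 * n + 1) ^ (n - 2) + 27 ^ (n - 2) * (156712 * Real.exp 3)) * d ^ 2 *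
        (H ^ (n - 2) * H ^ ((1 : ℝ) / d)) * l ^ (9 * (n - 2) + 25) := by ring
    _ ≤ (34 * (2 * n + 1) ^ (n - 2) + 27 ^ (n - 2) * (156712 * Real.exp 3)) * d ^ 2 *
        (H ^ (n - 2) * H ^ ((1 : ℝ) / d)) * (6 * Real.log H) ^ (9 * (n - 2) + 25) := by
        gcongr
    _ = _ := by
      rw [hHn, mul_pow]
      ring

end BombieriPila

open MvPolynomial

/-- Let `n > 1`.  There are constants `c = c(n)` and `κ = κ(n)` such that for
every irreducible `f ∈ ℚ[x₁,…,x_n]` of degree `d > 0` defining the hypersurface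
`X ⊆ 𝔸ⁿ_ℚ` and every real `H > 2`, one has
`#X(ℤ,H) ≤ c·d²·H^(n−2+1/d)·(log H)^κ`. -/
theorem statement2 (n : ℕ) (hn : 1 < n) :
    ∃ c : ℝ, ∃ κ : ℕ, ∀ (d : ℕ), 0 < d →
      ∀ f : MvPolynomial (Fin n) ℚ, Irreducible f → f.totalDegree = d →
      ∀ H : ℝ, 2 < H →
      (Nat.card {x : Fin n → ℤ //
          (∀ i, |(x i : ℝ)| ≤ H) ∧ eval (fun i => (x i : ℚ)) f = 0} : ℝ)
        ≤ c * (d : ℝ) ^ 2 * H ^ ((n : ℝ) - 2 + 1 / (d : ℝ)) * Real.log H ^ κ := by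
  exact ⟨(34 * (2 * n + 1) ^ (n - 2) + 27 ^ (n - 2) * (156712 * Real.exp 3)) *
    6 ^ (9 * (n - 2) + 25), 9 * (n - 2) + 25, fun d hd f hf hfd H hH =>
    BombieriPila.card_integer_points_le hn hd hf hfd hH⟩
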